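/- Let W4 be the wheel with four spokes (hub 0 joined to the 4-cycle 1-2-3-4-1, 8 edges), fix any edge e0 of W4 with endpoints u, v, and let G = W4 − e0 with marked vertices u, v (a three-loop propagator graph: |E| = 7, loop number h = 3). Let ψ, φ be its Kirchhoff and second Symanzik polynomials. Then for all naturals k, k1, ..., k7, the coefficient integral ∫_{(0,∞)^6} (ψφ)^{-1} · ln^k(ψ^4/φ^3) · Π_{i=1}^7 ln^{k_i}(α_{e_i} ψ/φ) dα_{e_1}...dα_{e_6}, evaluated at α_{e_7} = 1, is absolutely convergent and its value is a rational linear combination of 1 and multiple zeta values. -/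

import Mathlib

open MeasureTheory SimpleGraph Finset

noncomputable section

open Classical in
/-- The Kirchhoff (first Symanzik) polynomial, as a real-valued function, of the
graph whose edges are listed by `ed : Fin m → Sym2 V`: the sum over all (index
sets of) spanning trees `S` of the product of the variables `x i` over `i ∉ S`. -/
def psiI {V : Type} [Fintype V] [DecidableEq V] {m : ℕ}
    (ed : Fin m → Sym2 V) (x : Fin m → ℝ) : ℝ :=
  ∑ S : Finset (Fin m),
    if (SimpleGraph.fromEdgeSet (↑(S.image ed) : Set (Sym2 V))).IsTree then
      ∏ i ∈ Sᶜ, x i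
    else 0

open Classical in
/-- The second Symanzik polynomial with marked vertices `u`, `v`, as a real-valued
function: the sum over all (index sets of) spanning 2-forests (acyclic spanning
subgraphs with exactly two connected components) separating `u` from `v`, of the
product of the variables `x i` over the complementary indices. -/
def phiI {V : Type} [Fintype V] [DecidableEq V] {m : ℕ}
    (ed : Fin m → Sym2 V) (u v : V) (x : Fin m → ℝ) : ℝ :=
  ∑ S : Finset (Fin m),
    if ((SimpleGraph.fromEdgeSet (↑(S.image ed) : Set (Sym2 V))).IsAcyclic ∧
        Nat.card (SimpleGraph.fromEdgeSet (↑(S.image ed) : Set (Sym2 V))).ConnectedComponent = 2 ∧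
        ¬ (SimpleGraph.fromEdgeSet (↑(S.image ed) : Set (Sym2 V))).Reachable u v) then
      ∏ i ∈ Sᶜ, x i
    else 0

/-- The multiple zeta value `ζ(n₁,…,n_d) = ∑_{1 ≤ k₁ < … < k_d} k₁^{-n₁} ⋯ k_d^{-n_d}`. -/
def multipleZeta {d : ℕ} (n : Fin d → ℕ) : ℝ :=
  ∑' k : {k : Fin d → ℕ // StrictMono k ∧ ∀ i, 0 < k i},
    ∏ i, ((k.1 i : ℝ) ^ n i)⁻¹

/-- The set of multiple zeta values `ζ(n₁,…,n_d)` with all `nᵢ ≥ 1` and `n_d ≥ 2`. -/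
def mzvSet : Set ℝ :=
  {x | ∃ (d : ℕ) (n : Fin (d + 1) → ℕ),
    (∀ i, 0 < n i) ∧ 2 ≤ n (Fin.last d) ∧ x = multipleZeta n}

/-- The open positive orthant `(0, ∞)^m`. -/
def posOrthant (m : ℕ) : Set (Fin m → ℝ) := Set.univ.pi fun _ => Set.Ioi 0

/-- The coefficient integrand `ψ^a · φ^b · ln^k(ψ^c/φ^d) · ∏ᵢ ln^{kᵢ}(αᵢ ψ/φ)` of a
propagator graph with edges `ed`, marked vertices `u`, `v`, in the affine chart where
the last Schwinger variable is set to `1` (via `Fin.snoc y 1`). -/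
def coeffIntegrand {V : Type} [Fintype V] [DecidableEq V] {m : ℕ}
    (ed : Fin (m + 1) → Sym2 V) (u v : V) (a b : ℤ) (c d : ℕ) (k : ℕ)
    (kk : Fin (m + 1) → ℕ) (y : Fin m → ℝ) : ℝ :=
  let x : Fin (m + 1) → ℝ := Fin.snoc y 1
  psiI ed x ^ a * phiI ed u v x ^ b *
    Real.log (psiI ed x ^ c / phiI ed u v x ^ d) ^ k *
    ∏ i, Real.log (x i * psiI ed x / phiI ed u v x) ^ kk i

/-- The wheel with four spokes: hub `0` joined to each vertex of the rim cycle
`1 - 2 - 3 - 4 - 1`. -/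
def W4 : SimpleGraph (Fin 5) :=
  SimpleGraph.fromEdgeSet {s(0, 1), s(0, 2), s(0, 3), s(0, 4), s(1, 2), s(2, 3), s(3, 4), s(4, 1)}

namespace FW
open Filter Topology

/-- division by the index, as a linear map -/
def dv : (ℕ → ℝ) →ₗ[ℝ] (ℕ → ℝ) where
  toFun T n := T n / n
  map_add' a b := by ext n; simp [add_div]
  map_smul' c a := by ext n; simp [mul_div_assoc]

/-- partial sums of `T j / j` -/
def Sm : (ℕ → ℝ) →ₗ[ℝ] (ℕ → ℝ) where
  toFun T n := ∑ j ∈ range n, T (j + 1) / ((j : ℝ) + 1)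
  map_add' a b := by ext n; simp [add_div, sum_add_distrib]
  map_smul' c a := by ext n; simp [mul_div_assoc, mul_sum]

lemma dv_apply (T : ℕ → ℝ) (n : ℕ) : dv T n = T n / n := rfl
lemma Sm_apply (T : ℕ → ℝ) (n : ℕ) : Sm T n = ∑ j ∈ range n, T (j + 1) / ((j : ℝ) + 1) := rfl
lemma Sm_zero (T : ℕ → ℝ) : Sm T 0 = 0 := by simp [Sm_apply]
lemma Sm_succ (T : ℕ → ℝ) (n : ℕ) : Sm T (n + 1) = Sm T n + T (n + 1) / ((n : ℝ) + 1) := by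
  simp [Sm_apply, sum_range_succ]

lemma dv_mul (a b : ℕ → ℝ) : dv a * b = dv (a * b) := by
  ext n; simp [dv_apply]; ring
lemma mul_dv (a b : ℕ → ℝ) : a * dv b = dv (a * b) := by
  ext n; simp [dv_apply]; ring

lemma Sm_mul (a b : ℕ → ℝ) : Sm a * Sm b = Sm (a * Sm b + Sm a * b - dv (a * b)) := by
  ext n
  induction n with
  | zero => simp [Sm_zero]
  | succ n ih =>
    rw [Sm_succ, ← ih]
    simp only [Pi.mul_apply, Pi.add_apply, Pi.sub_apply, Sm_succ, dv_apply]
    have : (n : ℝ) + 1 ≠ 0 := by positivity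
    push_cast
    field_simp
    ring

/-- basic nested sums -/
def Tw : List Bool → ℕ → ℝ
  | [] => 1
  | false :: w => dv (Tw w)
  | true :: w => Sm (Tw w)

section
variable (K : Subalgebra ℚ ℝ)

/-- span of nested sums -/
def TS : Submodule K (ℕ → ℝ) := Submodule.span K (Set.range Tw)

variable {K}
lemma Tw_mem (w : List Bool) : Tw w ∈ TS K := Submodule.subset_span ⟨w, rfl⟩
lemma one_memTS : (1 : ℕ → ℝ) ∈ TS K := Tw_mem []
lemma map_memTS (f : (ℕ → ℝ) →ₗ[ℝ] (ℕ → ℝ)) (P : Submodule K (ℕ → ℝ)) (h : ∀ w, f (Tw w) ∈ P)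
    {T : ℕ → ℝ} (hT : T ∈ TS K) : f T ∈ P := by
  induction hT using Submodule.span_induction with
  | mem x hx => obtain ⟨w, rfl⟩ := hx; exact h w
  | zero => rw [map_zero]; exact zero_mem _
  | add x y _ _ hx hy => rw [map_add]; exact add_mem hx hy
  | smul c x _ hx => 
    have : f (c • x) = c • f x := by
      have := f.map_smul (c : ℝ) x
      exact this
    rw [this]; exact Submodule.smul_mem _ _ hx
lemma dv_memTS {T : ℕ → ℝ} (hT : T ∈ TS K) : dv T ∈ TS K :=
  map_memTS dv _ (fun w => Tw_mem (false :: w)) hT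
lemma Sm_memTS {T : ℕ → ℝ} (hT : T ∈ TS K) : Sm T ∈ TS K :=
  map_memTS Sm _ (fun w => Tw_mem (true :: w)) hT

lemma Tw_mul (w w' : List Bool) : Tw w * Tw w' ∈ TS K := by
  induction w generalizing w' with
  | nil => simpa [Tw] using Tw_mem w'
  | cons b w ih =>
    cases b with
    | false => rw [Tw, dv_mul]; exact dv_memTS (ih w')
    | true =>
      induction w' with
      | nil => simpa [Tw] using Sm_memTS (Tw_mem w)
      | cons b w' ih' =>
        cases b with
        | false => rw [Tw.eq_2, mul_dv]; exact dv_memTS ih'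
        | true =>
          have h1 := ih (true :: w')
          rw [Tw] at h1 ih'
          rw [Tw, Tw, Sm_mul]
          exact Sm_memTS (sub_mem (add_mem h1 ih') (dv_memTS (ih w')))

lemma mul_memTS {a b : ℕ → ℝ} (ha : a ∈ TS K) (hb : b ∈ TS K) : a * b ∈ TS K := by
  have key : ∀ w, Tw w * b ∈ TS K := by
    intro w
    exact map_memTS (LinearMap.mulLeft ℝ (Tw w)) _ (fun w' => by simpa using Tw_mul w w') hb
  have := map_memTS (LinearMap.mulRight ℝ b) (TS K) (fun w' => by simpa using key w') ha
  simpa using this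

lemma const_memTS {c : ℝ} (hc : c ∈ K) : (fun _ => c : ℕ → ℝ) ∈ TS K := by
  have := (TS K).smul_mem (⟨c, hc⟩ : K) one_memTS
  convert this using 1
  ext n; simp [Algebra.smul_def]

lemma smul_memTS {c : ℝ} (hc : c ∈ K) {T : ℕ → ℝ} (hT : T ∈ TS K) : c • T ∈ TS K :=
  (TS K).smul_mem (⟨c, hc⟩ : K) hT

lemma natc_mem (n : ℕ) : (n : ℝ) ∈ K := natCast_mem K n

lemma pow_memTS {a : ℕ → ℝ} (ha : a ∈ TS K) (i : ℕ) : a ^ i ∈ TS K := by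
  induction i with
  | zero => simpa using one_memTS
  | succ i ih => rw [pow_succ]; exact mul_memTS ih ha

lemma prod_memTS {ι : Type} (s : Finset ι) (f : ι → ℕ → ℝ) (h : ∀ i ∈ s, f i ∈ TS K) :
    ∏ i ∈ s, f i ∈ TS K := by
  classical
  induction s using Finset.induction_on with
  | empty => simpa using one_memTS
  | insert a s ha ih =>
    rw [prod_insert ha]
    exact mul_memTS (h a (mem_insert_self _ _)) (ih fun i hi => h i (mem_insert_of_mem hi))

/-- square-root growth -/
def Bd (T : ℕ → ℝ) : Prop := ∃ C : ℝ, 0 ≤ C ∧ ∀ n : ℕ, |T (n + 1)| ≤ C * √((n : ℝ) + 1)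

lemma Bd_dv {T : ℕ → ℝ} (h : Bd T) : Bd (dv T) := by
  obtain ⟨C, hC, h⟩ := h
  refine ⟨C, hC, fun n => le_trans ?_ (h n)⟩
  rw [dv_apply, abs_div]
  apply div_le_self (abs_nonneg _)
  push_cast
  rw [abs_of_nonneg (by positivity)]
  linarith [(Nat.cast_nonneg n : (0 : ℝ) ≤ n)]

lemma Bd_Sm {T : ℕ → ℝ} (h : Bd T) : Bd (Sm T) := by
  obtain ⟨C, hC, h⟩ := h
  refine ⟨2 * C, by positivity, ?_⟩
  have key : ∀ n : ℕ, |Sm T n| ≤ 2 * C * √(n : ℝ) := by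
    intro n
    induction n with
    | zero => simp [Sm_zero]
    | succ n ih =>
      rw [Sm_succ]
      refine (abs_add_le _ _).trans ?_
      have h1 : |T (n + 1) / ((n : ℝ) + 1)| ≤ C / √((n : ℝ) + 1) := by
        rw [abs_div, abs_of_pos (by positivity : (0 : ℝ) < n + 1), div_le_div_iff₀ (by positivity) (by positivity)]
        have := mul_le_mul_of_nonneg_right (h n) (Real.sqrt_nonneg ((n : ℝ) + 1))
        rwa [mul_assoc, Real.mul_self_sqrt (by positivity)] at this
      have h2 : 1 / √((n : ℝ) + 1) ≤ 2 * (√((n : ℝ) + 1) - √(n : ℝ)) := by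
        have hs : 0 < √((n : ℝ) + 1) := by positivity
        rw [div_le_iff₀ hs]
        have e1 := Real.mul_self_sqrt (by positivity : (0 : ℝ) ≤ n + 1)
        have e2 := Real.mul_self_sqrt (by positivity : (0 : ℝ) ≤ n)
        nlinarith [sq_nonneg (√((n : ℝ) + 1) - √(n : ℝ))]
      have h3 : C / √((n : ℝ) + 1) = C * (1 / √((n : ℝ) + 1)) := by ring
      push_cast
      nlinarith [mul_le_mul_of_nonneg_left h2 hC]
  intro n
  simpa using key (n + 1)

lemma Bd_of_mem {T : ℕ → ℝ} (hT : T ∈ TS K) : Bd T := by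
  induction hT using Submodule.span_induction with
  | mem x hx =>
    obtain ⟨w, rfl⟩ := hx
    induction w with
    | nil =>
      refine ⟨1, zero_le_one, fun n => ?_⟩
      have : (1 : ℝ) ≤ √((n : ℝ) + 1) := by
        rw [Real.one_le_sqrt]; linarith [(Nat.cast_nonneg n : (0 : ℝ) ≤ n)]
      simp [Tw]
    | cons b w ih => cases b with
      | false => exact Bd_dv ih
      | true => exact Bd_Sm ih
  | zero => exact ⟨0, le_rfl, by simp⟩
  | add x y _ _ hx hy =>
    obtain ⟨C, hC, h⟩ := hx
    obtain ⟨D, hD, h'⟩ := hy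
    refine ⟨C + D, by positivity, fun n => (abs_add_le _ _).trans ?_⟩
    rw [add_mul]; exact add_le_add (h n) (h' n)
  | smul c x _ hx =>
    obtain ⟨C, hC, h⟩ := hx
    refine ⟨|(c : ℝ)| * C, by positivity, fun n => ?_⟩
    have : (c • x) (n + 1) = (c : ℝ) * x (n + 1) := rfl
    rw [this, abs_mul, mul_assoc]
    exact mul_le_mul_of_nonneg_left (h n) (abs_nonneg _)

lemma summable_dv {T : ℕ → ℝ} (hT : T ∈ TS K) :
    Summable fun j : ℕ => |dv T (j + 1) / ((j : ℝ) + 1)| := by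
  obtain ⟨C, hC, h⟩ := Bd_of_mem hT
  have h1 : Summable fun j : ℕ => C * ((((j + 1 : ℕ) : ℝ) ^ (3 / 2 : ℝ))⁻¹) :=
    ((summable_nat_add_iff 1).2 (Real.summable_nat_rpow_inv.2 (by norm_num : (1 : ℝ) < 3 / 2))).mul_left C
  refine Summable.of_nonneg_of_le (fun _ => abs_nonneg _) (fun j => ?_) h1
  have hj : (0 : ℝ) < (j : ℝ) + 1 := by positivity
  rw [dv_apply, abs_div, abs_div]
  push_cast
  rw [abs_of_pos hj, div_div, div_le_iff₀ (by positivity)]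
  refine (h j).trans_eq ?_
  have e : ((j : ℝ) + 1) * ((j : ℝ) + 1) = ((j : ℝ) + 1) ^ (3 / 2 : ℝ) * √((j : ℝ) + 1) := by
    rw [Real.sqrt_eq_rpow, ← Real.rpow_add hj]; norm_num; ring
  rw [e]
  have : ((j : ℝ) + 1) ^ (3 / 2 : ℝ) ≠ 0 := by positivity
  field_simp

lemma tendsto_Sm_dv {T : ℕ → ℝ} (hT : T ∈ TS K) : ∃ x, Tendsto (Sm (dv T)) atTop (𝓝 x) :=
  ⟨_, (summable_dv hT).of_abs.hasSum.tendsto_sum_nat⟩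

end

/-- the ring of numbers `q + ∑ T_j / j^2` -/
def Z : Subalgebra ℚ ℝ where
  carrier := {x | ∃ q : ℚ, ∃ T ∈ TS ⊥, Tendsto (fun n => (q : ℝ) + Sm (dv T) n) atTop (𝓝 x)}
  mul_mem' := by
    rintro x y ⟨q, T, hT, h⟩ ⟨q', T', hT', h'⟩
    have hq : ∀ q : ℚ, (q : ℝ) ∈ (⊥ : Subalgebra ℚ ℝ) := fun q => (⊥ : Subalgebra ℚ ℝ).algebraMap_mem q
    refine ⟨q * q', (q : ℝ) • T' + (q' : ℝ) • T + (T * Sm (dv T') + Sm (dv T) * T' - dv (dv (T * T'))), ?_, ?_⟩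
    · exact add_mem (add_mem (smul_memTS (hq q) hT') (smul_memTS (hq q') hT))
        (sub_mem (add_mem (mul_memTS hT (Sm_memTS (dv_memTS hT'))) (mul_memTS (Sm_memTS (dv_memTS hT)) hT'))
        (dv_memTS (dv_memTS (mul_memTS hT hT'))))
    · convert h.mul h' using 2 with n
      have e := congrFun (Sm_mul (dv T) (dv T')) n
      simp only [dv_mul, mul_dv, ← map_add, ← map_sub] at e
      simp only [map_add, map_sub, map_smul, Pi.add_apply, Pi.sub_apply, Pi.smul_apply, Pi.mul_apply, smul_eq_mul] at e ⊢
      push_cast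
      linear_combination -e
  add_mem' := by
    rintro x y ⟨q, T, hT, h⟩ ⟨q', T', hT', h'⟩
    refine ⟨q + q', T + T', add_mem hT hT', ?_⟩
    convert h.add h' using 2 with n
    simp only [map_add, Pi.add_apply]; push_cast; ring
  algebraMap_mem' q := ⟨q, 0, zero_mem _, by simp⟩

lemma exists_lim {T : ℕ → ℝ} (hT : T ∈ TS Z) : ∃ x ∈ Z, Tendsto (Sm (dv T)) atTop (𝓝 x) := by
  induction hT using Submodule.span_induction with
  | mem x hx =>
    obtain ⟨w, rfl⟩ := hx
    obtain ⟨x, hx⟩ := tendsto_Sm_dv (K := ⊥) (Tw_mem w)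
    exact ⟨x, ⟨0, Tw w, Tw_mem w, by simpa using hx⟩, hx⟩
  | zero => exact ⟨0, zero_mem _, by rw [map_zero, map_zero]; exact tendsto_const_nhds⟩
  | add a b _ _ ha hb =>
    obtain ⟨x, hx, h⟩ := ha
    obtain ⟨y, hy, h'⟩ := hb
    exact ⟨x + y, add_mem hx hy, by rw [map_add, map_add]; exact h.add h'⟩
  | smul c a _ ha =>
    obtain ⟨x, hx, h⟩ := ha
    refine ⟨c * x, mul_mem c.2 hx, ?_⟩
    have e : Sm (dv (c • a)) = fun n => (c : ℝ) * Sm (dv a) n := by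
      have : c • a = (c : ℝ) • a := rfl
      rw [this, map_smul, map_smul]; rfl
    rw [e]; exact h.const_mul _

lemma lim_mem {T : ℕ → ℝ} (hT : T ∈ TS Z) {x : ℝ} (h : Tendsto (Sm (dv T)) atTop (𝓝 x)) : x ∈ Z := by
  obtain ⟨y, hy, h'⟩ := exists_lim hT
  rwa [tendsto_nhds_unique h h']

/-- harmonic numbers -/
def Hn : ℕ → ℝ := Sm 1

/-- allowed limits -/
def Vok (V : ℕ → ℝ) : Prop := V = 1 ∨ ∃ T ∈ TS Z, V = Sm (dv T)

lemma Vok.mem {V : ℕ → ℝ} (h : Vok V) : V ∈ TS Z := by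
  rcases h with rfl | ⟨T, hT, rfl⟩
  · exact one_memTS
  · exact Sm_memTS (dv_memTS hT)

lemma Hn_mem : Hn ∈ TS Z := Sm_memTS one_memTS

lemma Hn_step {V : ℕ → ℝ} (h : Vok V) (i : ℕ) :
    ∃ t ∈ TS Z, Hn ^ (i + 1) * V = Sm (((i : ℝ) + 1) • (Hn ^ i * V) + dv t) := by
  induction i with
  | zero =>
    rcases h with rfl | ⟨T, hT, rfl⟩
    · exact ⟨0, zero_mem _, by simp [Hn]⟩
    · refine ⟨Hn * T - dv T, sub_mem (mul_memTS Hn_mem hT) (dv_memTS hT), ?_⟩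
      simp only [zero_add, pow_one, pow_zero, one_mul, Nat.cast_zero, one_smul]
      rw [Hn, Sm_mul, one_mul, one_mul, mul_dv, map_sub dv]
      congr 1; abel
  | succ i ih =>
    obtain ⟨t, ht, e⟩ := ih
    have hm : Hn ^ i * V ∈ TS Z := mul_memTS (pow_memTS Hn_mem i) h.mem
    refine ⟨Hn * t - (((i : ℝ) + 1) • (Hn ^ i * V) + dv t), sub_mem (mul_memTS Hn_mem ht)
      (add_mem (smul_memTS ?_ hm) (dv_memTS ht)), ?_⟩
    · exact_mod_cast natc_mem (i + 1)
    · rw [pow_succ' Hn (i + 1), mul_assoc, e]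
      nth_rewrite 1 [Hn]
      rw [Sm_mul, one_mul, one_mul, ← e, ← Hn]
      congr 1
      rw [map_sub, mul_add, mul_dv]
      ext n
      simp only [Pi.add_apply, Pi.sub_apply, Pi.mul_apply, Pi.smul_apply, Pi.pow_apply, smul_eq_mul, map_add, map_smul]
      push_cast; ring

/-- regularized form -/
def RS : Submodule Z (ℕ → ℝ) :=
  Submodule.span Z ({f | ∃ i : ℕ, ∃ V, Vok V ∧ f = Hn ^ i * V} ∪ {f | ∃ T ∈ TS Z, f = dv T})

lemma Sm_memRS {T : ℕ → ℝ} (hT : T ∈ RS) : Sm T ∈ RS := by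
  have hS : ∀ t ∈ TS Z, Sm (dv t) ∈ RS := fun t ht =>
    Submodule.subset_span (Or.inl ⟨0, Sm (dv t), Or.inr ⟨t, ht, rfl⟩, by simp⟩)
  induction hT using Submodule.span_induction with
  | mem x hx =>
    rcases hx with ⟨i, V, hV, rfl⟩ | ⟨T, hT, rfl⟩
    · obtain ⟨t, ht, e⟩ := Hn_step hV i
      have hi : ((i : ℝ) + 1)⁻¹ ∈ Z := by
        have : ((i : ℝ) + 1)⁻¹ = algebraMap ℚ ℝ (((i : ℚ) + 1)⁻¹) := by simp
        rw [this]; exact Z.algebraMap_mem _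
      have e2 : Sm (Hn ^ i * V) = (⟨_, hi⟩ : Z) • (Hn ^ (i + 1) * V - Sm (dv t)) := by
        rw [e, map_add, add_sub_cancel_right, map_smul]
        have : ∀ f : ℕ → ℝ, (⟨_, hi⟩ : Z) • f = ((i : ℝ) + 1)⁻¹ • f := fun f => rfl
        rw [this, smul_smul, inv_mul_cancel₀ (by positivity), one_smul]
      rw [e2]
      exact Submodule.smul_mem _ _ (sub_mem (Submodule.subset_span (Or.inl ⟨i + 1, V, hV, rfl⟩)) (hS t ht))
    · exact hS T hT
  | zero => rw [map_zero]; exact zero_mem _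
  | add x y _ _ hx hy => rw [map_add]; exact add_mem hx hy
  | smul c x _ hx =>
    have : Sm (c • x) = c • Sm x := Sm.map_smul (c : ℝ) x
    rw [this]; exact Submodule.smul_mem _ _ hx

lemma TS_le_RS {T : ℕ → ℝ} (hT : T ∈ TS Z) : T ∈ RS := by
  refine Submodule.span_le.2 ?_ hT
  rintro _ ⟨w, rfl⟩
  induction w with
  | nil => exact Submodule.subset_span (Or.inl ⟨0, 1, Or.inl rfl, by simp [Tw]⟩)
  | cons b w ih => cases b with
    | false => exact Submodule.subset_span (Or.inr ⟨Tw w, Tw_mem w, rfl⟩)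
    | true => exact Sm_memRS ih

lemma Hn_tendsto : Tendsto Hn atTop atTop := by
  have := Real.tendsto_sum_range_one_div_nat_succ_atTop
  exact this

lemma Hn_nonneg (n : ℕ) : 0 ≤ Hn n := by
  rw [Hn, Sm_apply]; exact sum_nonneg fun i _ => by simp; positivity

lemma Hn_mono : Monotone Hn := monotone_nat_of_le_succ fun n => by
  rw [Hn, Sm_succ]; simp; positivity

lemma dv_tendsto {T : ℕ → ℝ} (hT : T ∈ TS Z) : Tendsto (dv T) atTop (𝓝 0) := by
  have hs := (summable_dv hT).of_abs.tendsto_atTop_zero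
  obtain ⟨C, hC, h⟩ := Bd_of_mem hT
  rw [← tendsto_add_atTop_iff_nat 1]
  have h1 : Tendsto (fun n : ℕ => C * (√((n : ℝ) + 1))⁻¹) atTop (𝓝 (C * 0)) := by
    refine Tendsto.const_mul _ (tendsto_inv_atTop_zero.comp (Real.tendsto_sqrt_atTop.comp ?_))
    exact tendsto_atTop_add_const_right _ _ tendsto_natCast_atTop_atTop
  rw [mul_zero] at h1
  refine squeeze_zero_norm (fun n => ?_) h1
  rw [dv_apply, Real.norm_eq_abs, abs_div]
  push_cast
  rw [abs_of_pos (by positivity : (0 : ℝ) < n + 1), div_le_iff₀ (by positivity)]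
  refine (h n).trans_eq ?_
  have := Real.mul_self_sqrt (by positivity : (0 : ℝ) ≤ n + 1)
  have h0 : √((n : ℝ) + 1) ≠ 0 := by positivity
  field_simp
  nlinarith

lemma tail_tendsto {T : ℕ → ℝ} (hT : T ∈ TS Z) {c : ℝ} (hc : Tendsto (Sm (dv T)) atTop (𝓝 c)) (i : ℕ) :
    Tendsto (fun n => Hn n ^ i * (Sm (dv T) n - c)) atTop (𝓝 0) := by
  set a : ℕ → ℝ := fun j => dv T (j + 1) / ((j : ℝ) + 1)
  have hsa : Summable a := (summable_dv hT).of_abs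
  have hc' : c = ∑' j, a j := tendsto_nhds_unique hc hsa.hasSum.tendsto_sum_nat
  have hU : Hn ^ i * T ∈ TS Z := mul_memTS (pow_memTS Hn_mem i) hT
  set b : ℕ → ℝ := fun j => |dv (Hn ^ i * T) (j + 1) / ((j : ℝ) + 1)|
  have hsb : Summable b := summable_dv hU
  have hb := tendsto_sum_nat_add b
  refine squeeze_zero_norm (fun n => ?_) hb
  have e1 : Sm (dv T) n - c = - ∑' k, a (k + n) := by
    rw [hc', ← hsa.sum_add_tsum_nat_add n, Sm_apply]; ring
  rw [e1, mul_neg, norm_neg, ← tsum_mul_left]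
  have hle : ∀ k, ‖Hn n ^ i * a (k + n)‖ ≤ b (k + n) := by
    intro k
    have e2 : b (k + n) = Hn (k + n + 1) ^ i * |a (k + n)| := by
      simp only [b, a, ← mul_dv, Pi.mul_apply, Pi.pow_apply]
      rw [mul_div_assoc, abs_mul, abs_of_nonneg (pow_nonneg (Hn_nonneg _) _)]
    rw [e2, norm_mul, Real.norm_eq_abs, Real.norm_eq_abs, abs_of_nonneg (pow_nonneg (Hn_nonneg _) _)]
    gcongr
    · exact Hn_nonneg _
    · exact Hn_mono (by omega)
  exact tsum_of_norm_bounded ((summable_nat_add_iff n).2 hsb).hasSum hle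

lemma RS_asymp {T : ℕ → ℝ} (hT : T ∈ RS) :
    ∃ p : Polynomial Z, Tendsto (fun n => T n - (p.map (algebraMap Z ℝ)).eval (Hn n)) atTop (𝓝 0) := by
  induction hT using Submodule.span_induction with
  | mem x hx =>
    rcases hx with ⟨i, V, hV, rfl⟩ | ⟨T, hT, rfl⟩
    · rcases hV with rfl | ⟨T, hT, rfl⟩
      · exact ⟨Polynomial.X ^ i, by simp⟩
      · obtain ⟨c, hc, h⟩ := exists_lim hT
        refine ⟨Polynomial.C ⟨c, hc⟩ * Polynomial.X ^ i, ?_⟩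
        convert tail_tendsto hT h i using 2 with n
        simp only [Pi.mul_apply, Pi.pow_apply, Polynomial.map_mul, Polynomial.map_C, Polynomial.map_pow,
          Polynomial.map_X, Polynomial.eval_mul, Polynomial.eval_C, Polynomial.eval_pow, Polynomial.eval_X]
        have : algebraMap Z ℝ ⟨c, hc⟩ = c := rfl
        rw [this]; ring
    · exact ⟨0, by simpa using dv_tendsto hT⟩
  | zero => exact ⟨0, by simp⟩
  | add x y _ _ hx hy =>
    obtain ⟨p, hp⟩ := hx
    obtain ⟨q, hq⟩ := hy
    refine ⟨p + q, ?_⟩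
    convert hp.add hq using 2 with n
    · simp; ring
    · simp
  | smul c x _ hx =>
    obtain ⟨p, hp⟩ := hx
    refine ⟨Polynomial.C c * p, ?_⟩
    convert hp.const_mul (c : ℝ) using 2 with n
    · have : (c • x) n = (c : ℝ) * x n := rfl
      have h2 : algebraMap Z ℝ c = (c : ℝ) := rfl
      rw [this, Polynomial.map_mul, Polynomial.eval_mul, Polynomial.map_C, Polynomial.eval_C, h2]; ring
    · simp

/-- regularization: convergent sums `∑ T_n / n` lie in `Z`. -/
lemma reg {T : ℕ → ℝ} (hT : T ∈ TS Z) {x : ℝ} (h : Tendsto (Sm T) atTop (𝓝 x)) : x ∈ Z := by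
  obtain ⟨p, hp⟩ := RS_asymp (TS_le_RS (Sm_memTS hT))
  have h1 : Tendsto (fun n => (p.map (algebraMap Z ℝ)).eval (Hn n)) atTop (𝓝 x) := by
    have := h.sub hp
    simpa using this
  by_cases hd : 0 < (p.map (algebraMap Z ℝ)).degree
  · have h2 := (Polynomial.abs_tendsto_atTop _ hd).comp Hn_tendsto
    exact absurd h1.abs (not_tendsto_nhds_of_tendsto_atTop h2 _)
  · rw [Polynomial.eq_C_of_degree_le_zero (not_lt.1 hd)] at h1
    simp only [Polynomial.eval_C] at h1
    rw [← tendsto_nhds_unique tendsto_const_nhds h1, Polynomial.coeff_map]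
    exact (p.coeff 0).2

end FW

namespace FW
open Filter Topology

/-- truncated multiple zeta values -/
def zsF : (d : ℕ) → (Fin d → ℕ) → ℕ → ℝ
  | 0, _, _ => 1
  | d + 1, n, N => ∑ k ∈ range N, (((k : ℝ) + 1) ^ n (Fin.last d))⁻¹ * zsF d (Fin.init n) k

/-- index tuples bounded by `N` -/
def At : (d : ℕ) → ℕ → Finset (Fin d → ℕ)
  | 0, _ => univ
  | d + 1, N => (range N).biUnion fun k => (At d k).image fun f => (Fin.snoc f (k + 1) : Fin (d + 1) → ℕ)

lemma mem_At (d N : ℕ) (k : Fin d → ℕ) : k ∈ At d N ↔ (StrictMono k ∧ ∀ i, 0 < k i) ∧ ∀ i, k i ≤ N := by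
  induction d generalizing N with
  | zero => simpa [At, Subsingleton.strictMono] using Subsingleton.elim _ _
  | succ d ih =>
    simp only [At, mem_biUnion, mem_image, mem_range]
    constructor
    · rintro ⟨a, ha, f, hf, rfl⟩
      obtain ⟨⟨h1, h2⟩, h3⟩ := (ih a f).1 hf
      refine ⟨⟨?_, ?_⟩, ?_⟩
      · intro i j hij
        induction j using Fin.lastCases with
        | last =>
          induction i using Fin.lastCases with
          | last => exact absurd hij (lt_irrefl _)
          | cast i => simpa using Nat.lt_succ_of_le (h3 i)
        | cast j =>
          induction i using Fin.lastCases with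
          | last => exact absurd hij (not_lt.2 (Fin.le_last _))
          | cast i => simpa using h1 (by simpa using hij)
      · intro i
        induction i using Fin.lastCases with
        | last => simp
        | cast i => simpa using h2 i
      · intro i
        induction i using Fin.lastCases with
        | last => simpa using ha
        | cast i => have := h3 i; simp; omega
    · rintro ⟨⟨h1, h2⟩, h3⟩
      have hl := h2 (Fin.last d)
      have hN := h3 (Fin.last d)
      refine ⟨k (Fin.last d) - 1, by omega, Fin.init k, (ih _ _).2 ⟨⟨?_, ?_⟩, ?_⟩, ?_⟩
      · intro i j hij; exact h1 (by simpa using hij)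
      · intro i; exact h2 _
      · intro i
        have := h1 (Fin.castSucc_lt_last i)
        simp only [Fin.init]; omega
      · rw [Nat.sub_add_cancel (by omega), Fin.snoc_init_self]

lemma sum_At (d : ℕ) (n : Fin d → ℕ) (N : ℕ) :
    ∑ k ∈ At d N, ∏ i, ((k i : ℝ) ^ n i)⁻¹ = zsF d n N := by
  induction d generalizing N with
  | zero => simp [At, zsF]
  | succ d ih =>
    rw [At, sum_biUnion, zsF]
    · refine sum_congr rfl fun k _ => ?_
      rw [sum_image, ← ih, mul_sum]
      · refine sum_congr rfl fun f _ => ?_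
        rw [Fin.prod_univ_castSucc]
        simp [Fin.init, mul_comm]
      · intro f _ g _ h
        have := congrArg Fin.init h
        simpa using this
    · intro a _ b _ hab
      rw [Function.onFun, Finset.disjoint_left]
      intro x hx hy
      simp only [mem_image] at hx hy
      obtain ⟨f, _, rfl⟩ := hx
      obtain ⟨g, _, h⟩ := hy
      have := congrFun h (Fin.last d)
      simp at this
      exact hab this.symm

lemma mzv_of_tendsto (d : ℕ) (n : Fin d → ℕ) {x : ℝ} (h : Tendsto (zsF d n) atTop (𝓝 x)) :
    multipleZeta n = x := by
  classical
  set p : (Fin d → ℕ) → Prop := fun k => StrictMono k ∧ ∀ i, 0 < k i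
  set f : {k : Fin d → ℕ // p k} → ℝ := fun k => ∏ i, ((k.1 i : ℝ) ^ n i)⁻¹
  have hf : ∀ k, 0 ≤ f k := fun k => prod_nonneg fun i _ => by positivity
  set A : ℕ → Finset {k : Fin d → ℕ // p k} := fun N => (At d N).subtype p
  have hA : ∀ N, ∑ k ∈ A N, f k = zsF d n N := by
    intro N
    rw [← sum_At]
    exact sum_subtype_of_mem (fun k : Fin d → ℕ => ∏ i, ((k i : ℝ) ^ n i)⁻¹) fun k hk => ((mem_At d N k).1 hk).1
  have hmono : Monotone A := by
    intro M N hMN k hk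
    simp only [A, mem_subtype, mem_At] at hk ⊢
    exact ⟨hk.1, fun i => (hk.2 i).trans hMN⟩
  have hex : ∀ k, ∃ N, k ∈ A N := by
    intro k
    refine ⟨∑ i, k.1 i, ?_⟩
    simp only [A, mem_subtype, mem_At]
    exact ⟨k.2, fun i => single_le_sum (f := fun i => k.1 i) (fun _ _ => Nat.zero_le _) (mem_univ i)⟩
  have ht := tendsto_atTop_finset_of_monotone hmono hex
  have hzm : Monotone (zsF d n) := fun M N hMN => by
    rw [← hA, ← hA]
    exact sum_le_sum_of_subset_of_nonneg (hmono hMN) fun k _ _ => hf k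
  have hs : Summable f := by
    refine summable_of_sum_le hf (c := x) fun s => ?_
    obtain ⟨N, hN⟩ := (ht.eventually_ge_atTop s).exists
    refine (sum_le_sum_of_subset_of_nonneg hN fun k _ _ => hf k).trans ?_
    rw [hA]
    exact hzm.ge_of_tendsto h N
  have h2 : Tendsto (fun N => ∑ k ∈ A N, f k) atTop (𝓝 (∑' k, f k)) := hs.hasSum.comp ht
  simp only [hA] at h2
  exact tendsto_nhds_unique h2 h

/-- generators `(n+1)^{-i} zs n` -/
def QS : Submodule ℚ (ℕ → ℝ) :=
  Submodule.span ℚ {f | ∃ (i d : ℕ) (n : Fin d → ℕ), (∀ j, 0 < n j) ∧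
    f = fun N : ℕ => ((((N : ℝ) + 1) ^ i)⁻¹ * zsF d n N)}

lemma zsF_snoc (d : ℕ) (n : Fin d → ℕ) (a N : ℕ) :
    zsF (d + 1) (Fin.snoc n a : Fin (d + 1) → ℕ) N = ∑ k ∈ range N, (((k : ℝ) + 1) ^ a)⁻¹ * zsF d n k := by
  simp [zsF]

lemma Tw_QS (w : List Bool) : (fun n => Tw w (n + 1)) ∈ QS := by
  induction w with
  | nil => exact Submodule.subset_span ⟨0, 0, Fin.elim0, fun j => j.elim0, by ext; simp [Tw, zsF]⟩
  | cons b w ih =>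
    have hpos : ∀ (d : ℕ) (n : Fin d → ℕ) (i : ℕ), (∀ j, 0 < n j) → ∀ j, 0 < (Fin.snoc n (i + 1) : Fin (d + 1) → ℕ) j := by
      intro d n i hn j
      induction j using Fin.lastCases with
      | last => simp
      | cast j => simpa using hn j
    cases b with
    | false =>
      have key : ∀ f ∈ QS, (fun n : ℕ => f n / ((n : ℝ) + 1)) ∈ QS := by
        intro f hf
        induction hf using Submodule.span_induction with
        | mem x hx =>
          obtain ⟨i, d, n, hn, rfl⟩ := hx
          refine Submodule.subset_span ⟨i + 1, d, n, hn, ?_⟩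
          ext N; rw [pow_succ, mul_inv]; ring
        | zero => simp only [Pi.zero_apply, zero_div, sum_const_zero]; exact zero_mem QS
        | add x y _ _ hx hy => convert add_mem hx hy using 1; ext n; simp [add_div]
        | smul c x _ hx => convert QS.smul_mem c hx using 1; ext n; simp [Rat.smul_def, mul_div_assoc]
      convert key _ ih using 1
      ext n; simp [Tw, dv_apply]
    | true =>
      have key : ∀ f ∈ QS, (fun n : ℕ => ∑ j ∈ range (n + 1), f j / ((j : ℝ) + 1)) ∈ QS := by
        intro f hf
        induction hf using Submodule.span_induction with
        | mem x hx =>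
          obtain ⟨i, d, n, hn, rfl⟩ := hx
          have e : (fun N : ℕ => ∑ j ∈ range (N + 1), ((((j : ℝ) + 1) ^ i)⁻¹ * zsF d n j) / ((j : ℝ) + 1)) =
              (fun N : ℕ => ((((N : ℝ) + 1) ^ 0)⁻¹ * zsF (d + 1) (Fin.snoc n (i + 1) : Fin (d + 1) → ℕ) N)) +
              fun N : ℕ => ((((N : ℝ) + 1) ^ (i + 1))⁻¹ * zsF d n N) := by
            ext N
            simp only [Pi.add_apply, zsF_snoc, pow_zero, inv_one, one_mul, sum_range_succ, pow_succ, mul_inv]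
            congr 1
            · exact sum_congr rfl fun k _ => by ring
            · ring
          rw [e]
          exact add_mem (Submodule.subset_span ⟨0, d + 1, _, hpos d n i hn, rfl⟩)
            (Submodule.subset_span ⟨i + 1, d, n, hn, rfl⟩)
        | zero => simp only [Pi.zero_apply, zero_div, sum_const_zero]; exact zero_mem QS
        | add x y _ _ hx hy => convert add_mem hx hy using 1; ext n; simp [add_div, sum_add_distrib]
        | smul c x _ hx => convert QS.smul_mem c hx using 1; ext n; simp [Rat.smul_def, mul_div_assoc, mul_sum]
      exact key _ ih

lemma Z_le {x : ℝ} (hx : x ∈ Z) : x ∈ Submodule.span ℚ (insert (1 : ℝ) mzvSet) := by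
  obtain ⟨q, T, hT, h⟩ := hx
  have hQ : (fun n => T (n + 1)) ∈ QS := by
    clear h
    induction hT using Submodule.span_induction with
    | mem x hx => obtain ⟨w, rfl⟩ := hx; exact Tw_QS w
    | zero => exact zero_mem QS
    | add x y _ _ hx hy => exact add_mem hx hy
    | smul c x _ hx =>
      obtain ⟨c, hc⟩ := c
      obtain ⟨r, rfl⟩ := Algebra.mem_bot.1 hc
      convert QS.smul_mem r hx using 1
      ext n; simp [Rat.smul_def, Subalgebra.smul_def]
  have key : ∀ f ∈ QS, ∃ c : ℝ, Tendsto (fun N => ∑ k ∈ range N, (((k : ℝ) + 1) ^ 2)⁻¹ * f k) atTop (𝓝 c) ∧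
      c ∈ Submodule.span ℚ (insert (1 : ℝ) mzvSet) := by
    intro f hf
    induction hf using Submodule.span_induction with
    | mem x hx =>
      obtain ⟨i, d, n, hn, rfl⟩ := hx
      have e : (fun N : ℕ => ∑ k ∈ range N, (((k : ℝ) + 1) ^ 2)⁻¹ * ((((k : ℝ) + 1) ^ i)⁻¹ * zsF d n k)) =
          zsF (d + 1) (Fin.snoc n (i + 2) : Fin (d + 1) → ℕ) := by
        ext N; rw [zsF_snoc]
        refine sum_congr rfl fun k _ => ?_
        rw [pow_add, mul_inv]; ring
      have hb : ∀ (d : ℕ) (n : Fin d → ℕ), (∀ j, 0 < n j) → ∃ T ∈ TS ⊥, ∀ N : ℕ, 0 ≤ zsF d n N ∧ zsF d n N ≤ T (N + 1) := by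
        intro d n hn
        induction d with
        | zero => exact ⟨1, one_memTS, fun N => by simp [zsF]⟩
        | succ d ih =>
          obtain ⟨T, hT, h⟩ := ih (Fin.init n) fun j => hn _
          have hle : ∀ k : ℕ, (((k : ℝ) + 1) ^ n (Fin.last d))⁻¹ * zsF d (Fin.init n) k ≤ T (k + 1) / ((k : ℝ) + 1) := by
            intro k
            rw [div_eq_inv_mul]
            have h1 : (1 : ℝ) ≤ (k : ℝ) + 1 := by linarith [(Nat.cast_nonneg k : (0 : ℝ) ≤ k)]
            have h2 : ((k : ℝ) + 1) ≤ ((k : ℝ) + 1) ^ n (Fin.last d) := le_self_pow₀ h1 (hn _).ne'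
            have h3 := (h k).1
            have h4 := (h k).2
            gcongr
          have h0 : ∀ k : ℕ, 0 ≤ (((k : ℝ) + 1) ^ n (Fin.last d))⁻¹ * zsF d (Fin.init n) k := fun k =>
            mul_nonneg (by positivity) (h k).1
          refine ⟨Sm T, Sm_memTS hT, fun N => ⟨sum_nonneg fun k _ => h0 k, ?_⟩⟩
          rw [Sm_succ, zsF, Sm_apply]
          have := sum_le_sum fun k (_ : k ∈ range N) => hle k
          linarith [h0 N, hle N]
      obtain ⟨T, hT, hTb⟩ := hb d n hn
      rw [e]
      have hs : Summable fun k : ℕ => (((k : ℝ) + 1) ^ (i + 2))⁻¹ * zsF d n k := by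
        refine Summable.of_nonneg_of_le (fun k => mul_nonneg (by positivity) (hTb k).1) (fun k => ?_) (summable_dv hT)
        refine le_trans ?_ (le_abs_self _)
        rw [dv_apply, div_div, div_eq_inv_mul]
        push_cast
        have h1 : (1 : ℝ) ≤ (k : ℝ) + 1 := by linarith [(Nat.cast_nonneg k : (0 : ℝ) ≤ k)]
        have h2 : ((k : ℝ) + 1) * ((k : ℝ) + 1) ≤ ((k : ℝ) + 1) ^ (i + 2) := by
          rw [← sq]; exact pow_le_pow_right₀ h1 (by omega)
        have h3 := (hTb k).1
        have h4 := (hTb k).2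
        gcongr
      have ht : Tendsto (zsF (d + 1) (Fin.snoc n (i + 2) : Fin (d + 1) → ℕ)) atTop
          (𝓝 (∑' k : ℕ, (((k : ℝ) + 1) ^ (i + 2))⁻¹ * zsF d n k)) := by
        have := hs.hasSum.tendsto_sum_nat
        convert this using 2 with N
        rw [zsF_snoc]
      refine ⟨_, ht, Submodule.subset_span (Or.inr ⟨d, Fin.snoc n (i + 2), ?_, by simp, (mzv_of_tendsto _ _ ht).symm⟩)⟩
      intro j
      induction j using Fin.lastCases with
      | last => simp
      | cast j => simpa using hn j
    | zero => exact ⟨0, by simp, zero_mem _⟩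
    | add a b _ _ ha hb =>
      obtain ⟨x, hx, hx'⟩ := ha
      obtain ⟨y, hy, hy'⟩ := hb
      refine ⟨x + y, ?_, add_mem hx' hy'⟩
      convert hx.add hy using 2 with N
      simp [mul_add, sum_add_distrib]
    | smul c a _ ha =>
      obtain ⟨x, hx, hx'⟩ := ha
      refine ⟨c • x, ?_, Submodule.smul_mem _ _ hx'⟩
      convert hx.const_smul c using 2 with N
      simp only [Pi.smul_apply, smul_sum, mul_smul_comm]
  obtain ⟨c, hc, hc'⟩ := key _ hQ
  have h2 : Tendsto (fun n => (q : ℝ) + Sm (dv T) n) atTop (𝓝 (q + c)) := by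
    refine tendsto_const_nhds.add ?_
    convert hc using 2 with N
    rw [Sm_apply]
    refine sum_congr rfl fun k _ => ?_
    rw [dv_apply, sq, mul_inv]; push_cast; ring
  rw [tendsto_nhds_unique h h2]
  refine add_mem ?_ hc'
  have : (q : ℝ) = q • (1 : ℝ) := by simp [Rat.smul_def]
  rw [this]
  exact Submodule.smul_mem _ _ (Submodule.subset_span (Or.inl rfl))

end FW

namespace FW
open Filter Topology ENNReal

/-- Lebesgue measure on the unit interval -/
def U : Measure ℝ := volume.restrict (Set.Ioo (0 : ℝ) 1)

instance : IsFiniteMeasure U := by unfold U; infer_instance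

/-- kernels -/
def kr : Bool → ℝ → ℝ → ℝ≥0∞
  | false, x, t => if x < t then ENNReal.ofReal t⁻¹ else 0
  | true, x, t => if t < x then ENNReal.ofReal (1 - t)⁻¹ else 0

/-- integral operators -/
def Iop (b : Bool) (h : ℝ → ℝ≥0∞) (x : ℝ) : ℝ≥0∞ := ∫⁻ t, kr b x t * h t ∂U

/-- iterated integrals -/
def We : List Bool → ℝ → ℝ≥0∞
  | [] => 1
  | b :: w => Iop b (We w)

/-- moments -/
def Mo (n : ℕ) (h : ℝ → ℝ≥0∞) : ℝ≥0∞ := ∫⁻ x, ENNReal.ofReal (x ^ n) * h x ∂U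

lemma kr_meas (b : Bool) : Measurable (Function.uncurry (kr b)) := by
  cases b with
  | false =>
    exact Measurable.ite (measurableSet_lt measurable_fst measurable_snd) (by fun_prop) measurable_const
  | true =>
    exact Measurable.ite (measurableSet_lt measurable_snd measurable_fst) (by fun_prop) measurable_const

lemma kr_meas1 (b : Bool) (x : ℝ) : Measurable (kr b x) := (kr_meas b).comp measurable_prodMk_left
lemma krm_meas (b : Bool) (x : ℝ) {h : ℝ → ℝ≥0∞} (hh : Measurable h) : Measurable fun t => kr b x t * h t :=
  (kr_meas1 b x).mul hh
lemma kr_meas2 (b : Bool) (t : ℝ) : Measurable fun x => kr b x t := (kr_meas b).comp measurable_prodMk_right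

lemma Iop_meas (b : Bool) {h : ℝ → ℝ≥0∞} (hh : Measurable h) : Measurable (Iop b h) :=
  Measurable.lintegral_prod_right' (f := fun p : ℝ × ℝ => kr b p.1 p.2 * h p.2)
    ((kr_meas b).mul (hh.comp measurable_snd))

lemma We_meas (w : List Bool) : Measurable (We w) := by
  induction w with
  | nil => exact measurable_const
  | cons b w ih => exact Iop_meas b ih

lemma ae_U : ∀ᵐ x ∂U, x ∈ Set.Ioo (0 : ℝ) 1 := ae_restrict_mem measurableSet_Ioo

lemma U_congr {f g : ℝ → ℝ≥0∞} (h : ∀ x ∈ Set.Ioo (0 : ℝ) 1, f x = g x) : ∫⁻ x, f x ∂U = ∫⁻ x, g x ∂U :=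
  lintegral_congr_ae (ae_U.mono h)

lemma lint_pow (a b : ℝ) (ha : 0 ≤ a) (hab : a ≤ b) (n : ℕ) :
    ∫⁻ x in Set.Ioo a b, ENNReal.ofReal (x ^ n) = ENNReal.ofReal ((b ^ (n + 1) - a ^ (n + 1)) / (n + 1)) := by
  rw [← integral_pow, intervalIntegral.integral_of_le hab, integral_Ioc_eq_integral_Ioo,
    ofReal_integral_eq_lintegral_ofReal]
  · exact ((continuous_pow n).integrableOn_Icc).mono_set Set.Ioo_subset_Icc_self
  · filter_upwards [ae_restrict_mem measurableSet_Ioo] with x hx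
    exact pow_nonneg (ha.trans hx.1.le) n

lemma lint_k0 {t : ℝ} (ht : t ∈ Set.Ioo (0 : ℝ) 1) (n : ℕ) :
    ∫⁻ x, ENNReal.ofReal (x ^ n) * kr false x t ∂U = ENNReal.ofReal (t ^ n / (n + 1)) := by
  have e : ∀ x, ENNReal.ofReal (x ^ n) * kr false x t =
      (Set.Iio t).indicator (fun x => ENNReal.ofReal t⁻¹ * ENNReal.ofReal (x ^ n)) x := by
    intro x
    by_cases hx : x < t <;> simp [kr, hx, Set.indicator, mul_comm]
  simp only [e]
  rw [lintegral_indicator measurableSet_Iio, U, Measure.restrict_restrict measurableSet_Iio,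
    lintegral_const_mul _ (by fun_prop)]
  have : Set.Iio t ∩ Set.Ioo 0 1 = Set.Ioo 0 t := by
    ext x; simp only [Set.mem_inter_iff, Set.mem_Iio, Set.mem_Ioo]
    exact ⟨fun h => ⟨h.2.1, h.1⟩, fun h => ⟨h.2, h.1, h.2.trans ht.2⟩⟩
  rw [this, lint_pow 0 t le_rfl ht.1.le, ← ENNReal.ofReal_mul (inv_nonneg.2 ht.1.le)]
  congr 1
  have := ht.1.ne'
  rw [zero_pow (by omega), sub_zero, pow_succ]
  field_simp

lemma lint_k1 {t : ℝ} (ht : t ∈ Set.Ioo (0 : ℝ) 1) (n : ℕ) :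
    ∫⁻ x, ENNReal.ofReal (x ^ n) * kr true x t ∂U =
      ENNReal.ofReal ((∑ j ∈ range (n + 1), t ^ j) / (n + 1)) := by
  have e : ∀ x, ENNReal.ofReal (x ^ n) * kr true x t =
      (Set.Ioi t).indicator (fun x => ENNReal.ofReal (1 - t)⁻¹ * ENNReal.ofReal (x ^ n)) x := by
    intro x
    by_cases hx : t < x <;> simp [kr, hx, Set.indicator, mul_comm]
  simp only [e]
  have h1 : 0 < 1 - t := by linarith [ht.2]
  rw [lintegral_indicator measurableSet_Ioi, U, Measure.restrict_restrict measurableSet_Ioi,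
    lintegral_const_mul _ (by fun_prop)]
  have : Set.Ioi t ∩ Set.Ioo 0 1 = Set.Ioo t 1 := by
    ext x; simp only [Set.mem_inter_iff, Set.mem_Ioi, Set.mem_Ioo]
    exact ⟨fun h => ⟨h.1, h.2.2⟩, fun h => ⟨h.1, ht.1.trans h.1, h.2⟩⟩
  rw [this, lint_pow t 1 ht.1.le ht.2.le, ← ENNReal.ofReal_mul (inv_nonneg.2 h1.le)]
  congr 1
  have e2 := geom_sum_mul t (n + 1)
  rw [one_pow]
  have : 1 - t ^ (n + 1) = (∑ j ∈ range (n + 1), t ^ j) * (1 - t) := by linear_combination e2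
  rw [this]
  field_simp

lemma Mo_Iop (b : Bool) {h : ℝ → ℝ≥0∞} (hh : Measurable h) (n : ℕ) :
    Mo n (Iop b h) = ∫⁻ t, h t * (∫⁻ x, ENNReal.ofReal (x ^ n) * kr b x t ∂U) ∂U := by
  simp only [Mo, Iop]
  have e1 : ∀ x, ENNReal.ofReal (x ^ n) * ∫⁻ t, kr b x t * h t ∂U =
      ∫⁻ t, ENNReal.ofReal (x ^ n) * (kr b x t * h t) ∂U := fun x =>
    (lintegral_const_mul _ ((kr_meas1 b x).mul hh)).symm
  simp only [e1]
  rw [lintegral_lintegral_swap]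
  · refine lintegral_congr fun t => ?_
    rw [← lintegral_const_mul]
    · exact lintegral_congr fun x => by ring
    · exact (by fun_prop : Measurable fun x : ℝ => ENNReal.ofReal (x ^ n)).mul (kr_meas2 b t)
  · exact Measurable.aemeasurable ((by fun_prop : Measurable fun p : ℝ × ℝ => ENNReal.ofReal (p.1 ^ n)).mul
      ((kr_meas b).mul (hh.comp measurable_snd)))

lemma Mo_I0 {h : ℝ → ℝ≥0∞} (hh : Measurable h) (n : ℕ) :
    Mo n (Iop false h) = ENNReal.ofReal ((n : ℝ) + 1)⁻¹ * Mo n h := by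
  rw [Mo_Iop _ hh, Mo, ← lintegral_const_mul _ (by fun_prop)]
  refine U_congr fun t ht => ?_
  rw [lint_k0 ht, div_eq_mul_inv, ENNReal.ofReal_mul (pow_nonneg ht.1.le _)]
  ring

lemma Mo_I1 {h : ℝ → ℝ≥0∞} (hh : Measurable h) (n : ℕ) :
    Mo n (Iop true h) = ENNReal.ofReal ((n : ℝ) + 1)⁻¹ * ∑ j ∈ range (n + 1), Mo j h := by
  rw [Mo_Iop _ hh]
  simp only [Mo]
  rw [← lintegral_finsetSum _ (fun j _ => by fun_prop), ← lintegral_const_mul _ (by fun_prop)]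
  refine U_congr fun t ht => ?_
  rw [lint_k1 ht, div_eq_mul_inv, ENNReal.ofReal_mul (sum_nonneg fun j _ => pow_nonneg ht.1.le _),
    ENNReal.ofReal_sum_of_nonneg fun j _ => pow_nonneg ht.1.le _, ← sum_mul]
  ring

lemma Tw_nonneg (w : List Bool) (n : ℕ) : 0 ≤ Tw w n := by
  induction w generalizing n with
  | nil => simp [Tw]
  | cons b w ih => cases b with
    | false => exact div_nonneg (ih n) (Nat.cast_nonneg n)
    | true => rw [Tw, Sm_apply]; exact sum_nonneg fun j _ => div_nonneg (ih _) (by positivity)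

lemma Mo_We (w : List Bool) (n : ℕ) : Mo n (We w) = ENNReal.ofReal (Tw w (n + 1) / ((n : ℝ) + 1)) := by
  induction w generalizing n with
  | nil =>
    have := lint_pow 0 1 le_rfl zero_le_one n
    simp only [Mo, We, Pi.one_apply, mul_one, U, this, Tw]
    simp
  | cons b w ih =>
    have hp : (0 : ℝ) ≤ ((n : ℝ) + 1)⁻¹ := by positivity
    cases b with
    | false =>
      rw [We, Mo_I0 (We_meas w), ih, ← ENNReal.ofReal_mul hp, Tw, dv_apply]
      congr 1; push_cast; ring
    | true =>
      rw [We, Mo_I1 (We_meas w), Tw, Sm_apply]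
      simp only [ih]
      rw [← ENNReal.ofReal_sum_of_nonneg (fun j _ => div_nonneg (Tw_nonneg _ _) (by positivity)), ← ENNReal.ofReal_mul hp]
      congr 1; ring

lemma Mo_zero (h : ℝ → ℝ≥0∞) : Mo 0 h = ∫⁻ x, h x ∂U := by simp [Mo]

lemma kr_le (b : Bool) {x : ℝ} (hx : x ∈ Set.Ioo (0 : ℝ) 1) :
    ∃ C : ℝ≥0∞, C ≠ ∞ ∧ ∀ t, kr b x t ≤ C := by
  cases b with
  | false =>
    refine ⟨ENNReal.ofReal x⁻¹, ENNReal.ofReal_ne_top, fun t => ?_⟩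
    by_cases h : x < t
    · simp only [kr, h, if_true]
      exact ENNReal.ofReal_le_ofReal (inv_anti₀ hx.1 h.le)
    · simp [kr, h]
  | true =>
    refine ⟨ENNReal.ofReal (1 - x)⁻¹, ENNReal.ofReal_ne_top, fun t => ?_⟩
    by_cases h : t < x
    · simp only [kr, h, if_true]
      exact ENNReal.ofReal_le_ofReal (inv_anti₀ (by linarith [hx.2]) (by linarith))
    · simp [kr, h]

lemma Iop_ne_top (b : Bool) {h : ℝ → ℝ≥0∞} (hh : Measurable h) (hi : ∫⁻ x, h x ∂U ≠ ∞) {x : ℝ}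
    (hx : x ∈ Set.Ioo (0 : ℝ) 1) : Iop b h x ≠ ∞ := by
  obtain ⟨C, hC, hle⟩ := kr_le b hx
  refine ne_top_of_le_ne_top (ENNReal.mul_ne_top hC hi) ?_
  rw [← lintegral_const_mul _ hh]
  exact lintegral_mono fun t => mul_le_mul_left (hle t) _

lemma We_int (w : List Bool) : ∫⁻ x, We w x ∂U ≠ ∞ := by
  rw [← Mo_zero, Mo_We]; exact ENNReal.ofReal_ne_top

lemma We_ne_top (w : List Bool) {x : ℝ} (hx : x ∈ Set.Ioo (0 : ℝ) 1) : We w x ≠ ∞ := by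
  cases w with
  | nil => exact ENNReal.one_ne_top
  | cons b w => exact Iop_ne_top b (We_meas w) (We_int w) hx

lemma Iop_mul_Iop (b b' : Bool) {h k : ℝ → ℝ≥0∞} (hh : Measurable h) (hk : Measurable k) (x : ℝ) :
    Iop b h x * Iop b' k x = ∫⁻ s, ∫⁻ t, kr b x s * kr b' x t * (h s * k t) ∂U ∂U := by
  rw [Iop, Iop, ← lintegral_lintegral_mul (krm_meas b x hh).aemeasurable
    (krm_meas b' x hk).aemeasurable]
  exact lintegral_congr fun s => lintegral_congr fun t => by ring

lemma Iop_Iop (b b' : Bool) {h k : ℝ → ℝ≥0∞} (hk : Measurable k) (x : ℝ) :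
    Iop b (h * Iop b' k) x = ∫⁻ s, ∫⁻ t, kr b x s * kr b' s t * (h s * k t) ∂U ∂U := by
  simp only [Iop, Pi.mul_apply]
  refine lintegral_congr fun s => ?_
  rw [← mul_assoc, ← lintegral_const_mul _ (krm_meas b' s hk)]
  exact lintegral_congr fun t => by ring

lemma krP_meas (b b' : Bool) {h k : ℝ → ℝ≥0∞} (hh : Measurable h) (hk : Measurable k) (x : ℝ) :
    Measurable fun p : ℝ × ℝ => kr b x p.1 * kr b' p.1 p.2 * (h p.1 * k p.2) :=
  (((kr_meas1 b x).comp measurable_fst).mul (kr_meas b')).mul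
    ((hh.comp measurable_fst).mul (hk.comp measurable_snd))

lemma krP_meas' (b b' : Bool) {h k : ℝ → ℝ≥0∞} (hh : Measurable h) (hk : Measurable k) (x : ℝ) :
    Measurable fun p : ℝ × ℝ => kr b x p.2 * kr b' p.2 p.1 * (k p.2 * h p.1) :=
  (krP_meas b b' hk hh x).comp measurable_swap

lemma lint2_add {f g : ℝ × ℝ → ℝ≥0∞} (hf : Measurable f) (_ : Measurable g) :
    ∫⁻ s, ∫⁻ t, (f (s, t) + g (s, t)) ∂U ∂U = ∫⁻ s, ∫⁻ t, f (s, t) ∂U ∂U + ∫⁻ s, ∫⁻ t, g (s, t) ∂U ∂U := by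
  rw [← lintegral_add_left hf.lintegral_prod_right']
  exact lintegral_congr fun s => lintegral_add_left (hf.comp measurable_prodMk_left) _

/-- Leibniz rule for one operator -/
lemma Iop_prod (b : Bool) {h k : ℝ → ℝ≥0∞} (hh : Measurable h) (hk : Measurable k) (x : ℝ) :
    Iop b h x * Iop b k x = Iop b (h * Iop b k) x + Iop b (k * Iop b h) x := by
  rw [Iop_mul_Iop b b hh hk, Iop_Iop b b hk, Iop_Iop b b hh]
  rw [lintegral_lintegral_swap (f := fun s t => kr b x s * kr b s t * (k s * h t))
    (krP_meas b b hk hh x).aemeasurable,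
    ← lint2_add (krP_meas b b hh hk x) (krP_meas' b b hh hk x)]
  refine lintegral_congr fun s => lintegral_congr_ae ?_
  have hne : ∀ᵐ t ∂U, t ≠ s := (ae_restrict_of_ae (Measure.ae_ne volume s))
  filter_upwards [hne] with t ht
  have : kr b x s * kr b x t = kr b x s * kr b s t + kr b x t * kr b t s := by
    cases b <;> rcases lt_or_gt_of_ne ht with h | h <;>
    simp only [kr] <;> split_ifs <;> first | (exfalso; linarith) | (simp; done) | ring | simp [mul_comm]
  rw [this]; ring

/-- the constant in the mixed product -/
def mixc (h k : ℝ → ℝ≥0∞) : ℝ≥0∞ := ∫⁻ t, ENNReal.ofReal (1 - t)⁻¹ * (k * Iop false h) t ∂U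

lemma Iop_mix {h k : ℝ → ℝ≥0∞} (hh : Measurable h) (hk : Measurable k) (x : ℝ) :
    Iop false h x * Iop true k x + mixc h k = Iop false (h * Iop true k) x + Iop true (k * Iop false h) x := by
  have e0 : mixc h k = ∫⁻ s, ∫⁻ t, ENNReal.ofReal (1 - t)⁻¹ * kr false t s * (k t * h s) ∂U ∂U := by
    rw [lintegral_lintegral_swap]
    · simp only [mixc, Iop, Pi.mul_apply]
      refine lintegral_congr fun s => ?_
      rw [← mul_assoc, ← lintegral_const_mul _ (krm_meas _ s hh)]
      exact lintegral_congr fun t => by ring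
    · exact Measurable.aemeasurable (((by fun_prop : Measurable fun p : ℝ × ℝ => ENNReal.ofReal (1 - p.2)⁻¹).mul
        ((kr_meas false).comp measurable_swap)).mul ((hk.comp measurable_snd).mul (hh.comp measurable_fst)))
  rw [Iop_mul_Iop _ _ hh hk, Iop_Iop _ _ hk, Iop_Iop _ _ hh, e0]
  rw [lintegral_lintegral_swap (f := fun s t => kr true x s * kr false s t * (k s * h t))
    (krP_meas _ _ hk hh x).aemeasurable,
    ← lint2_add (krP_meas _ _ hh hk x) (krP_meas' _ _ hh hk x),
    ← lint2_add (f := fun p => kr false x p.1 * kr true x p.2 * (h p.1 * k p.2))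
      (g := fun p => ENNReal.ofReal (1 - p.2)⁻¹ * kr false p.2 p.1 * (k p.2 * h p.1))]
  · refine lintegral_congr fun s => lintegral_congr fun t => ?_
    have : kr false x s * kr true x t + ENNReal.ofReal (1 - t)⁻¹ * kr false t s =
        kr false x s * kr true s t + kr true x t * kr false t s := by
      simp only [kr]; split_ifs <;> first | (exfalso; linarith) | (simp; done) | ring | simp [mul_comm]
    simp only
    rw [mul_comm (k t) (h s), ← add_mul, ← add_mul, this]
  · exact (((kr_meas1 _ x).comp measurable_fst).mul ((kr_meas1 _ x).comp measurable_snd)).mul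
      ((hh.comp measurable_fst).mul (hk.comp measurable_snd))
  · exact (((by fun_prop : Measurable fun p : ℝ × ℝ => ENNReal.ofReal (1 - p.2)⁻¹).mul
        ((kr_meas false).comp measurable_swap)).mul ((hk.comp measurable_snd).mul (hh.comp measurable_fst)))

end FW

namespace FW
open Filter Topology ENNReal

/-- real-valued iterated integrals -/
def wr (w : List Bool) (x : ℝ) : ℝ := (We w x).toReal

/-- functions on `(0,1)` that are `Z`-combinations of iterated integrals with prefix `p` -/
def HZ (p : List Bool) : Submodule Z (ℝ → ℝ) :=
  Submodule.span Z {f | ∃ w, Set.EqOn f (wr (p ++ w)) (Set.Ioo 0 1)}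

lemma HZ_zero_on {p : List Bool} {f : ℝ → ℝ} (h : ∀ x ∈ Set.Ioo (0 : ℝ) 1, f x = 0) : f ∈ HZ p := by
  have h1 : f + wr (p ++ []) ∈ HZ p := Submodule.subset_span ⟨[], fun x hx => by simp [h x hx]⟩
  have h2 : wr (p ++ []) ∈ HZ p := Submodule.subset_span ⟨[], fun x _ => rfl⟩
  simpa using sub_mem h1 h2

lemma HZ_congr {p : List Bool} {f g : ℝ → ℝ} (hg : g ∈ HZ p) (h : ∀ x ∈ Set.Ioo (0 : ℝ) 1, f x = g x) :
    f ∈ HZ p := by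
  have : f = (f - g) + g := by simp
  rw [this]
  exact add_mem (HZ_zero_on fun x hx => by simp [h x hx]) hg

lemma HZ_le (p q : List Bool) : HZ (p ++ q) ≤ HZ p := by
  refine Submodule.span_le.2 ?_
  rintro f ⟨w, hf⟩
  exact Submodule.subset_span ⟨q ++ w, by simpa using hf⟩

lemma Z_smul (c : Z) (f : ℝ → ℝ) (x : ℝ) : (c • f) x = (c : ℝ) * f x := rfl

lemma HZ_mom_aux {f : ℝ → ℝ} {w : List Bool} (hf : Set.EqOn f (wr w) (Set.Ioo 0 1)) (n : ℕ) :
    Integrable (fun x => x ^ n * f x) U ∧ ∫ x, x ^ n * f x ∂U = Tw w (n + 1) / ((n : ℝ) + 1) := by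
  have hm : Measurable fun x => ENNReal.ofReal (x ^ n) * We w x := by
    have := We_meas w
    fun_prop
  have h1 : ∫⁻ x, ENNReal.ofReal (x ^ n) * We w x ∂U ≠ ∞ := by
    rw [← Mo, Mo_We]; exact ENNReal.ofReal_ne_top
  have h2 : (fun x => x ^ n * f x) =ᵐ[U] fun x => (ENNReal.ofReal (x ^ n) * We w x).toReal := by
    filter_upwards [ae_U] with x hx
    rw [ENNReal.toReal_mul, ENNReal.toReal_ofReal (pow_nonneg hx.1.le _), hf hx, wr]
  refine ⟨(integrable_toReal_of_lintegral_ne_top hm.aemeasurable h1).congr h2.symm, ?_⟩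
  rw [integral_congr_ae h2, integral_toReal hm.aemeasurable (ae_lt_top hm h1), ← Mo, Mo_We,
    ENNReal.toReal_ofReal (div_nonneg (Tw_nonneg _ _) (by positivity))]

lemma HZ_mom {p : List Bool} {k : ℕ} (hp : p = List.replicate k false) {f : ℝ → ℝ} (hf : f ∈ HZ p) :
    ∃ T ∈ TS Z, ∀ n : ℕ, Integrable (fun x => x ^ n * f x) U ∧
      ∫ x, x ^ n * f x ∂U = T (n + 1) / ((n : ℝ) + 1) ^ (k + 1) := by
  induction hf using Submodule.span_induction with
  | mem f hf =>
    obtain ⟨w, hf⟩ := hf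
    refine ⟨Tw w, Tw_mem w, fun n => ⟨(HZ_mom_aux hf n).1, ?_⟩⟩
    rw [(HZ_mom_aux hf n).2, hp]
    clear hf hp
    have : ∀ k, Tw (List.replicate k false ++ w) (n + 1) = Tw w (n + 1) / ((n : ℝ) + 1) ^ k := by
      intro k
      induction k with
      | zero => simp
      | succ k ih => rw [List.replicate_succ, List.cons_append, Tw, dv_apply, ih, pow_succ]; push_cast; rw [div_div]
    rw [this, div_div, pow_succ]
  | zero => exact ⟨0, zero_mem _, fun n => by simp⟩
  | add f g _ _ hf hg =>
    obtain ⟨T, hT, h⟩ := hf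
    obtain ⟨S, hS, h'⟩ := hg
    refine ⟨T + S, add_mem hT hS, fun n => ?_⟩
    simp only [Pi.add_apply, mul_add]
    refine ⟨(h n).1.add (h' n).1, ?_⟩
    rw [integral_add (h n).1 (h' n).1, (h n).2, (h' n).2, add_div]
  | smul c f _ hf =>
    obtain ⟨T, hT, h⟩ := hf
    refine ⟨c • T, Submodule.smul_mem _ _ hT, fun n => ?_⟩
    simp only [Z_smul, mul_left_comm _ (c : ℝ)]
    refine ⟨(h n).1.const_mul _, ?_⟩
    rw [integral_const_mul, (h n).2, ← mul_div_assoc]; rfl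

lemma HZ_int {p : List Bool} {f : ℝ → ℝ} (hf : f ∈ HZ p) : Integrable f U := by
  obtain ⟨T, -, h⟩ := HZ_mom (k := 0) rfl (HZ_le [] p hf)
  simpa using (h 0).1

lemma HZ_of_TS (k : ℕ) {T : ℕ → ℝ} (hT : T ∈ TS Z) : ∃ f ∈ HZ (List.replicate k false),
    ∀ n : ℕ, Integrable (fun x => x ^ n * f x) U ∧ ∫ x, x ^ n * f x ∂U = T (n + 1) / ((n : ℝ) + 1) ^ (k + 1) := by
  induction hT using Submodule.span_induction with
  | mem T hT =>
    obtain ⟨w, rfl⟩ := hT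
    refine ⟨_, Submodule.subset_span ⟨w, fun x _ => rfl⟩, fun n => ⟨(HZ_mom_aux (fun x _ => rfl) n).1, ?_⟩⟩
    rw [(HZ_mom_aux (fun x _ => rfl) n).2]
    have : ∀ k, Tw (List.replicate k false ++ w) (n + 1) = Tw w (n + 1) / ((n : ℝ) + 1) ^ k := by
      intro k
      induction k with
      | zero => simp
      | succ k ih => rw [List.replicate_succ, List.cons_append, Tw, dv_apply, ih, pow_succ]; push_cast; rw [div_div]
    rw [this, div_div, pow_succ]
  | zero => exact ⟨0, zero_mem _, fun n => by simp⟩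
  | add T S _ _ hT hS =>
    obtain ⟨f, hf, h⟩ := hT
    obtain ⟨g, hg, h'⟩ := hS
    refine ⟨f + g, add_mem hf hg, fun n => ?_⟩
    simp only [Pi.add_apply, mul_add]
    refine ⟨(h n).1.add (h' n).1, ?_⟩
    rw [integral_add (h n).1 (h' n).1, (h n).2, (h' n).2, add_div]
  | smul c T _ hT =>
    obtain ⟨f, hf, h⟩ := hT
    refine ⟨c • f, Submodule.smul_mem _ _ hf, fun n => ?_⟩
    simp only [Z_smul, mul_left_comm _ (c : ℝ)]
    refine ⟨(h n).1.const_mul _, ?_⟩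
    rw [integral_const_mul, (h n).2, ← mul_div_assoc]; rfl

lemma HZ_J (b : Bool) {p : List Bool} {f : ℝ → ℝ} (hf : f ∈ HZ p) :
    (fun x => ∫ t, (kr b x t).toReal * f t ∂U) ∈ HZ (b :: p) ∧
    ∀ x ∈ Set.Ioo (0 : ℝ) 1, Integrable (fun t => (kr b x t).toReal * f t) U := by
  induction hf using Submodule.span_induction with
  | mem f hf =>
    obtain ⟨w, hf⟩ := hf
    have h2 : ∀ x, (fun t => (kr b x t).toReal * f t) =ᵐ[U] fun t => (kr b x t * We (p ++ w) t).toReal := by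
      intro x
      filter_upwards [ae_U] with t ht
      rw [ENNReal.toReal_mul, hf ht, wr]
    have hm := fun x => krm_meas b x (We_meas (p ++ w))
    have h3 : ∀ x ∈ Set.Ioo (0 : ℝ) 1, ∫⁻ t, kr b x t * We (p ++ w) t ∂U ≠ ∞ := fun x hx =>
      Iop_ne_top b (We_meas _) (We_int _) hx
    refine ⟨Submodule.subset_span ⟨w, fun x hx => ?_⟩, fun x hx =>
      (integrable_toReal_of_lintegral_ne_top (hm x).aemeasurable (h3 x hx)).congr (h2 x).symm⟩
    simp only
    rw [integral_congr_ae (h2 x), integral_toReal (hm x).aemeasurable (ae_lt_top (hm x) (h3 x hx))]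
    rfl
  | zero => exact ⟨HZ_zero_on fun x _ => by simp, fun x _ => by simp⟩
  | add f g _ _ hf hg =>
    refine ⟨HZ_congr (add_mem hf.1 hg.1) fun x hx => ?_, fun x hx => ?_⟩
    · simp only [Pi.add_apply, mul_add]
      exact integral_add (hf.2 x hx) (hg.2 x hx)
    · simp only [Pi.add_apply, mul_add]
      exact (hf.2 x hx).add (hg.2 x hx)
  | smul c f _ hf =>
    refine ⟨HZ_congr (Submodule.smul_mem _ c hf.1) fun x hx => ?_, fun x hx => ?_⟩
    · simp only [Z_smul, mul_left_comm _ (c : ℝ), integral_const_mul]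
    · simp only [Z_smul, mul_left_comm _ (c : ℝ)]
      exact (hf.2 x hx).const_mul _

/-- extended-real versions -/
def HE (p : List Bool) (h : ℝ → ℝ≥0∞) : Prop :=
  Measurable h ∧ (∀ x ∈ Set.Ioo (0 : ℝ) 1, h x ≠ ∞) ∧ (fun x => (h x).toReal) ∈ HZ p

lemma HE_We (p w : List Bool) : HE p (We (p ++ w)) :=
  ⟨We_meas _, fun _ hx => We_ne_top _ hx, Submodule.subset_span ⟨w, fun _ _ => rfl⟩⟩

lemma HE.Mo_eq {p : List Bool} {h : ℝ → ℝ≥0∞} (hh : HE p h) (n : ℕ) :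
    Mo n h = ENNReal.ofReal (∫ x, x ^ n * (h x).toReal ∂U) ∧ 0 ≤ ∫ x, x ^ n * (h x).toReal ∂U := by
  obtain ⟨T, -, hT⟩ := HZ_mom (k := 0) rfl (HZ_le [] p hh.2.2)
  have h0 : 0 ≤ᵐ[U] fun x => x ^ n * (h x).toReal := by
    filter_upwards [ae_U] with x hx
    exact mul_nonneg (pow_nonneg hx.1.le _) ENNReal.toReal_nonneg
  rw [ofReal_integral_eq_lintegral_ofReal (hT n).1 h0]
  refine ⟨U_congr fun x hx => ?_, integral_nonneg_of_ae h0⟩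
  rw [ENNReal.ofReal_mul (pow_nonneg hx.1.le _), ENNReal.ofReal_toReal (hh.2.1 x hx)]

lemma HE.int {p : List Bool} {h : ℝ → ℝ≥0∞} (hh : HE p h) : ∫⁻ x, h x ∂U ≠ ∞ := by
  rw [← Mo_zero, (hh.Mo_eq 0).1]; exact ENNReal.ofReal_ne_top

lemma HE.Iop (b : Bool) {p : List Bool} {h : ℝ → ℝ≥0∞} (hh : HE p h) : HE (b :: p) (Iop b h) := by
  refine ⟨Iop_meas b hh.1, fun x hx => Iop_ne_top b hh.1 hh.int hx, HZ_congr (HZ_J b hh.2.2).1 fun x hx => ?_⟩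
  have hm := krm_meas b x hh.1
  rw [FW.Iop, ← integral_toReal hm.aemeasurable (ae_lt_top hm (Iop_ne_top b hh.1 hh.int hx))]
  simp

lemma HE.add {p : List Bool} {h k : ℝ → ℝ≥0∞} (hh : HE p h) (hk : HE p k) : HE p (h + k) :=
  ⟨hh.1.add hk.1, fun x hx => ENNReal.add_ne_top.2 ⟨hh.2.1 x hx, hk.2.1 x hx⟩,
    HZ_congr (add_mem hh.2.2 hk.2.2) fun x hx => ENNReal.toReal_add (hh.2.1 x hx) (hk.2.1 x hx)⟩

lemma HE.mono {p : List Bool} {h : ℝ → ℝ≥0∞} (hh : HE p h) : HE [] h := ⟨hh.1, hh.2.1, HZ_le [] p hh.2.2⟩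

lemma geom_ofReal {t : ℝ} (ht : t ∈ Set.Ioo (0 : ℝ) 1) :
    ENNReal.ofReal (1 - t)⁻¹ = ∑' n : ℕ, ENNReal.ofReal (t ^ n) := by
  rw [← tsum_geometric_of_lt_one ht.1.le ht.2,
    ENNReal.ofReal_tsum_of_nonneg (fun n => pow_nonneg ht.1.le n) (summable_geometric_of_lt_one ht.1.le ht.2)]

lemma mixc_mem {h k : ℝ → ℝ≥0∞} (hh : HE [] (k * Iop false h)) (hc : mixc h k ≠ ∞) : (mixc h k).toReal ∈ Z := by
  obtain ⟨T, hT, hm⟩ := HZ_mom (k := 0) rfl hh.2.2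
  have e : mixc h k = ∑' n, Mo n (k * Iop false h) := by
    simp only [mixc, Mo]
    rw [← lintegral_tsum]
    · refine U_congr fun t ht => ?_
      rw [geom_ofReal ht, ENNReal.tsum_mul_right]
    · intro n
      have := hh.1
      exact ((by fun_prop : Measurable fun x : ℝ => ENNReal.ofReal (x ^ n)).mul this).aemeasurable
  have h1 : ∀ n, Mo n (k * Iop false h) = ENNReal.ofReal (T (n + 1) / ((n : ℝ) + 1)) ∧ 0 ≤ T (n + 1) / ((n : ℝ) + 1) := by
    intro n
    have h2 := hh.Mo_eq n
    rw [(hm n).2, zero_add, pow_one] at h2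
    exact h2
  have h3 : Tendsto (fun N => ∑ n ∈ range N, Mo n (k * Iop false h)) atTop (𝓝 (mixc h k)) := by
    rw [e]; exact ENNReal.summable.hasSum.tendsto_sum_nat
  refine reg hT ?_
  have h4 := (ENNReal.tendsto_toReal hc).comp h3
  convert h4 using 1
  ext N
  rw [Function.comp, Sm_apply, ENNReal.toReal_sum fun n _ => by rw [(h1 n).1]; exact ENNReal.ofReal_ne_top]
  exact sum_congr rfl fun n _ => by rw [(h1 n).1, ENNReal.toReal_ofReal (h1 n).2]

lemma HZ_const {c : ℝ} (hc : c ∈ Z) : (fun _ => c) ∈ HZ [] :=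
  HZ_congr (Submodule.smul_mem (HZ []) ⟨c, hc⟩ (Submodule.subset_span ⟨[], fun _ _ => rfl⟩)) fun x _ => by
    rw [Z_smul]; simp [wr, We]

lemma HE_mix {h k : ℝ → ℝ≥0∞} (hh : Measurable h) (hk : Measurable k) (h0 : HE [] (k * Iop false h))
    (h1 : HE [] (h * Iop true k)) : HE [] (Iop false h * Iop true k) := by
  have hq := ((h1.Iop false).mono).add ((h0.Iop true).mono)
  have e := fun x => Iop_mix hh hk x
  have hfin : ∀ x ∈ Set.Ioo (0 : ℝ) 1, Iop false h x * Iop true k x + mixc h k ≠ ∞ := fun x hx => by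
    rw [e]; exact hq.2.1 x hx
  have hc : mixc h k ≠ ∞ := (ENNReal.add_ne_top.1 (hfin (1 / 2) (by norm_num))).2
  have hp := fun x hx => (ENNReal.add_ne_top.1 (hfin x hx)).1
  refine ⟨(Iop_meas _ hh).mul (Iop_meas _ hk), hp, HZ_congr (sub_mem hq.2.2 (HZ_const (mixc_mem h0 hc))) fun x hx => ?_⟩
  simp only [Pi.sub_apply, Pi.add_apply, Pi.mul_apply]
  rw [← e, ENNReal.toReal_add (hp x hx) hc]; ring

lemma We_mul (n : ℕ) : ∀ w w' : List Bool, w.length + w'.length = n → HE [] (We w * We w') := by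
  induction n using Nat.strong_induction_on with
  | _ n ih =>
  intro w w' hn
  rcases w with _ | ⟨b, w⟩
  · have := HE_We [] w'
    simpa [We] using this
  rcases w' with _ | ⟨b', w'⟩
  · have := HE_We [] (b :: w)
    simpa [We] using this
  simp only [List.length_cons] at hn
  have h1 : HE [] (We w * Iop b' (We w')) := ih (n - 1) (by omega) w (b' :: w') (by simp; omega)
  have h2 : HE [] (We w' * Iop b (We w)) := ih (n - 1) (by omega) w' (b :: w) (by simp; omega)
  by_cases hb : b = b'
  · subst hb
    have e : We (b :: w) * We (b :: w') = Iop b (We w * Iop b (We w')) + Iop b (We w' * Iop b (We w)) := by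
      ext x; exact Iop_prod b (We_meas w) (We_meas w') x
    rw [e]
    exact ((h1.Iop b).mono).add ((h2.Iop b).mono)
  · cases b <;> cases b' <;> simp at hb
    · exact HE_mix (We_meas w) (We_meas w') h2 h1
    · rw [mul_comm]
      exact HE_mix (We_meas w') (We_meas w) h1 h2

lemma We_mul_k (k : ℕ) (w w' : List Bool) :
    HE (List.replicate k false) (We (List.replicate k false ++ w) * We (List.replicate k false ++ w')) := by
  induction k generalizing w w' with
  | zero => exact We_mul _ _ _ rfl
  | succ k ih =>
    simp only [List.replicate_succ, List.cons_append]
    set h := We (List.replicate k false ++ w) with hh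
    set g := We (List.replicate k false ++ w') with hg
    have e : We (false :: (List.replicate k false ++ w)) * We (false :: (List.replicate k false ++ w')) =
        Iop false (h * Iop false g) + Iop false (g * Iop false h) := by
      ext x; exact Iop_prod false (We_meas _) (We_meas _) x
    have key : ∀ v, Iop false (We (List.replicate k false ++ v)) = We (List.replicate k false ++ (false :: v)) := by
      intro v
      have : List.replicate k false ++ (false :: v) = false :: (List.replicate k false ++ v) := by
        rw [← List.cons_append, ← List.replicate_succ, List.replicate_succ', List.append_assoc]; rfl
      rw [this]; rfl
    rw [e, hh, hg, key, key]
    exact ((ih _ _).Iop false).add ((ih _ _).Iop false)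

lemma HZ_mul_k (k : ℕ) {f g : ℝ → ℝ} (hf : f ∈ HZ (List.replicate k false)) (hg : g ∈ HZ (List.replicate k false)) :
    f * g ∈ HZ (List.replicate k false) := by
  induction hf using Submodule.span_induction with
  | mem f hf =>
    obtain ⟨w, hf⟩ := hf
    induction hg using Submodule.span_induction with
    | mem g hg =>
      obtain ⟨w', hg⟩ := hg
      refine HZ_congr (We_mul_k k w w').2.2 fun x hx => ?_
      rw [Pi.mul_apply, hf hx, hg hx, Pi.mul_apply, ENNReal.toReal_mul]; rfl
    | zero => rw [mul_zero]; exact zero_mem _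
    | add a b _ _ ha hb => rw [mul_add]; exact add_mem ha hb
    | smul c a _ ha => rw [mul_smul_comm]; exact Submodule.smul_mem _ _ ha
  | zero => rw [zero_mul]; exact zero_mem _
  | add a b _ _ ha hb => rw [add_mul]; exact add_mem ha hb
  | smul c a _ ha => rw [smul_mul_assoc]; exact Submodule.smul_mem _ _ ha

lemma HZ_mul {f g : ℝ → ℝ} (hf : f ∈ HZ []) (hg : g ∈ HZ []) : f * g ∈ HZ [] := HZ_mul_k 0 hf hg

lemma HZ_pow {f : ℝ → ℝ} (hf : f ∈ HZ []) (n : ℕ) : f ^ n ∈ HZ [] := by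
  induction n with
  | zero => rw [pow_zero]; exact HZ_const (one_mem Z)
  | succ n ih => rw [pow_succ]; exact HZ_mul ih hf

lemma We_log0 {x : ℝ} (hx : x ∈ Set.Ioo (0 : ℝ) 1) : We [false] x = ENNReal.ofReal (-Real.log x) := by
  have e : ∀ t, kr false x t * We [] t = (Set.Ioi x).indicator (fun t => ENNReal.ofReal t⁻¹) t := by
    intro t
    by_cases h : x < t <;> simp [kr, h, We, Set.indicator]
  rw [We, Iop]
  simp only [e]
  rw [lintegral_indicator measurableSet_Ioi, U, Measure.restrict_restrict measurableSet_Ioi]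
  have : Set.Ioi x ∩ Set.Ioo 0 1 = Set.Ioo x 1 := by
    ext y; simp only [Set.mem_inter_iff, Set.mem_Ioi, Set.mem_Ioo]
    exact ⟨fun h => ⟨h.1, h.2.2⟩, fun h => ⟨h.1, hx.1.trans h.1, h.2⟩⟩
  have e2 : ∫ t in x..1, t⁻¹ = -Real.log x := by
    rw [integral_inv_of_pos hx.1 one_pos, one_div, Real.log_inv]
  rw [this, ← e2, intervalIntegral.integral_of_le hx.2.le, integral_Ioc_eq_integral_Ioo,
    ofReal_integral_eq_lintegral_ofReal]
  · refine (ContinuousOn.integrableOn_Icc ?_).mono_set Set.Ioo_subset_Icc_self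
    exact continuousOn_inv₀.mono fun t ht => (hx.1.trans_le ht.1).ne'
  · filter_upwards [ae_restrict_mem measurableSet_Ioo] with t ht
    exact inv_nonneg.2 (hx.1.trans ht.1).le

lemma We_log1 {x : ℝ} (hx : x ∈ Set.Ioo (0 : ℝ) 1) : We [true] x = ENNReal.ofReal (-Real.log (1 - x)) := by
  have e : ∀ t, kr true x t * We [] t = (Set.Iio x).indicator (fun t => ENNReal.ofReal (1 - t)⁻¹) t := by
    intro t
    by_cases h : t < x <;> simp [kr, h, We, Set.indicator]
  rw [We, Iop]
  simp only [e]
  rw [lintegral_indicator measurableSet_Iio, U, Measure.restrict_restrict measurableSet_Iio]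
  have : Set.Iio x ∩ Set.Ioo 0 1 = Set.Ioo 0 x := by
    ext y; simp only [Set.mem_inter_iff, Set.mem_Iio, Set.mem_Ioo]
    exact ⟨fun h => ⟨h.2.1, h.1⟩, fun h => ⟨h.2, h.1, h.2.trans hx.2⟩⟩
  have e2 : ∫ t in (0 : ℝ)..x, (1 - t)⁻¹ = -Real.log (1 - x) := by
    rw [intervalIntegral.integral_comp_sub_left (fun t => t⁻¹), sub_zero,
      integral_inv_of_pos (by linarith [hx.2]) one_pos, one_div, Real.log_inv]
  rw [this, ← e2, intervalIntegral.integral_of_le hx.1.le, integral_Ioc_eq_integral_Ioo,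
    ofReal_integral_eq_lintegral_ofReal]
  · refine (ContinuousOn.integrableOn_Icc ?_).mono_set Set.Ioo_subset_Icc_self
    refine ContinuousOn.inv₀ (by fun_prop) fun t ht => ?_
    have := ht.2.trans_lt hx.2
    linarith
  · filter_upwards [ae_restrict_mem measurableSet_Ioo] with t ht
    exact inv_nonneg.2 (by linarith [ht.2.trans hx.2])

lemma HZ_log0 : (fun x => -Real.log x) ∈ HZ [] :=
  Submodule.subset_span ⟨[false], fun x hx => by
    rw [List.nil_append, wr, We_log0 hx, ENNReal.toReal_ofReal]
    exact neg_nonneg.2 (Real.log_nonpos hx.1.le hx.2.le)⟩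

lemma HZ_log1 : (fun x => -Real.log (1 - x)) ∈ HZ [] :=
  Submodule.subset_span ⟨[true], fun x hx => by
    rw [List.nil_append, wr, We_log1 hx, ENNReal.toReal_ofReal]
    exact neg_nonneg.2 (Real.log_nonpos (by linarith [hx.2]) (by linarith [hx.1]))⟩

/-- moments determine integrable functions -/
lemma mom_unique {f : ℝ → ℝ} (hf : Integrable f U) (h : ∀ n : ℕ, ∫ x, x ^ n * f x ∂U = 0) : f =ᵐ[U] 0 := by
  have hpi : ∀ g : ℝ → ℝ, Continuous g → Integrable (fun x => g x * f x) U := by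
    intro g hg
    obtain ⟨C, hC⟩ := (isCompact_Icc (a := (0 : ℝ)) (b := 1)).exists_bound_of_continuousOn hg.continuousOn
    refine hf.bdd_mul (c := C) hg.aestronglyMeasurable ?_
    filter_upwards [ae_U] with x hx
    exact hC x ⟨hx.1.le, hx.2.le⟩
  have hp : ∀ p : Polynomial ℝ, ∫ x, p.eval x * f x ∂U = 0 := by
    intro p
    induction p using Polynomial.induction_on' with
    | add p q hp hq =>
      simp only [Polynomial.eval_add, add_mul]
      rw [integral_add (hpi _ p.continuous) (hpi _ q.continuous), hp, hq, add_zero]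
    | monomial n a =>
      simp only [Polynomial.eval_monomial, mul_assoc]
      rw [integral_const_mul, h, mul_zero]
  refine ae_eq_zero_of_integral_contDiff_smul_eq_zero hf.locallyIntegrable fun g hg _ => ?_
  have hgc := hg.continuous
  have hle : ∀ ε > 0, ‖∫ x, g x • f x ∂U‖ ≤ ε * ∫ x, ‖f x‖ ∂U := by
    intro ε hε
    obtain ⟨p, hpε⟩ := exists_polynomial_near_of_continuousOn 0 1 g hgc.continuousOn ε hε
    have e : ∫ x, g x • f x ∂U = ∫ x, (g x - p.eval x) * f x ∂U := by
      simp only [smul_eq_mul, sub_mul]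
      rw [integral_sub (hpi _ hgc) (hpi _ p.continuous), hp, sub_zero]
    rw [e, ← integral_const_mul]
    refine norm_integral_le_of_norm_le (hf.norm.const_mul ε) ?_
    filter_upwards [ae_U] with x hx
    rw [norm_mul]
    refine mul_le_mul_of_nonneg_right ?_ (norm_nonneg _)
    have := hpε x ⟨hx.1.le, hx.2.le⟩
    rw [Real.norm_eq_abs, abs_sub_comm]; exact this.le
  have hA : (0 : ℝ) ≤ ∫ x, ‖f x‖ ∂U := integral_nonneg fun _ => norm_nonneg _
  have : ‖∫ x, g x • f x ∂U‖ ≤ 0 := by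
    refine le_of_forall_pos_le_add fun δ hδ => ?_
    have := hle (δ / (1 + ∫ x, ‖f x‖ ∂U)) (by positivity)
    refine this.trans ?_
    rw [zero_add, div_mul_eq_mul_div, div_le_iff₀ (by positivity)]
    nlinarith
  exact norm_le_zero_iff.1 this

end FW

namespace FW
open Filter Topology ENNReal

/-- multiplicative convolution -/
def conv (p g : ℝ → ℝ≥0∞) (q : ℝ) : ℝ≥0∞ := ∫⁻ t, kr false q t * (p t * g (q / t)) ∂U

lemma conv_measP {p g : ℝ → ℝ≥0∞} (hp : Measurable p) (hg : Measurable g) :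
    Measurable fun z : ℝ × ℝ => kr false z.1 z.2 * (p z.2 * g (z.1 / z.2)) :=
  (kr_meas false).mul ((hp.comp measurable_snd).mul (hg.comp (measurable_fst.div measurable_snd)))

lemma conv_meas {p g : ℝ → ℝ≥0∞} (hp : Measurable p) (hg : Measurable g) : Measurable (conv p g) :=
  (conv_measP hp hg).lintegral_prod_right'

lemma lint_scale {t : ℝ} (ht : 0 < t) (F : ℝ → ℝ≥0∞) :
    ∫⁻ q in Set.Ioo 0 t, F q = ∫⁻ s, ENNReal.ofReal t * F (t * s) ∂U := by
  have := lintegral_image_eq_lintegral_abs_deriv_mul (s := Set.Ioo (0 : ℝ) 1) (f := fun s => t * s) (f' := fun _ => t)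
    measurableSet_Ioo (fun x _ => by simpa using ((hasDerivAt_id x).const_mul t).hasDerivWithinAt)
    (fun a _ b _ h => mul_left_cancel₀ ht.ne' h) F
  rw [Set.image_mul_left_Ioo ht, mul_zero, mul_one] at this
  rw [this, abs_of_pos ht]; rfl

lemma lint_kr0 {t : ℝ} (ht : t ∈ Set.Ioo (0 : ℝ) 1) {F : ℝ → ℝ≥0∞} (hF : Measurable F) :
    ∫⁻ q, kr false q t * F q ∂U = ∫⁻ s, F (t * s) ∂U := by
  have e : ∀ x, kr false x t * F x = (Set.Iio t).indicator (fun x => ENNReal.ofReal t⁻¹ * F x) x := by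
    intro x
    by_cases hx : x < t <;> simp [kr, hx, Set.indicator]
  simp only [e]
  rw [lintegral_indicator measurableSet_Iio]
  nth_rewrite 1 [U]
  rw [Measure.restrict_restrict measurableSet_Iio, lintegral_const_mul _ hF]
  have : Set.Iio t ∩ Set.Ioo 0 1 = Set.Ioo 0 t := by
    ext x; simp only [Set.mem_inter_iff, Set.mem_Iio, Set.mem_Ioo]
    exact ⟨fun h => ⟨h.2.1, h.1⟩, fun h => ⟨h.2, h.1, h.2.trans ht.2⟩⟩
  rw [this, lint_scale ht.1, lintegral_const_mul _ (by fun_prop), ← mul_assoc, ← ENNReal.ofReal_mul (inv_nonneg.2 ht.1.le),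
    inv_mul_cancel₀ ht.1.ne', ENNReal.ofReal_one, one_mul]

lemma Mo_conv {p g : ℝ → ℝ≥0∞} (hp : Measurable p) (hg : Measurable g) (n : ℕ) :
    Mo n (conv p g) = Mo n p * Mo n g := by
  simp only [Mo, conv]
  have e1 : ∀ x, ENNReal.ofReal (x ^ n) * ∫⁻ t, kr false x t * (p t * g (x / t)) ∂U =
      ∫⁻ t, ENNReal.ofReal (x ^ n) * (kr false x t * (p t * g (x / t))) ∂U := fun x =>
    (lintegral_const_mul _ ((conv_measP hp hg).comp measurable_prodMk_left)).symm
  simp only [e1]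
  rw [lintegral_lintegral_swap, ← lintegral_mul_const _ (by fun_prop)]
  · refine U_congr fun t ht => ?_
    have e2 : ∀ x, ENNReal.ofReal (x ^ n) * (kr false x t * (p t * g (x / t))) =
        kr false x t * (ENNReal.ofReal (x ^ n) * (p t * g (x / t))) := fun x => by ring
    simp only [e2]
    rw [lint_kr0 ht (by fun_prop), ← lintegral_const_mul _ (by fun_prop)]
    refine U_congr fun s _ => ?_
    rw [mul_pow, ENNReal.ofReal_mul (pow_nonneg ht.1.le n), mul_div_cancel_left₀ _ ht.1.ne']
    ring
  · exact Measurable.aemeasurable ((by fun_prop : Measurable fun z : ℝ × ℝ => ENNReal.ofReal (z.1 ^ n)).mul (conv_measP hp hg))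

/-- almost-everywhere class -/
def AE3 (k : ℕ) (h : ℝ → ℝ≥0∞) : Prop :=
  Measurable h ∧ (∀ᵐ x ∂U, h x ≠ ∞) ∧ ∃ g ∈ HZ (List.replicate k false), (fun x => (h x).toReal) =ᵐ[U] g

lemma AE3.mul {k : ℕ} {h h' : ℝ → ℝ≥0∞} (a : AE3 k h) (a' : AE3 k h') : AE3 k (h * h') := by
  obtain ⟨m, f, g, hg, e⟩ := a
  obtain ⟨m', f', g', hg', e'⟩ := a'
  refine ⟨m.mul m', ?_, g * g', HZ_mul_k k hg hg', ?_⟩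
  · filter_upwards [f, f'] with x h1 h2 using ENNReal.mul_ne_top h1 h2
  · filter_upwards [e, e'] with x h1 h2
    rw [Pi.mul_apply, ENNReal.toReal_mul, h1, h2, Pi.mul_apply]

lemma AE3.mom {k : ℕ} {h : ℝ → ℝ≥0∞} (a : AE3 k h) :
    ∃ T ∈ TS Z, ∀ n : ℕ, 0 ≤ T (n + 1) ∧ Mo n h = ENNReal.ofReal (T (n + 1) / ((n : ℝ) + 1) ^ (k + 1)) := by
  obtain ⟨m, f, g, hg, e⟩ := a
  obtain ⟨T, hT, hm⟩ := HZ_mom rfl hg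
  refine ⟨T, hT, fun n => ?_⟩
  have e2 : (fun x => x ^ n * g x) =ᵐ[U] fun x => x ^ n * (h x).toReal := by
    filter_upwards [e] with x hx; rw [hx]
  have h0 : 0 ≤ᵐ[U] fun x => x ^ n * g x := by
    filter_upwards [ae_U, e2] with x hx h2
    rw [h2]; exact mul_nonneg (pow_nonneg hx.1.le _) ENNReal.toReal_nonneg
  constructor
  · have := integral_nonneg_of_ae h0
    rw [(hm n).2, le_div_iff₀ (by positivity), zero_mul] at this
    exact this
  · rw [← (hm n).2, ofReal_integral_eq_lintegral_ofReal (hm n).1 h0, Mo]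
    refine lintegral_congr_ae ?_
    filter_upwards [ae_U, e2, f] with x hx h2 hf
    rw [h2, ENNReal.ofReal_mul (pow_nonneg hx.1.le _), ENNReal.ofReal_toReal hf]

lemma AE3_of_mom (k : ℕ) {h : ℝ → ℝ≥0∞} (hm : Measurable h) {T : ℕ → ℝ} (hT : T ∈ TS Z)
    (hM : ∀ n : ℕ, 0 ≤ T (n + 1) ∧ Mo n h = ENNReal.ofReal (T (n + 1) / ((n : ℝ) + 1) ^ (k + 1))) : AE3 k h := by
  have hfin : ∫⁻ x, h x ∂U ≠ ∞ := by rw [← Mo_zero, (hM 0).2]; exact ENNReal.ofReal_ne_top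
  have hae := ae_lt_top hm hfin
  obtain ⟨g, hg, hgm⟩ := HZ_of_TS k hT
  refine ⟨hm, hae.mono fun x hx => hx.ne, g, hg, ?_⟩
  have hi := integrable_toReal_of_lintegral_ne_top hm.aemeasurable hfin
  have hz := mom_unique (hi.sub (HZ_int hg)) fun n => ?_
  · filter_upwards [hz] with x hx
    simpa [sub_eq_zero] using hx
  · have h2 : (fun x => x ^ n * (h x).toReal) =ᵐ[U] fun x => (ENNReal.ofReal (x ^ n) * h x).toReal := by
      filter_upwards [ae_U] with x hx
      rw [ENNReal.toReal_mul, ENNReal.toReal_ofReal (pow_nonneg hx.1.le _)]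
    have hmn : Measurable fun x => ENNReal.ofReal (x ^ n) * h x := by fun_prop
    have hf2 : ∫⁻ x, ENNReal.ofReal (x ^ n) * h x ∂U ≠ ∞ := by
      rw [← Mo, (hM n).2]; exact ENNReal.ofReal_ne_top
    have hi2 : Integrable (fun x => x ^ n * (h x).toReal) U :=
      (integrable_toReal_of_lintegral_ne_top hmn.aemeasurable hf2).congr h2.symm
    simp only [Pi.sub_apply, mul_sub]
    rw [integral_sub hi2 (hgm n).1, (hgm n).2, integral_congr_ae h2,
      integral_toReal hmn.aemeasurable (ae_lt_top hmn hf2), ← Mo, (hM n).2, ENNReal.toReal_ofReal, sub_self]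
    exact div_nonneg (hM n).1 (by positivity)

/-- four-fold convolution -/
def conv4 (p : Fin 4 → ℝ → ℝ≥0∞) : ℝ → ℝ≥0∞ := conv (p 0) (conv (p 1) (conv (p 2) (p 3)))

lemma HE.ae3 {h : ℝ → ℝ≥0∞} (hh : HE [] h) : AE3 0 h :=
  ⟨hh.1, ae_U.mono hh.2.1, _, hh.2.2, EventuallyEq.rfl⟩

lemma AE3.conv {k l : ℕ} {h g : ℝ → ℝ≥0∞} (hh : AE3 k h) (hg : AE3 l g) : AE3 (k + l + 1) (conv h g) := by
  obtain ⟨T, hT, hM⟩ := hh.mom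
  obtain ⟨S, hS, hN⟩ := hg.mom
  refine AE3_of_mom _ (conv_meas hh.1 hg.1) (mul_memTS hT hS) fun n => ⟨mul_nonneg (hM n).1 (hN n).1, ?_⟩
  rw [Mo_conv hh.1 hg.1, (hM n).2, (hN n).2, ← ENNReal.ofReal_mul (div_nonneg (hM n).1 (by positivity)),
    div_mul_div_comm, ← pow_add, Pi.mul_apply]
  congr 3; ring

lemma conv4_ae {p : Fin 4 → ℝ → ℝ≥0∞} (hp : ∀ i, HE [] (p i)) : AE3 3 (conv4 p) := by
  have h1 : AE3 1 _ := AE3.conv (k := 0) (l := 0) (hp 2).ae3 (hp 3).ae3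
  have h2 : AE3 2 _ := AE3.conv (k := 0) (l := 1) (hp 1).ae3 h1
  have h3 : AE3 3 _ := AE3.conv (k := 0) (l := 2) (hp 0).ae3 h2
  exact h3

/-- power series with coefficients `c (n+1)` -/
def Ser (c : ℕ → ℝ) (F : ℝ → ℝ≥0∞) : Prop :=
  (∀ n, 0 ≤ c (n + 1)) ∧ ∀ q ∈ Set.Ioo (0 : ℝ) 1, F q = ∑' n : ℕ, ENNReal.ofReal (c (n + 1) * q ^ n)

lemma ser_geom {c : ℕ → ℝ} {F : ℝ → ℝ≥0∞} (h : Ser c F) :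
    Ser (fun n => ∑ i ∈ range n, c (i + 1)) (fun q => ENNReal.ofReal (1 - q)⁻¹ * F q) := by
  refine ⟨fun n => sum_nonneg fun i _ => h.1 i, fun q hq => ?_⟩
  show ENNReal.ofReal (1 - q)⁻¹ * F q = ∑' n : ℕ, ENNReal.ofReal ((∑ i ∈ range (n + 1), c (i + 1)) * q ^ n)
  rw [h.2 q hq, geom_ofReal hq, mul_comm, ← ENNReal.tsum_mul_right]
  simp only [← ENNReal.tsum_mul_left]
  rw [← ENNReal.tsum_prod (f := fun n k => ENNReal.ofReal (c (n + 1) * q ^ n) * ENNReal.ofReal (q ^ k)),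
    ← Equiv.tsum_eq (Finset.HasAntidiagonal.sigmaAntidiagonalEquivProd (A := ℕ)), ENNReal.tsum_sigma']
  refine tsum_congr fun m => ?_
  rw [tsum_fintype, Finset.sum_coe_sort_eq_attach]
  simp only [Finset.HasAntidiagonal.sigmaAntidiagonalEquivProd_apply]
  rw [Finset.sum_attach (antidiagonal m)
    (fun x : ℕ × ℕ => ENNReal.ofReal (c (x.1 + 1) * q ^ x.1) * ENNReal.ofReal (q ^ x.2)),
    Nat.sum_antidiagonal_eq_sum_range_succ_mk, sum_mul,
    ENNReal.ofReal_sum_of_nonneg fun i _ => mul_nonneg (h.1 i) (pow_nonneg hq.1.le _)]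
  refine sum_congr rfl fun i hi => ?_
  rw [← ENNReal.ofReal_mul (mul_nonneg (h.1 i) (pow_nonneg hq.1.le _)), mul_assoc, ← pow_add,
    Nat.add_sub_cancel' (Nat.lt_succ_iff.1 (mem_range.1 hi))]

lemma ser_int {c : ℕ → ℝ} {F : ℝ → ℝ≥0∞} (h : Ser c fun q => ENNReal.ofReal (1 - q)⁻¹ * F q) :
    Ser (fun n => if n ≤ 1 then 0 else c (n - 1) / ((n - 1 : ℕ) : ℝ)) (Iop true F) := by
  refine ⟨fun n => ?_, fun q hq => ?_⟩
  · rcases n with _ | n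
    · simp
    · simp only [show ¬ (n + 1 + 1 ≤ 1) by omega, if_false]
      exact div_nonneg (h.1 n) (by positivity)
  · rw [tsum_eq_zero_add' ENNReal.summable]
    simp only [zero_add, le_refl, if_true, zero_mul, ENNReal.ofReal_zero, show ∀ n : ℕ, ¬ (n + 1 + 1 ≤ 1) by omega, if_false]
    have e : ∀ t ∈ Set.Ioo (0 : ℝ) 1, kr true q t * F t =
        ∑' n : ℕ, (Set.Iio q).indicator (fun t => ENNReal.ofReal (c (n + 1)) * ENNReal.ofReal (t ^ n)) t := by
      intro t ht
      by_cases hx : t < q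
      · simp only [kr, hx, if_true, Set.indicator, Set.mem_Iio]
        refine (h.2 t ht).trans ?_
        exact tsum_congr fun n => ENNReal.ofReal_mul (h.1 n)
      · simp [kr, hx, Set.indicator]
    rw [Iop, U_congr e, lintegral_tsum]
    · refine tsum_congr fun n => ?_
      rw [lintegral_indicator measurableSet_Iio, U, Measure.restrict_restrict measurableSet_Iio]
      have : Set.Iio q ∩ Set.Ioo 0 1 = Set.Ioo 0 q := by
        ext x; simp only [Set.mem_inter_iff, Set.mem_Iio, Set.mem_Ioo]
        exact ⟨fun h => ⟨h.2.1, h.1⟩, fun h => ⟨h.2, h.1, h.2.trans hq.2⟩⟩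
      rw [this, lintegral_const_mul _ (by fun_prop), lint_pow 0 q le_rfl hq.1.le, ← ENNReal.ofReal_mul (h.1 n)]
      congr 1
      simp only [Nat.add_sub_cancel]
      push_cast
      rw [zero_pow (by omega)]; ring
    · intro n
      exact (Measurable.indicator (by fun_prop) measurableSet_Iio).aemeasurable

lemma Ser.congr {c d : ℕ → ℝ} {F : ℝ → ℝ≥0∞} (h : Ser c F) (hd : ∀ n, d (n + 1) = c (n + 1)) : Ser d F := by
  refine ⟨fun n => by rw [hd]; exact h.1 n, fun q hq => ?_⟩
  simp only [hd]; exact h.2 q hq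

lemma ser_log (j : ℕ) : ∃ a ∈ TS Z, Ser a fun q => ENNReal.ofReal (1 - q)⁻¹ * We (List.replicate j true) q := by
  induction j with
  | zero => exact ⟨1, one_memTS, fun n => by simp, fun q hq => by simpa [We] using geom_ofReal hq⟩
  | succ j ih =>
    obtain ⟨a, ha, h⟩ := ih
    refine ⟨Sm a - dv a, sub_mem (Sm_memTS ha) (dv_memTS ha), (ser_geom (ser_int h)).congr fun n => ?_⟩
    rw [Pi.sub_apply, Sm_succ, dv_apply]
    push_cast
    rw [add_sub_cancel_right, sum_range_succ', Sm_apply]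
    simp

lemma sumTS {T : ℕ → ℝ} (hT : T ∈ TS Z) : ∃ A ∈ TS Z, ∃ B ∈ TS Z, ∀ n : ℕ,
    ∑ i ∈ range n, T (i + 1) = n * A n + B n := by
  induction hT using Submodule.span_induction with
  | mem T hT =>
    obtain ⟨w, rfl⟩ := hT
    induction w with
    | nil => exact ⟨1, one_memTS, 0, zero_mem _, fun n => by simp [Tw]⟩
    | cons b w ih => cases b with
      | false =>
        refine ⟨0, zero_mem _, Sm (Tw w), Sm_memTS (Tw_mem w), fun n => ?_⟩
        simp [Tw, dv_apply, Sm_apply]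
      | true =>
        obtain ⟨A, hA, B, hB, h⟩ := ih
        refine ⟨Sm (Tw w) - A, sub_mem (Sm_memTS (Tw_mem w)) hA, Sm (Tw w) - B, sub_mem (Sm_memTS (Tw_mem w)) hB, fun n => ?_⟩
        have e : ∑ i ∈ range n, Sm (Tw w) (i + 1) = ((n : ℝ) + 1) * Sm (Tw w) n - ∑ i ∈ range n, Tw w (i + 1) := by
          clear h
          induction n with
          | zero => simp [Sm_zero]
          | succ n ih =>
            rw [sum_range_succ, ih, sum_range_succ, Sm_succ]
            have : (n : ℝ) + 1 ≠ 0 := by positivity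
            push_cast; field_simp; ring
        rw [Tw, e, h]; simp only [Pi.sub_apply]; ring
  | zero => exact ⟨0, zero_mem _, 0, zero_mem _, fun n => by simp⟩
  | add T S _ _ hT hS =>
    obtain ⟨A, hA, B, hB, h⟩ := hT
    obtain ⟨A', hA', B', hB', h'⟩ := hS
    refine ⟨_, add_mem hA hA', _, add_mem hB hB', fun n => ?_⟩
    simp only [Pi.add_apply, sum_add_distrib, h, h']; ring
  | smul c T _ hT =>
    obtain ⟨A, hA, B, hB, h⟩ := hT
    refine ⟨_, Submodule.smul_mem _ c hA, _, Submodule.smul_mem _ c hB, fun n => ?_⟩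
    have e : ∀ (f : ℕ → ℝ) n, (c • f) n = (c : ℝ) * f n := fun f n => rfl
    simp only [e, ← mul_sum, h]; ring

lemma sumTS2 {T : ℕ → ℝ} (hT : T ∈ TS Z) : ∃ A ∈ TS Z, ∃ B ∈ TS Z, ∃ C ∈ TS Z, ∀ n : ℕ,
    ∑ i ∈ range n, ((i : ℝ) + 1) * T (i + 1) = n ^ 2 * A n + n * B n + C n := by
  have hhalf : (1 / 2 : ℝ) ∈ Z := by
    have : (1 / 2 : ℝ) = algebraMap ℚ ℝ (1 / 2) := by simp
    rw [this]; exact Z.algebraMap_mem _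
  have e : ∀ (c : Z) (f : ℕ → ℝ) n, (c • f) n = (c : ℝ) * f n := fun c f n => rfl
  induction hT using Submodule.span_induction with
  | mem T hT =>
    obtain ⟨w, rfl⟩ := hT
    induction w with
    | nil =>
      refine ⟨_, const_memTS hhalf, _, const_memTS hhalf, 0, zero_mem _, fun n => ?_⟩
      induction n with
      | zero => simp
      | succ n ih => rw [sum_range_succ, ih]; simp [Tw]; ring
    | cons b w ih => cases b with
      | false =>
        obtain ⟨A, hA, B, hB, h⟩ := sumTS (Tw_mem w)
        refine ⟨0, zero_mem _, A, hA, B, hB, fun n => ?_⟩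
        have : ∀ i : ℕ, ((i : ℝ) + 1) * Tw (false :: w) (i + 1) = Tw w (i + 1) := fun i => by
          rw [Tw, dv_apply]; push_cast; field_simp
        simp only [this, h]; simp
      | true =>
        obtain ⟨A, hA, B, hB, C, hC, h⟩ := ih
        obtain ⟨A', hA', B', hB', h'⟩ := sumTS (Tw_mem w)
        have hS : Sm (Tw w) ∈ TS Z := Sm_memTS (Tw_mem w)
        refine ⟨_, Submodule.smul_mem _ ⟨_, hhalf⟩ (sub_mem hS hA), _, Submodule.smul_mem _ ⟨_, hhalf⟩ (sub_mem (add_mem hS hA') hB),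
          _, Submodule.smul_mem _ ⟨_, hhalf⟩ (sub_mem hB' hC), fun n => ?_⟩
        have e2 : ∑ i ∈ range n, ((i : ℝ) + 1) * Sm (Tw w) (i + 1) = 1 / 2 * (((n : ℝ) + 1) * n * Sm (Tw w) n
            - ∑ i ∈ range n, ((i : ℝ) + 1) * Tw w (i + 1) + ∑ i ∈ range n, Tw w (i + 1)) := by
          clear h h'
          induction n with
          | zero => simp
          | succ n ih =>
            rw [sum_range_succ, ih, sum_range_succ, sum_range_succ, Sm_succ]
            have : (n : ℝ) + 1 ≠ 0 := by positivity
            push_cast; field_simp; ring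
        rw [Tw, e2, h, h']; simp only [e, Pi.sub_apply, Pi.add_apply]; ring
  | zero => exact ⟨0, zero_mem _, 0, zero_mem _, 0, zero_mem _, fun n => by simp⟩
  | add T S _ _ hT hS =>
    obtain ⟨A, hA, B, hB, C, hC, h⟩ := hT
    obtain ⟨A', hA', B', hB', C', hC', h'⟩ := hS
    refine ⟨_, add_mem hA hA', _, add_mem hB hB', _, add_mem hC hC', fun n => ?_⟩
    simp only [Pi.add_apply, mul_add, sum_add_distrib, h, h']; ring
  | smul c T _ hT =>
    obtain ⟨A, hA, B, hB, C, hC, h⟩ := hT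
    refine ⟨_, Submodule.smul_mem _ c hA, _, Submodule.smul_mem _ c hB, _, Submodule.smul_mem _ c hC, fun n => ?_⟩
    simp only [e, mul_left_comm _ (c : ℝ), ← mul_sum, h]; ring

/-- good extended numbers -/
def ZE (X : ℝ≥0∞) : Prop := X ≠ ∞ ∧ X.toReal ∈ Z

lemma ser_ZE {c A B C : ℕ → ℝ} {F h : ℝ → ℝ≥0∞} (hs : Ser c F) (hh : AE3 3 h) (hA : A ∈ TS Z) (hB : B ∈ TS Z)
    (hC : C ∈ TS Z) (hc : ∀ n : ℕ, c n = n ^ 2 * A n + n * B n + C n) : ZE (∫⁻ q, F q * h q ∂U) := by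
  obtain ⟨T, hT, hM⟩ := hh.mom
  set S := A * T + dv (B * T) + dv (dv (C * T)) with hS
  have hSm : S ∈ TS Z := add_mem (add_mem (mul_memTS hA hT) (dv_memTS (mul_memTS hB hT)))
    (dv_memTS (dv_memTS (mul_memTS hC hT)))
  have e1 : ∀ n : ℕ, c (n + 1) * (T (n + 1) / ((n : ℝ) + 1) ^ 4) = dv S (n + 1) / ((n : ℝ) + 1) := by
    intro n
    rw [hc]
    simp only [hS, dv_apply, Pi.add_apply, Pi.mul_apply]
    push_cast
    have : (n : ℝ) + 1 ≠ 0 := by positivity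
    field_simp
  have h0 : ∀ n : ℕ, 0 ≤ dv S (n + 1) / ((n : ℝ) + 1) := fun n => by
    rw [← e1]; exact mul_nonneg (hs.1 n) (div_nonneg (hM n).1 (by positivity))
  have hsum : Summable fun n : ℕ => dv S (n + 1) / ((n : ℝ) + 1) := (summable_dv hSm).of_abs
  have e : ∫⁻ q, F q * h q ∂U = ENNReal.ofReal (∑' n : ℕ, dv S (n + 1) / ((n : ℝ) + 1)) := by
    rw [ENNReal.ofReal_tsum_of_nonneg h0 hsum]
    have e2 : ∀ n : ℕ, ENNReal.ofReal (dv S (n + 1) / ((n : ℝ) + 1)) = ENNReal.ofReal (c (n + 1)) * Mo n h := fun n => by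
      rw [← e1, ENNReal.ofReal_mul (hs.1 n), (hM n).2]
    have hm := hh.1
    simp only [e2, Mo]
    have e3 : ∀ n : ℕ, ENNReal.ofReal (c (n + 1)) * ∫⁻ x, ENNReal.ofReal (x ^ n) * h x ∂U =
        ∫⁻ x, ENNReal.ofReal (c (n + 1)) * (ENNReal.ofReal (x ^ n) * h x) ∂U := fun n =>
      (lintegral_const_mul _ (by fun_prop)).symm
    simp only [e3]
    rw [← lintegral_tsum fun n => by fun_prop]
    refine U_congr fun q hq => ?_
    rw [hs.2 q hq, ← ENNReal.tsum_mul_right]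
    refine tsum_congr fun n => ?_
    rw [ENNReal.ofReal_mul (hs.1 n)]; ring
  rw [e]
  refine ⟨ENNReal.ofReal_ne_top, ?_⟩
  rw [ENNReal.toReal_ofReal (tsum_nonneg h0)]
  exact lim_mem hSm hsum.hasSum.tendsto_sum_nat

lemma We_true_pow (j : ℕ) (x : ℝ) : We [true] x ^ j = (j.factorial : ℝ≥0∞) * We (List.replicate j true) x := by
  have key : ∀ j : ℕ, We [true] * We (List.replicate j true) = ((j + 1 : ℕ) : ℝ≥0∞) • We (List.replicate (j + 1) true) := by
    intro j
    induction j with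
    | zero => ext x; simp [We]
    | succ j ih =>
      have e : We [true] * We (List.replicate (j + 1) true) = Iop true (We [] * Iop true (We (List.replicate j true)))
          + Iop true (We (List.replicate j true) * Iop true (We [])) := by
        ext x; exact Iop_prod true (We_meas []) (We_meas _) x
      have e1 : We [] * Iop true (We (List.replicate j true)) = We (List.replicate (j + 1) true) := by
        simp [We, List.replicate_succ]
      have e2 : We (List.replicate j true) * Iop true (We []) = ((j + 1 : ℕ) : ℝ≥0∞) • We (List.replicate (j + 1) true) := by
        rw [mul_comm]; exact ih
      have e3 : Iop true (((j + 1 : ℕ) : ℝ≥0∞) • We (List.replicate (j + 1) true)) =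
          ((j + 1 : ℕ) : ℝ≥0∞) • Iop true (We (List.replicate (j + 1) true)) := by
        ext x
        simp only [Iop, Pi.smul_apply, smul_eq_mul, mul_left_comm _ ((j + 1 : ℕ) : ℝ≥0∞)]
        exact lintegral_const_mul _ (krm_meas _ _ (We_meas _))
      rw [e, e1, e2, e3]
      have e4 : Iop true (We (List.replicate (j + 1) true)) = We (List.replicate (j + 1 + 1) true) := rfl
      rw [e4]
      push_cast
      ext x; simp only [Pi.add_apply, Pi.smul_apply, smul_eq_mul]; ring
  induction j with
  | zero => simp [We]
  | succ j ih =>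
    have := congrFun (key j) x
    simp only [Pi.mul_apply, Pi.smul_apply, smul_eq_mul] at this
    rw [pow_succ, ih, mul_assoc, mul_comm (We _ x), this, Nat.factorial_succ]
    push_cast; ring

lemma ZE.mulNat {X : ℝ≥0∞} (h : ZE X) (n : ℕ) : ZE (n * X) :=
  ⟨ENNReal.mul_ne_top (ENNReal.natCast_ne_top n) h.1, by
    rw [ENNReal.toReal_mul, ENNReal.toReal_natCast]; exact mul_mem (natc_mem n) h.2⟩

/-- the basic numbers -/
lemma final_ZE (j : ℕ) {p r : Fin 4 → ℝ → ℝ≥0∞} (hp : ∀ i, HE [] (p i)) (hr : ∀ i, HE [] (r i)) :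
    ZE (∫⁻ q, ENNReal.ofReal ((1 + q) / (1 - q) ^ 3) * We [true] q ^ j * (conv4 p q * conv4 r q) ∂U) := by
  have hh := (conv4_ae hp).mul (conv4_ae hr)
  set h := conv4 p * conv4 r
  obtain ⟨a, ha, h1⟩ := ser_log j
  have h2 := ser_geom h1
  have h3 := ser_geom h2
  obtain ⟨A, hA, B, hB, e2⟩ := sumTS ha
  obtain ⟨A1, hA1, B1, hB1, C1, hC1, e3⟩ := sumTS2 hA
  obtain ⟨A2, hA2, B2, hB2, e4⟩ := sumTS hB
  have z2 := ser_ZE h2 hh (A := 0) (zero_mem _) hA hB fun n => by simp [e2]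
  have z3 := ser_ZE h3 hh hA1 (add_mem hB1 hA2) (add_mem hC1 hB2) fun n => by
    simp only [e2]
    have : ∀ i : ℕ, ((i + 1 : ℕ) : ℝ) * A (i + 1) + B (i + 1) = ((i : ℝ) + 1) * A (i + 1) + B (i + 1) := fun i => by push_cast; ring
    simp only [this, sum_add_distrib, e3, e4, Pi.add_apply]; ring
  have y2 := z2.mulNat j.factorial
  have y3 := (z3.mulNat j.factorial).mulNat 2
  set L := We (List.replicate j true) with hL
  have hLm : Measurable L := We_meas _
  have hhm : Measurable h := hh.1
  have hWm : Measurable (We [true]) := We_meas _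
  have key : (∫⁻ q, ENNReal.ofReal ((1 + q) / (1 - q) ^ 3) * We [true] q ^ j * (conv4 p q * conv4 r q) ∂U) +
      j.factorial * ∫⁻ q, ENNReal.ofReal (1 - q)⁻¹ * (ENNReal.ofReal (1 - q)⁻¹ * L q) * h q ∂U =
      (2 : ℕ) * (j.factorial * ∫⁻ q, ENNReal.ofReal (1 - q)⁻¹ * (ENNReal.ofReal (1 - q)⁻¹ * (ENNReal.ofReal (1 - q)⁻¹ * L q)) * h q ∂U) := by
    rw [← lintegral_const_mul _ (by fun_prop), ← lintegral_const_mul _ (by fun_prop), ← lintegral_const_mul _ (by fun_prop),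
      ← lintegral_add_right _ (by fun_prop)]
    refine U_congr fun q hq => ?_
    have hq1 : 0 < 1 - q := by linarith [hq.2]
    have hq0 := hq.1
    have e : conv4 p q * conv4 r q = h q := rfl
    rw [We_true_pow, e]
    have hz : ENNReal.ofReal ((1 + q) / (1 - q) ^ 3) + ENNReal.ofReal (1 - q)⁻¹ * ENNReal.ofReal (1 - q)⁻¹ =
        (2 : ℕ) * (ENNReal.ofReal (1 - q)⁻¹ * (ENNReal.ofReal (1 - q)⁻¹ * ENNReal.ofReal (1 - q)⁻¹)) := by
      have h1' : (0 : ℝ) ≤ (1 - q)⁻¹ := by positivity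
      rw [← ENNReal.ofReal_natCast, ← ENNReal.ofReal_mul h1', ← ENNReal.ofReal_mul h1', ← ENNReal.ofReal_mul (by positivity),
        ← ENNReal.ofReal_add (by positivity) (by positivity)]
      congr 1
      field_simp; push_cast; ring
    have e1 : ∀ u w z a b : ℝ≥0∞, u * (a * w) * b + a * (z * (z * w) * b) = (u + z * z) * (a * w * b) := by
      intros; ring
    rw [e1, hz, ← hL]; ring
  have hne := z2.1
  have hy : _ ≠ ∞ := y3.1
  rw [← key] at hy
  have hx := (ENNReal.add_ne_top.1 hy).1
  refine ⟨hx, ?_⟩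
  have e5 := congrArg ENNReal.toReal key
  rw [ENNReal.toReal_add hx y2.1] at e5
  rw [eq_sub_of_add_eq e5]
  exact sub_mem y3.2 y2.2

end FW

namespace FW
open Filter Topology ENNReal

/-- Lebesgue measure on the positive reals -/
def Pm : Measure ℝ := volume.restrict (Set.Ioi 0)

instance : SigmaFinite Pm := by unfold Pm; infer_instance

/-- power of a measure -/
abbrev pw (n : ℕ) (ν : Measure ℝ) : Measure (Fin n → ℝ) := Measure.pi fun _ => ν

lemma pi_ins (ν : Measure ℝ) [SigmaFinite ν] {n : ℕ} (i : Fin (n + 1)) {G : (Fin (n + 1) → ℝ) → ℝ≥0∞} (hG : Measurable G) :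
    ∫⁻ ξ, G ξ ∂pw (n + 1) ν = ∫⁻ a, ∫⁻ η, G (i.insertNth a η) ∂pw n ν ∂ν := by
  have h := (measurePreserving_piFinSuccAbove (fun _ : Fin (n + 1) => ν) i).symm
  rw [← h.lintegral_comp_emb (MeasurableEquiv.measurableEmbedding _), lintegral_prod _ (by
    exact (hG.comp (MeasurableEquiv.measurable _)).aemeasurable)]
  rfl

lemma meas_ins {n : ℕ} (i : Fin (n + 1)) : Measurable fun z : ℝ × (Fin n → ℝ) => (i.insertNth z.1 z.2 : Fin (n + 1) → ℝ) :=
  (MeasurableEquiv.piFinSuccAbove (fun _ : Fin (n + 1) => ℝ) i).symm.measurable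

lemma pi_ins' (ν : Measure ℝ) [SigmaFinite ν] {n : ℕ} (i : Fin (n + 1)) {G : (Fin (n + 1) → ℝ) → ℝ≥0∞} (hG : Measurable G) :
    ∫⁻ ξ, G ξ ∂pw (n + 1) ν = ∫⁻ η, ∫⁻ a, G (i.insertNth a η) ∂ν ∂pw n ν := by
  rw [pi_ins ν i hG, lintegral_lintegral_swap]
  exact (hG.comp (meas_ins i)).aemeasurable

lemma pi_perm (ν : Measure ℝ) [SigmaFinite ν] {n : ℕ} (σ : Equiv.Perm (Fin n)) (G : (Fin n → ℝ) → ℝ≥0∞) :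
    ∫⁻ ξ, G (ξ ∘ σ) ∂pw n ν = ∫⁻ ξ, G ξ ∂pw n ν := by
  have h := (measurePreserving_piCongrLeft (fun _ : Fin n => ν) σ).symm
  exact h.lintegral_comp_emb (MeasurableEquiv.measurableEmbedding _) G

lemma pm_scale {t : ℝ} (ht : 0 < t) (K : ℝ → ℝ≥0∞) : ∫⁻ a, K a ∂Pm = ENNReal.ofReal t * ∫⁻ a, K (t * a) ∂Pm := by
  have := lintegral_image_eq_lintegral_abs_deriv_mul (s := Set.Ioi (0 : ℝ)) (f := fun s => t * s) (f' := fun _ => t)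
    measurableSet_Ioi (fun x _ => by simpa using ((hasDerivAt_id x).const_mul t).hasDerivWithinAt)
    (fun a _ b _ h => mul_left_cancel₀ ht.ne' h) K
  rw [Set.image_mul_left_Ioi ht, mul_zero, abs_of_pos ht, lintegral_const_mul' _ _ ENNReal.ofReal_ne_top] at this
  exact this

lemma pi_scale {t : ℝ} (ht : 0 < t) {n : ℕ} : ∀ {G : (Fin n → ℝ) → ℝ≥0∞}, Measurable G →
    ∫⁻ ξ, G ξ ∂pw n Pm = ENNReal.ofReal (t ^ n) * ∫⁻ ξ, G (t • ξ) ∂pw n Pm := by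
  induction n with
  | zero =>
    intro G hG
    simp only [pow_zero, ENNReal.ofReal_one, one_mul]
    refine lintegral_congr fun ξ => ?_
    congr 1; exact Subsingleton.elim _ _
  | succ n ih =>
    intro G hG
    rw [pi_ins Pm 0 hG, pi_ins Pm 0 (G := fun ξ => G (t • ξ)) (hG.comp (measurable_const_smul t)), pm_scale ht, pow_succ', ENNReal.ofReal_mul ht.le, mul_assoc]
    congr 1
    rw [← lintegral_const_mul' _ _ ENNReal.ofReal_ne_top]
    refine lintegral_congr fun a => ?_
    rw [ih (G := fun η => G (Fin.insertNth 0 (t * a) η)) (hG.comp ((meas_ins 0).comp measurable_prodMk_left))]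
    congr 1
    refine lintegral_congr fun η => ?_
    congr 1
    ext j
    refine Fin.cases ?_ (fun j => ?_) j <;> simp

lemma iter7 (ν : Measure ℝ) [SigmaFinite ν] {G : (Fin 7 → ℝ) → ℝ≥0∞} (hG : Measurable G) :
    ∫⁻ ξ, G ξ ∂pw 7 ν = ∫⁻ a, ∫⁻ b, ∫⁻ c, ∫⁻ d, ∫⁻ e, ∫⁻ f, ∫⁻ g, G ![a, b, c, d, e, f, g] ∂ν ∂ν ∂ν ∂ν ∂ν ∂ν ∂ν := by
  have m : ∀ {n : ℕ} {G : (Fin (n + 1) → ℝ) → ℝ≥0∞} (a : ℝ), Measurable G → Measurable fun η : Fin n → ℝ => G ((0 : Fin (n + 1)).insertNth a η) :=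
    fun a hG => hG.comp ((meas_ins 0).comp measurable_prodMk_left)
  rw [pi_ins ν 0 hG]
  refine lintegral_congr fun a => ?_
  have h := m a hG
  rw [pi_ins ν 0 h]
  refine lintegral_congr fun b => ?_
  replace h := m b h
  rw [pi_ins ν 0 h]
  refine lintegral_congr fun c => ?_
  replace h := m c h
  rw [pi_ins ν 0 h]
  refine lintegral_congr fun d => ?_
  replace h := m d h
  rw [pi_ins ν 0 h]
  refine lintegral_congr fun e => ?_
  replace h := m e h
  rw [pi_ins ν 0 h]
  refine lintegral_congr fun f => ?_
  replace h := m f h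
  rw [pi_ins ν 0 h]
  refine lintegral_congr fun g => ?_
  rw [lintegral_unique]
  simp only [Fin.insertNth_zero]
  rw [show (pw 0 ν) Set.univ = 1 by simp, mul_one]
  congr 1

lemma sub1 {c : ℝ} (hc : 0 < c) (K : ℝ → ℝ≥0∞) :
    ∫⁻ a, K a ∂Pm = ∫⁻ x, ENNReal.ofReal (c / x ^ 2) * K (c * (1 - x) / x) ∂U := by
  have := lintegral_image_eq_lintegral_abs_deriv_mul (s := Set.Ioo (0 : ℝ) 1) (f := fun x => c * (1 - x) / x) (f' := fun x => - (c / x ^ 2))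
    measurableSet_Ioo (fun x hx => ?_) (fun a ha b hb h => ?_) K
  · have e : (fun x => c * (1 - x) / x) '' Set.Ioo (0 : ℝ) 1 = Set.Ioi 0 := by
      ext z; constructor
      · rintro ⟨x, hx, rfl⟩
        exact div_pos (mul_pos hc (by linarith [hx.2])) hx.1
      · intro hz
        have hz : 0 < z := hz
        refine ⟨c / (c + z), ⟨by positivity, by rw [div_lt_one (by positivity)]; linarith⟩, ?_⟩
        dsimp only; field_simp; ring
    rw [e] at this
    rw [Pm, this]
    refine U_congr fun x hx => ?_
    have := hx.1
    rw [abs_neg, abs_of_pos (by positivity)]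
  · have hx0 := hx.1.ne'
    have := (((hasDerivAt_id x).const_sub 1).const_mul c).div (hasDerivAt_id x) hx0
    refine (this.congr_deriv ?_).hasDerivWithinAt
    simp only [id]; field_simp; ring
  · have h1 := ha.1; have h2 := hb.1
    have h : c * (1 - a) / a = c * (1 - b) / b := h
    rw [div_eq_div_iff h1.ne' h2.ne'] at h
    have : c * (b - a) = 0 := by linarith
    rcases mul_eq_zero.1 this with h | h <;> linarith

lemma U_refl (K : ℝ → ℝ≥0∞) : ∫⁻ x, K x ∂U = ∫⁻ x, K (1 - x) ∂U := by
  have := lintegral_image_eq_lintegral_abs_deriv_mul (s := Set.Ioo (0 : ℝ) 1) (f := fun x => 1 - x) (f' := fun x => -1)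
    measurableSet_Ioo (fun x hx => by simpa using ((hasDerivAt_id x).const_sub 1).hasDerivWithinAt) (fun a ha b hb h => by simpa using h) K
  simp only [Set.image_const_sub_Ioo, sub_self, sub_zero, abs_neg, abs_one, ENNReal.ofReal_one, one_mul] at this
  exact this

lemma sub2 {c : ℝ} (hc : 0 < c) (K : ℝ → ℝ≥0∞) :
    ∫⁻ a, K a ∂Pm = ∫⁻ x, ENNReal.ofReal (c / (1 - x) ^ 2) * K (c * x / (1 - x)) ∂U := by
  rw [sub1 hc, U_refl]; simp

lemma Pm_congr {f g : ℝ → ℝ≥0∞} (h : ∀ x, 0 < x → f x = g x) : ∫⁻ x, f x ∂Pm = ∫⁻ x, g x ∂Pm :=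
  setLIntegral_congr_fun measurableSet_Ioi fun x hx => h x hx

lemma ae_Pm : ∀ᵐ x ∂Pm, 0 < x := ae_restrict_mem measurableSet_Ioi

lemma ae_pw {ν : Measure ℝ} [SigmaFinite ν] {P : ℝ → Prop} (h : ∀ᵐ x ∂ν, P x) (n : ℕ) : ∀ᵐ ξ ∂pw n ν, ∀ i, P (ξ i) :=
  ae_all_iff.2 fun _ => Measure.tendsto_eval_ae_ae.eventually h

lemma pw_congr {n : ℕ} {f g : (Fin n → ℝ) → ℝ≥0∞} (h : ∀ x, (∀ i, 0 < x i) → f x = g x) :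
    ∫⁻ x, f x ∂pw n Pm = ∫⁻ x, g x ∂pw n Pm :=
  lintegral_congr_ae ((ae_pw ae_Pm n).mono fun x hx => h x hx)

/-- gauge function -/
def gg (t : ℝ) : ℝ≥0∞ := (Set.Icc (1 : ℝ) 2).indicator 1 t

lemma gg_meas : Measurable gg := measurable_one.indicator measurableSet_Icc

def L2 : ℝ≥0∞ := ∫⁻ t, gg t * ENNReal.ofReal t⁻¹ ∂Pm

lemma L2_eq : L2 = ∫⁻ t in Set.Icc (1 : ℝ) 2, ENNReal.ofReal t⁻¹ := by
  have e : ∀ t, gg t * ENNReal.ofReal t⁻¹ = (Set.Icc (1 : ℝ) 2).indicator (fun t => ENNReal.ofReal t⁻¹) t := by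
    intro t
    by_cases h : t ∈ Set.Icc (1 : ℝ) 2 <;> simp [gg, h]
  simp only [L2, e]
  rw [lintegral_indicator measurableSet_Icc, Pm, Measure.restrict_restrict measurableSet_Icc]
  congr 2
  exact Set.inter_eq_left.2 fun x hx => lt_of_lt_of_le one_pos hx.1

lemma L2_ne_top : L2 ≠ ∞ := by
  rw [L2_eq]
  refine ((setLIntegral_mono (g := fun _ => 1) measurable_const fun x hx => ?_).trans_lt ?_).ne
  · rw [← ENNReal.ofReal_one]; exact ENNReal.ofReal_le_ofReal (inv_le_one_of_one_le₀ hx.1)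
  · simp

lemma L2_ne_zero : L2 ≠ 0 := by
  rw [L2_eq]
  have h : ∫⁻ t in Set.Icc (1 : ℝ) 2, ENNReal.ofReal (1 / 2) ≤ ∫⁻ t in Set.Icc (1 : ℝ) 2, ENNReal.ofReal t⁻¹ :=
    setLIntegral_mono (by fun_prop) fun x hx => ENNReal.ofReal_le_ofReal (by
      rw [one_div]; exact inv_anti₀ (by linarith [hx.1]) hx.2)
  intro h0
  rw [h0, lintegral_const] at h
  simp at h

lemma L2_scale {c : ℝ} (hc : 0 < c) : ∫⁻ t, gg (c * t) * ENNReal.ofReal t⁻¹ ∂Pm = L2 := by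
  conv_rhs => rw [L2, pm_scale hc, ← lintegral_const_mul' _ _ ENNReal.ofReal_ne_top]
  refine Pm_congr fun t ht => ?_
  rw [mul_left_comm, ← ENNReal.ofReal_mul hc.le]
  congr 2; rw [mul_inv, mul_inv_cancel_left₀ hc.ne']

/-- homogeneity of degree `-8` -/
def Hom8 (F : (Fin 8 → ℝ) → ℝ≥0∞) : Prop :=
  ∀ t : ℝ, 0 < t → ∀ c : Fin 8 → ℝ, (∀ i, 0 < c i) → F (t • c) = ENNReal.ofReal (t ^ 8)⁻¹ * F c

lemma sn_pos {η : Fin 7 → ℝ} {a : ℝ} (h : ∀ i, 0 < η i) (ha : 0 < a) (i : Fin 8) : 0 < (Fin.last 7).insertNth (α := fun _ => ℝ) a η i := by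
  refine Fin.succAboveCases (Fin.last 7) ?_ (fun i => ?_) i
  · rw [Fin.insertNth_apply_same]; exact ha
  · rw [Fin.insertNth_apply_succAbove]; exact h i

lemma sn_smul {η : Fin 7 → ℝ} {a t : ℝ} : (Fin.last 7).insertNth (α := fun _ => ℝ) (t * a) (t • η) = t • (Fin.last 7).insertNth (α := fun _ => ℝ) a η := by
  ext i
  refine Fin.succAboveCases (Fin.last 7) ?_ (fun i => ?_) i
  · rw [Pi.smul_apply, Fin.insertNth_apply_same, Fin.insertNth_apply_same, smul_eq_mul]
  · rw [Pi.smul_apply, Fin.insertNth_apply_succAbove, Fin.insertNth_apply_succAbove, Pi.smul_apply]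

lemma pw_L2 (t : ℝ) (ht : 0 < t) : ENNReal.ofReal (t ^ 7) * ENNReal.ofReal (t ^ 8)⁻¹ = ENNReal.ofReal t⁻¹ := by
  rw [← ENNReal.ofReal_mul (by positivity)]
  congr 1; field_simp

lemma chart {F : (Fin 8 → ℝ) → ℝ≥0∞} (hF : Measurable F) (hh : Hom8 F) :
    ∫⁻ c, gg (c (Fin.last 7)) * F c ∂pw 8 Pm = L2 * ∫⁻ η, F ((Fin.last 7).insertNth 1 η) ∂pw 7 Pm := by
  have hm : Measurable fun c : Fin 8 → ℝ => gg (c (Fin.last 7)) * F c := (gg_meas.comp (measurable_pi_apply _)).mul hF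
  have hg := gg_meas
  have hm2 : Measurable fun η : Fin 7 → ℝ => F ((Fin.last 7).insertNth 1 η) := hF.comp ((meas_ins _).comp measurable_prodMk_left)
  rw [pi_ins Pm (Fin.last 7) hm, L2, ← lintegral_mul_const _ (by fun_prop)]
  refine Pm_congr fun t ht => ?_
  rw [pi_scale ht (G := fun η => gg ((Fin.last 7).insertNth (α := fun _ => ℝ) t η (Fin.last 7)) * F ((Fin.last 7).insertNth t η))
    (hm.comp ((meas_ins _).comp measurable_prodMk_left))]
  simp only [Fin.insertNth_apply_same]
  rw [← pw_L2 t ht, mul_left_comm, mul_assoc (ENNReal.ofReal (t ^ 7))]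
  congr 1
  rw [← lintegral_const_mul _ hm2]
  refine pw_congr fun η hη => ?_
  have := sn_smul (η := η) (a := 1) (t := t)
  rw [mul_one] at this
  rw [this, hh t ht _ (sn_pos hη one_pos), mul_assoc]
end FW

namespace FW
open Filter Topology ENNReal

def par (s a : ℝ) : ℝ := s * a / (s + a)
def f1 (v : Fin 7 → ℝ) (t : ℝ) : ℝ := t + v 0
def g1 (v : Fin 7 → ℝ) (t : ℝ) : ℝ := par (v 1) (f1 v t)
def f2 (v : Fin 7 → ℝ) (t : ℝ) : ℝ := g1 v t + v 2
def g2 (v : Fin 7 → ℝ) (t : ℝ) : ℝ := par (v 3) (f2 v t)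
def f3 (v : Fin 7 → ℝ) (t : ℝ) : ℝ := g2 v t + v 4
def g3 (v : Fin 7 → ℝ) (t : ℝ) : ℝ := par (v 5) (f3 v t)
def f4 (v : Fin 7 → ℝ) (t : ℝ) : ℝ := g3 v t + v 6
def S4 (v : Fin 7 → ℝ) (t : ℝ) : ℝ := t * f4 v t / (f4 v t - t)
def dd (v : Fin 7 → ℝ) (t : ℝ) : ℝ := (g3 v t / f3 v t) ^ 2 * ((g2 v t / f2 v t) ^ 2 * (g1 v t / f1 v t) ^ 2)
def Jc (v : Fin 7 → ℝ) (t : ℝ) : ℝ := (S4 v t / t) ^ 2 * (1 - (t / f4 v t) ^ 2 * dd v t)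

lemma par_pos {s a : ℝ} (hs : 0 < s) (ha : 0 < a) : 0 < par s a := by unfold par; positivity

lemma par_ratio {s a : ℝ} (hs : 0 < s) (ha : 0 < a) : 0 < par s a / a ∧ par s a / a < 1 := by
  have : par s a / a = s / (s + a) := by unfold par; field_simp
  rw [this]
  exact ⟨by positivity, by rw [div_lt_one (by positivity)]; linarith⟩

lemma par_smul {k : ℝ} (hk : 0 < k) (s a : ℝ) : par (k * s) (k * a) = k * par s a := by
  unfold par
  rw [← mul_add, mul_div_assoc, mul_div_mul_left _ _ hk.ne', mul_assoc, mul_div_assoc]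

lemma par_deriv {F : ℝ → ℝ} {F' t s : ℝ} (h : HasDerivAt F F' t) (hs : 0 < s) (hF : 0 < F t) :
    HasDerivAt (fun t => par s (F t)) ((par s (F t) / F t) ^ 2 * F') t := by
  have := (h.const_mul s).fun_div (h.const_add s) (by positivity)
  refine this.congr_deriv ?_
  unfold par; field_simp; ring

lemma par_dec {s a b t t' : ℝ} (hs : 0 < s) (ha : 0 < a) (hb : 0 < b) (ht : t < t') (h : b * t ≤ a * t') :
    par s b * t ≤ par s a * t' := by
  unfold par
  rw [div_mul_eq_mul_div, div_mul_eq_mul_div, div_le_div_iff₀ (by positivity) (by positivity)]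
  have h1 : s * s * (b * t) ≤ s * s * (a * t') := mul_le_mul_of_nonneg_left h (by positivity)
  have h2 : s * a * b * t ≤ s * a * b * t' := mul_le_mul_of_nonneg_left ht.le (by positivity)
  nlinarith

lemma ch_pos {v : Fin 7 → ℝ} (hv : ∀ i, 0 < v i) {t : ℝ} (ht : 0 ≤ t) :
    0 < f1 v t ∧ 0 < g1 v t ∧ 0 < f2 v t ∧ 0 < g2 v t ∧ 0 < f3 v t ∧ 0 < g3 v t ∧ 0 < f4 v t := by
  have h1 : 0 < f1 v t := add_pos_of_nonneg_of_pos ht (hv 0)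
  have h2 : 0 < g1 v t := par_pos (hv 1) h1
  have h3 : 0 < f2 v t := add_pos h2 (hv 2)
  have h4 : 0 < g2 v t := par_pos (hv 3) h3
  have h5 : 0 < f3 v t := add_pos h4 (hv 4)
  have h6 : 0 < g3 v t := par_pos (hv 5) h5
  exact ⟨h1, h2, h3, h4, h5, h6, add_pos h6 (hv 6)⟩

lemma ch_deriv {v : Fin 7 → ℝ} (hv : ∀ i, 0 < v i) {t : ℝ} (ht : 0 ≤ t) : HasDerivAt (f4 v) (dd v t) t := by
  obtain ⟨p1, p2, p3, p4, p5, p6, p7⟩ := ch_pos hv ht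
  have h1 : HasDerivAt (f1 v) 1 t := (hasDerivAt_id t).add_const _
  have h2 : HasDerivAt (f2 v) _ t := (par_deriv h1 (hv 1) p1).add_const _
  have h3 : HasDerivAt (f3 v) _ t := (par_deriv h2 (hv 3) p3).add_const _
  have h4 : HasDerivAt (f4 v) _ t := (par_deriv h3 (hv 5) p5).add_const _
  refine h4.congr_deriv ?_
  simp only [dd, g1, g2, g3, mul_one]

lemma ch_dec {v : Fin 7 → ℝ} (hv : ∀ i, 0 < v i) {t t' : ℝ} (ht : 0 < t) (h : t < t') : f4 v t' * t < f4 v t * t' := by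
  obtain ⟨p1, p2, p3, p4, p5, p6, p7⟩ := ch_pos hv ht.le
  obtain ⟨q1, q2, q3, q4, q5, q6, q7⟩ := ch_pos hv (ht.trans h).le
  have st : ∀ a b r : ℝ, 0 < r → b * t ≤ a * t' → (b + r) * t < (a + r) * t' := fun a b r hr h' => by nlinarith
  have h1 : f1 v t' * t ≤ f1 v t * t' := (st t t' (v 0) (hv 0) (mul_comm _ _).le).le
  have h2 : f2 v t' * t ≤ f2 v t * t' := (st _ _ (v 2) (hv 2) (par_dec (hv 1) p1 q1 h h1)).le
  have h3 : f3 v t' * t ≤ f3 v t * t' := (st _ _ (v 4) (hv 4) (par_dec (hv 3) p3 q3 h h2)).le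
  exact st _ _ (v 6) (hv 6) (par_dec (hv 5) p5 q5 h h3)

lemma dd_lt {v : Fin 7 → ℝ} (hv : ∀ i, 0 < v i) {t : ℝ} (ht : 0 < t) (h : t < f4 v t) :
    0 < 1 - (t / f4 v t) ^ 2 * dd v t := by
  obtain ⟨p1, p2, p3, p4, p5, p6, p7⟩ := ch_pos hv ht.le
  have st : ∀ x : ℝ, 0 < x ∧ x < 1 → 0 < x ^ 2 ∧ x ^ 2 < 1 := fun x hx => ⟨pow_pos hx.1 2, pow_lt_one₀ hx.1.le hx.2 two_ne_zero⟩
  have mm : ∀ x y : ℝ, 0 < x ∧ x < 1 → 0 < y ∧ y < 1 → 0 < x * y ∧ x * y < 1 := fun x y hx hy =>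
    ⟨mul_pos hx.1 hy.1, mul_lt_one_of_nonneg_of_lt_one_left hx.1.le hx.2 hy.2.le⟩
  have := mm _ _ (st _ ⟨div_pos ht p7, (div_lt_one p7).2 h⟩) (mm _ _ (st _ (par_ratio (hv 5) p5))
    (mm _ _ (st _ (par_ratio (hv 3) p3)) (st _ (par_ratio (hv 1) p1))))
  have := this.2
  simp only [dd, g1, g2, g3] at *
  linarith

lemma f4_meas : Measurable fun z : (Fin 7 → ℝ) × ℝ => f4 z.1 z.2 := by
  unfold f4 g3 f3 g2 f2 g1 f1 par; fun_prop

lemma S4_meas : Measurable fun z : (Fin 7 → ℝ) × ℝ => S4 z.1 z.2 := by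
  have := f4_meas
  unfold S4; fun_prop

lemma Jc_meas : Measurable fun z : (Fin 7 → ℝ) × ℝ => Jc z.1 z.2 := by
  have := f4_meas
  have := S4_meas
  unfold Jc dd g3 f3 g2 f2 g1 f1 par; fun_prop

lemma S4_image {v : Fin 7 → ℝ} (hv : ∀ i, 0 < v i) : S4 v '' {t | 0 < t ∧ t < f4 v t} = Set.Ioi 0 := by
  ext s; constructor
  · rintro ⟨t, ⟨h1, h2⟩, rfl⟩
    exact div_pos (mul_pos h1 (h1.trans h2)) (by linarith)
  · intro hs
    have hs : 0 < s := hs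
    have hc : ContinuousOn (fun t => par s (f4 v t) - t) (Set.Icc 0 s) := fun t ht => by
      have h4 := (ch_pos hv ht.1).2.2.2.2.2.2
      exact ((par_deriv (ch_deriv hv ht.1) hs h4).sub (hasDerivAt_id t)).continuousAt.continuousWithinAt
    have h0 := par_pos hs (ch_pos hv le_rfl).2.2.2.2.2.2
    have hp : ∀ t, 0 ≤ t → par s (f4 v t) < s := fun t ht => by
      have h4 := (ch_pos hv ht).2.2.2.2.2.2
      unfold par; rw [div_lt_iff₀ (by positivity)]; nlinarith
    obtain ⟨t, ht, h⟩ := intermediate_value_Icc' hs.le hc (show (0 : ℝ) ∈ Set.Icc _ _ from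
      ⟨by have := hp s hs.le; linarith, by linarith⟩)
    have h4 := (ch_pos hv ht.1).2.2.2.2.2.2
    have h : par s (f4 v t) = t := by linarith
    have ht0 : 0 < t := by rw [← h]; exact par_pos hs h4
    have h5 : s * f4 v t = t * (s + f4 v t) := by
      unfold par at h; rw [div_eq_iff (by positivity)] at h; exact h
    have h6 : t < f4 v t := by
      have := hp t ht.1
      rw [h] at this
      by_contra hh
      push Not at hh
      nlinarith
    refine ⟨t, ⟨ht0, h6⟩, ?_⟩
    unfold S4; rw [div_eq_iff (by linarith)]; linarith

lemma S4_sub {v : Fin 7 → ℝ} (hv : ∀ i, 0 < v i) (K : ℝ → ℝ≥0∞) :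
    ∫⁻ s, K s ∂Pm = ∫⁻ t, (if t < f4 v t then ENNReal.ofReal (Jc v t) * K (S4 v t) else 0) ∂Pm := by
  have hmv : Measurable (f4 v) := f4_meas.comp measurable_prodMk_left
  have hm : MeasurableSet {t | t < f4 v t} := measurableSet_lt measurable_id hmv
  have hD : {t | 0 < t ∧ t < f4 v t} = {t | t < f4 v t} ∩ Set.Ioi 0 := by ext t; simp [and_comm]
  have := lintegral_image_eq_lintegral_abs_deriv_mul (s := {t | 0 < t ∧ t < f4 v t}) (f := S4 v) (f' := Jc v)
    (hD ▸ hm.inter measurableSet_Ioi) (fun t ht => ?_) ?_ K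
  · rw [S4_image hv] at this
    rw [Pm, this, hD, ← Measure.restrict_restrict hm, ← lintegral_indicator hm]
    refine setLIntegral_congr_fun measurableSet_Ioi fun t ht => ?_
    by_cases h : t < f4 v t
    · simp only [Set.indicator, Set.mem_ofPred_eq, h, if_true]
      rw [abs_of_nonneg (show 0 ≤ Jc v t from mul_nonneg (sq_nonneg _) (dd_lt hv ht h).le)]
    · simp [Set.indicator, h]
  · have h4 := ch_deriv hv ht.1.le
    have h0 : f4 v t - t ≠ 0 := by linarith [ht.2]
    have h5 := (ch_pos hv ht.1.le).2.2.2.2.2.2.ne'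
    have h6 := ht.1.ne'
    have := ((hasDerivAt_id t).mul h4).fun_div (h4.sub (hasDerivAt_id t)) h0
    refine (this.congr_deriv ?_).hasDerivWithinAt
    simp only [id, Pi.mul_apply, Pi.sub_apply]
    unfold Jc S4; generalize dd v t = D; generalize f4 v t = F at *
    field_simp; ring
  · have key : ∀ a ∈ {t | 0 < t ∧ t < f4 v t}, ∀ b ∈ {t | 0 < t ∧ t < f4 v t}, a < b → S4 v a ≠ S4 v b := by
      rintro a ⟨ha, ha'⟩ b ⟨hb, hb'⟩ hab
      have h := ch_dec hv ha hab
      refine ne_of_lt ?_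
      unfold S4
      rw [div_lt_div_iff₀ (by linarith) (by linarith)]
      have h1 : 0 < f4 v b := hb.trans hb'
      have h2 : 0 < f4 v a := ha.trans ha'
      have h3 := mul_pos (mul_pos (sub_pos.2 hab) h1) (sub_pos.2 ha')
      have h5 := mul_pos ha (sub_pos.2 h)
      linarith
    intro a ha b hb h
    rcases lt_trichotomy a b with h' | h' | h'
    · exact absurd h (key a ha b hb h')
    · exact h'
    · exact absurd h.symm (key b hb a ha h')

lemma ch_smul {k : ℝ} (hk : 0 < k) (v : Fin 7 → ℝ) :
    f1 (k • v) k = k * f1 v 1 ∧ g1 (k • v) k = k * g1 v 1 ∧ f2 (k • v) k = k * f2 v 1 ∧ g2 (k • v) k = k * g2 v 1 ∧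
    f3 (k • v) k = k * f3 v 1 ∧ g3 (k • v) k = k * g3 v 1 ∧ f4 (k • v) k = k * f4 v 1 := by
  have a1 : f1 (k • v) k = k * f1 v 1 := by simp [f1, mul_add]
  have b1 : g1 (k • v) k = k * g1 v 1 := by rw [g1, a1]; exact par_smul hk _ _
  have a2 : f2 (k • v) k = k * f2 v 1 := by rw [f2, b1]; simp [f2, mul_add]
  have b2 : g2 (k • v) k = k * g2 v 1 := by rw [g2, a2]; exact par_smul hk _ _
  have a3 : f3 (k • v) k = k * f3 v 1 := by rw [f3, b2]; simp [f3, mul_add]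
  have b3 : g3 (k • v) k = k * g3 v 1 := by rw [g3, a3]; exact par_smul hk _ _
  exact ⟨a1, b1, a2, b2, a3, b3, by rw [f4, b3]; simp [f4, mul_add]⟩

lemma S4_smul {k : ℝ} (hk : 0 < k) (v : Fin 7 → ℝ) : S4 (k • v) k = k * S4 v 1 := by
  rw [S4, (ch_smul hk v).2.2.2.2.2.2, S4, one_mul]
  rw [show k * f4 v 1 - k = k * (f4 v 1 - 1) by ring, mul_div_mul_left _ _ hk.ne', mul_div_assoc]

lemma Jc_smul {k : ℝ} (hk : 0 < k) (v : Fin 7 → ℝ) : Jc (k • v) k = Jc v 1 := by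
  obtain ⟨p1, p2, p3, p4, p5, p6, p7⟩ := ch_smul hk v
  have e : ∀ a b : ℝ, k * a / (k * b) = a / b := fun a b => mul_div_mul_left _ _ hk.ne'
  have e1 : ∀ b : ℝ, k / (k * b) = 1 / b := fun b => by simpa using e 1 b
  have e2 : ∀ b : ℝ, k * b / k = b / 1 := fun b => by simpa using e b 1
  unfold Jc dd
  rw [S4_smul hk, p1, p2, p3, p4, p5, p6, p7, e, e, e, e1, e2]

/-- passing to the gauge `u₁ = 1` -/
lemma gauge {F : (Fin 8 → ℝ) → ℝ≥0∞} (hF : Measurable F) (hh : Hom8 F) (j : Fin 8) :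
    ∫⁻ c, gg (c j) * F c ∂pw 8 Pm = L2 * ∫⁻ v, (if 1 < f4 v 1 then
      ENNReal.ofReal (Jc v 1) * F ((Fin.last 7).insertNth (S4 v 1) v) else 0) ∂pw 7 Pm := by
  have hg := gg_meas
  have hm : Measurable fun c : Fin 8 → ℝ => gg (c j) * F c := (gg_meas.comp (measurable_pi_apply _)).mul hF
  have hS := S4_meas
  have hJ := Jc_meas
  have hf := f4_meas
  have hI : Measurable fun z : (Fin 7 → ℝ) × ℝ => ((Fin.last 7).insertNth (S4 z.1 z.2) z.1 : Fin 8 → ℝ) :=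
    (meas_ins (Fin.last 7)).comp (hS.prodMk measurable_fst)
  have hW : Measurable fun z : (Fin 7 → ℝ) × ℝ => if z.2 < f4 z.1 z.2 then
      ENNReal.ofReal (Jc z.1 z.2) * (gg (((Fin.last 7).insertNth (S4 z.1 z.2) z.1 : Fin 8 → ℝ) j) *
        F ((Fin.last 7).insertNth (S4 z.1 z.2) z.1)) else 0 :=
    Measurable.ite (measurableSet_lt measurable_snd hf) (hJ.ennreal_ofReal.mul (hm.comp hI)) measurable_const
  rw [pi_ins' Pm (Fin.last 7) hm, pw_congr fun v hv => S4_sub hv _, lintegral_lintegral_swap hW.aemeasurable]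
  have hmv : Measurable fun v : Fin 7 → ℝ => (v, (1 : ℝ)) := by fun_prop
  have e1 : ∀ t : ℝ, 0 < t → (∫⁻ v, (if t < f4 v t then
      ENNReal.ofReal (Jc v t) * (gg (((Fin.last 7).insertNth (S4 v t) v : Fin 8 → ℝ) j) *
        F ((Fin.last 7).insertNth (S4 v t) v)) else 0) ∂pw 7 Pm) =
      ∫⁻ v, gg (((Fin.last 7).insertNth (S4 v 1) v : Fin 8 → ℝ) j * t) * ENNReal.ofReal t⁻¹ * (if 1 < f4 v 1 then
      ENNReal.ofReal (Jc v 1) * F ((Fin.last 7).insertNth (S4 v 1) v) else 0) ∂pw 7 Pm := by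
    intro t ht
    rw [pi_scale ht (G := fun v => if t < f4 v t then
      ENNReal.ofReal (Jc v t) * (gg (((Fin.last 7).insertNth (S4 v t) v : Fin 8 → ℝ) j) *
        F ((Fin.last 7).insertNth (S4 v t) v)) else 0) (hW.comp measurable_prodMk_right),
      ← lintegral_const_mul' _ _ ENNReal.ofReal_ne_top]
    refine pw_congr fun v hv => ?_
    rw [(ch_smul ht v).2.2.2.2.2.2, Jc_smul ht, S4_smul ht, sn_smul]
    have h1 : t < t * f4 v 1 ↔ 1 < f4 v 1 := by
      constructor <;> intro h <;> nlinarith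
    by_cases h : 1 < f4 v 1
    · have hS0 : 0 < S4 v 1 := div_pos (mul_pos one_pos (ch_pos hv zero_le_one).2.2.2.2.2.2) (by linarith)
      rw [if_pos (h1.2 h), if_pos h, hh t ht _ (sn_pos hv hS0), ← pw_L2 t ht, Pi.smul_apply, smul_eq_mul, mul_comm t]
      ring
    · rw [if_neg (fun h' => h (h1.1 h')), if_neg h, mul_zero, mul_zero]
  rw [Pm_congr e1, lintegral_lintegral_swap, ← lintegral_const_mul]
  · refine pw_congr fun v hv => ?_
    by_cases h : 1 < f4 v 1
    · have hS0 : 0 < S4 v 1 := div_pos (mul_pos one_pos (ch_pos hv zero_le_one).2.2.2.2.2.2) (by linarith)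
      rw [lintegral_mul_const _ (by fun_prop), L2_scale (sn_pos hv hS0 j)]
    · simp [h]
  · exact Measurable.ite (measurableSet_lt measurable_const (hf.comp hmv)) ((hJ.comp hmv).ennreal_ofReal.mul (hF.comp (hI.comp hmv))) measurable_const
  · refine Measurable.aemeasurable ?_
    have h1 : Measurable fun z : ℝ × (Fin 7 → ℝ) => ((Fin.last 7).insertNth (S4 z.2 1) z.2 : Fin 8 → ℝ) :=
      hI.comp (hmv.comp measurable_snd)
    have h2 : Measurable fun z : ℝ × (Fin 7 → ℝ) => if 1 < f4 z.2 1 then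
      ENNReal.ofReal (Jc z.2 1) * F ((Fin.last 7).insertNth (S4 z.2 1) z.2) else 0 :=
      Measurable.ite (measurableSet_lt measurable_const ((hf.comp hmv).comp measurable_snd))
        (((hJ.comp hmv).comp measurable_snd).ennreal_ofReal.mul (hF.comp h1)) measurable_const
    have h3 : Measurable fun z : ℝ × (Fin 7 → ℝ) => ((Fin.last 7).insertNth (S4 z.2 1) z.2 : Fin 8 → ℝ) j :=
      (measurable_pi_apply j).comp h1
    exact ((hg.comp (h3.mul measurable_fst)).mul (by fun_prop)).mul h2
end FW

namespace FW
open Filter Topology ENNReal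

/-- the Kirchhoff polynomial of the wheel with four spokes, transfer matrix form -/
def PsiW (r s r' s' p t p' t' : ℝ) : ℝ :=
  ((s + r) * (s' + r') + r * s) * ((t + p) * (t' + p') + p * t) +
  ((s + r) * (r' * s') + r * s * s') * (t' + p' + t) +
  (s' + r' + s) * ((t + p) * (p' * t') + p * t * t') +
  (r' * s' + s * s') * (p' * t' + t * t') - 2 * (s * s' * t * t')

def Psi8 (c : Fin 8 → ℝ) : ℝ := PsiW (c 0) (c 1) (c 2) (c 3) (c 4) (c 5) (c 6) (c 7)

lemma PsiW_zig (u₁ u₂ u₃ u₄ w₁ w₂ w₃ w₄ : ℝ) (h₁ : w₁ - u₂ ≠ 0) (h₂ : w₂ - u₃ ≠ 0) (h₃ : w₃ - u₄ ≠ 0) (h₄ : w₄ - u₁ ≠ 0) :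
    PsiW (w₁ - u₁) (u₂ * w₁ / (w₁ - u₂)) (w₂ - u₂) (u₃ * w₂ / (w₂ - u₃)) (w₃ - u₃) (u₄ * w₃ / (w₃ - u₄)) (w₄ - u₄) (u₁ * w₄ / (w₄ - u₁)) =
    (w₁ * w₂ * w₃ * w₄ - u₁ * u₂ * u₃ * u₄) ^ 2 / ((w₁ - u₂) * (w₂ - u₃) * (w₃ - u₄) * (w₄ - u₁)) := by
  unfold PsiW
  obtain ⟨d₁, rfl⟩ : ∃ d, w₁ = d + u₂ := ⟨w₁ - u₂, by ring⟩
  obtain ⟨d₂, rfl⟩ : ∃ d, w₂ = d + u₃ := ⟨w₂ - u₃, by ring⟩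
  obtain ⟨d₃, rfl⟩ : ∃ d, w₃ = d + u₄ := ⟨w₃ - u₄, by ring⟩
  obtain ⟨d₄, rfl⟩ : ∃ d, w₄ = d + u₁ := ⟨w₄ - u₁, by ring⟩
  simp only [add_sub_cancel_right] at *
  field_simp
  ring

lemma par_y {c y : ℝ} (hc : 0 < c) (hy : y < 1) : par (c * y / (1 - y)) c = c * y := by
  unfold par
  have : 1 - y ≠ 0 := by linarith
  have h2 : c * y / (1 - y) + c = c / (1 - y) := by field_simp; ring
  rw [h2]; field_simp

lemma add_x {u x : ℝ} (hx : 0 < x) : u + u * (1 - x) / x = u / x := by field_simp; ring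

/-- first seven coordinates -/
def Tv (a b c d e f g : ℝ) : Fin 7 → ℝ :=
  ![1 * (1 - a) / a, 1 / a * b / (1 - b), 1 / a * b * (1 - c) / c, 1 / a * b / c * d / (1 - d),
    1 / a * b / c * d * (1 - e) / e, 1 / a * b / c * d / e * f / (1 - f), 1 / a * b / c * d / e * f * (1 - g) / g]

/-- the parametrization -/
def Th (ξ : Fin 7 → ℝ) : Fin 8 → ℝ :=
  (Fin.last 7).insertNth (S4 (Tv (ξ 0) (ξ 1) (ξ 2) (ξ 3) (ξ 4) (ξ 5) (ξ 6)) 1) (Tv (ξ 0) (ξ 1) (ξ 2) (ξ 3) (ξ 4) (ξ 5) (ξ 6))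

/-- the density -/
def dens (a b c d e f g : ℝ) : ℝ≥0∞ :=
  if a * c * e * g < b * d * f then ENNReal.ofReal ((1 + a * c * e * g) / (1 - a * c * e * g) ^ 3 / (b * d * f)) else 0

/-- the good region -/
def Rg (a b c d e f g : ℝ) : Prop := a ∈ Set.Ioo (0 : ℝ) 1 ∧ b ∈ Set.Ioo (0 : ℝ) 1 ∧ c ∈ Set.Ioo (0 : ℝ) 1 ∧
  d ∈ Set.Ioo (0 : ℝ) 1 ∧ e ∈ Set.Ioo (0 : ℝ) 1 ∧ f ∈ Set.Ioo (0 : ℝ) 1 ∧ g ∈ Set.Ioo (0 : ℝ) 1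

lemma Tv_ch {a b c d e f g : ℝ} (h : Rg a b c d e f g) :
    f1 (Tv a b c d e f g) 1 = 1 / a ∧ g1 (Tv a b c d e f g) 1 = 1 / a * b ∧ f2 (Tv a b c d e f g) 1 = 1 / a * b / c ∧
    g2 (Tv a b c d e f g) 1 = 1 / a * b / c * d ∧ f3 (Tv a b c d e f g) 1 = 1 / a * b / c * d / e ∧
    g3 (Tv a b c d e f g) 1 = 1 / a * b / c * d / e * f ∧ f4 (Tv a b c d e f g) 1 = 1 / a * b / c * d / e * f / g := by
  obtain ⟨⟨ha, ha'⟩, ⟨hb, hb'⟩, ⟨hc, hc'⟩, ⟨hd, hd'⟩, ⟨he, he'⟩, ⟨hf, hf'⟩, ⟨hg, hg'⟩⟩ := h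
  have a1 : f1 (Tv a b c d e f g) 1 = 1 / a := add_x ha
  have b1 : g1 (Tv a b c d e f g) 1 = 1 / a * b := by rw [g1, a1]; exact par_y (by positivity) hb'
  have a2 : f2 (Tv a b c d e f g) 1 = 1 / a * b / c := by rw [f2, b1]; exact add_x hc
  have b2 : g2 (Tv a b c d e f g) 1 = 1 / a * b / c * d := by rw [g2, a2]; exact par_y (by positivity) hd'
  have a3 : f3 (Tv a b c d e f g) 1 = 1 / a * b / c * d / e := by rw [f3, b2]; exact add_x he
  have b3 : g3 (Tv a b c d e f g) 1 = 1 / a * b / c * d / e * f := by rw [g3, a3]; exact par_y (by positivity) hf'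
  exact ⟨a1, b1, a2, b2, a3, b3, by rw [f4, b3]; exact add_x hg⟩

lemma Tv_cond {a b c d e f g : ℝ} (h : Rg a b c d e f g) :
    1 < f4 (Tv a b c d e f g) 1 ↔ a * c * e * g < b * d * f := by
  rw [(Tv_ch h).2.2.2.2.2.2]
  obtain ⟨⟨ha, ha'⟩, ⟨hb, hb'⟩, ⟨hc, hc'⟩, ⟨hd, hd'⟩, ⟨he, he'⟩, ⟨hf, hf'⟩, ⟨hg, hg'⟩⟩ := h
  have : 1 / a * b / c * d / e * f / g = b * d * f / (a * c * e * g) := by field_simp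
  rw [this, lt_div_iff₀ (by positivity), one_mul]

lemma S4_Tv {a b c d e f g : ℝ} (h : Rg a b c d e f g) :
    S4 (Tv a b c d e f g) 1 = 1 / (1 - a * c * e * g / (b * d * f)) := by
  rw [S4, (Tv_ch h).2.2.2.2.2.2]
  obtain ⟨⟨ha, ha'⟩, ⟨hb, hb'⟩, ⟨hc, hc'⟩, ⟨hd, hd'⟩, ⟨he, he'⟩, ⟨hf, hf'⟩, ⟨hg, hg'⟩⟩ := h
  have : 1 / a * b / c * d / e * f / g = (a * c * e * g / (b * d * f))⁻¹ := by field_simp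
  rw [this]
  have hq : 0 < a * c * e * g / (b * d * f) := by positivity
  generalize a * c * e * g / (b * d * f) = y at *
  rw [one_mul, ← one_div, show 1 / y - 1 = (1 - y) / y by field_simp]
  by_cases h1 : 1 - y = 0
  · simp [h1]
  · field_simp

lemma Psi_Tv {a b c d e f g : ℝ} (h : Rg a b c d e f g) (h1 : a * c * e * g < b * d * f) :
    Psi8 ((Fin.last 7).insertNth (S4 (Tv a b c d e f g) 1) (Tv a b c d e f g)) =
    (b ^ 3 * d ^ 2 * f / (a ^ 4 * c ^ 3 * e ^ 2 * g)) * (1 - a * c * e * g) ^ 2 /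
      ((1 - b) * (1 - d) * (1 - f) * (1 - a * c * e * g / (b * d * f))) := by
  have hS := S4_Tv h
  obtain ⟨⟨ha, ha'⟩, ⟨hb, hb'⟩, ⟨hc, hc'⟩, ⟨hd, hd'⟩, ⟨he, he'⟩, ⟨hf, hf'⟩, ⟨hg, hg'⟩⟩ := h
  have n1 : 1 - b ≠ 0 := by linarith
  have n2 : 1 - d ≠ 0 := by linarith
  have n3 : 1 - f ≠ 0 := by linarith
  have n4 : b * d * f - a * c * e * g ≠ 0 := by linarith
  have key := PsiW_zig 1 (1 / a * b) (1 / a * b / c * d) (1 / a * b / c * d / e * f) (1 / a) (1 / a * b / c) (1 / a * b / c * d / e)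
    (1 / a * b / c * d / e * f / g)
    (by rw [show 1 / a - 1 / a * b = (1 - b) / a by ring]; positivity)
    (by rw [show 1 / a * b / c - 1 / a * b / c * d = (1 - d) * (1 / a * b / c) by ring]; positivity)
    (by rw [show 1 / a * b / c * d / e - 1 / a * b / c * d / e * f = (1 - f) * (1 / a * b / c * d / e) by ring]; positivity)
    (by rw [show 1 / a * b / c * d / e * f / g - 1 = (b * d * f - a * c * e * g) / (a * c * e * g) by field_simp]; positivity)
  have e0 : Psi8 ((Fin.last 7).insertNth (S4 (Tv a b c d e f g) 1) (Tv a b c d e f g)) =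
    PsiW (1 * (1 - a) / a) (1 / a * b / (1 - b)) (1 / a * b * (1 - c) / c) (1 / a * b / c * d / (1 - d))
      (1 / a * b / c * d * (1 - e) / e) (1 / a * b / c * d / e * f / (1 - f)) (1 / a * b / c * d / e * f * (1 - g) / g) (S4 (Tv a b c d e f g) 1) := rfl
  rw [e0, hS]
  convert key using 1
  · congr 1
    · field_simp
    · field_simp
    · field_simp
    · field_simp
    · field_simp
    · field_simp
    · field_simp
    · field_simp
  · field_simp

lemma Jac_Tv {a b c d e f g : ℝ} (h : Rg a b c d e f g) (h1 : a * c * e * g < b * d * f) :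
    1 / a ^ 2 * ((1 / a) / (1 - b) ^ 2 * ((1 / a * b) / c ^ 2 * ((1 / a * b / c) / (1 - d) ^ 2 * ((1 / a * b / c * d) / e ^ 2 *
    ((1 / a * b / c * d / e) / (1 - f) ^ 2 * ((1 / a * b / c * d / e * f) / g ^ 2 * (Jc (Tv a b c d e f g) 1 *
    ((Psi8 ((Fin.last 7).insertNth (S4 (Tv a b c d e f g) 1) (Tv a b c d e f g))) ^ 2)⁻¹))))))) =
    (1 + a * c * e * g) / (1 - a * c * e * g) ^ 3 / (b * d * f) := by
  rw [Psi_Tv h h1, Jc, dd, S4_Tv h]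
  obtain ⟨p1, p2, p3, p4, p5, p6, p7⟩ := Tv_ch h
  rw [p1, p2, p3, p4, p5, p6, p7]
  obtain ⟨⟨ha, ha'⟩, ⟨hb, hb'⟩, ⟨hc, hc'⟩, ⟨hd, hd'⟩, ⟨he, he'⟩, ⟨hf, hf'⟩, ⟨hg, hg'⟩⟩ := h
  have n1 : 1 - b ≠ 0 := by linarith
  have n2 : 1 - d ≠ 0 := by linarith
  have n3 : 1 - f ≠ 0 := by linarith
  have n4 : b * d * f - a * c * e * g ≠ 0 := by linarith
  have n5 : 1 - a * c * e * g ≠ 0 := by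
    have : b * d * f < 1 := by
      have h2 : b * d < 1 := mul_lt_one_of_nonneg_of_lt_one_left hb.le hb' hd'.le
      exact mul_lt_one_of_nonneg_of_lt_one_left (by positivity) h2 hf'.le
    linarith
  have e1 : 1 - a * c * e * g / (b * d * f) = (b * d * f - a * c * e * g) / (b * d * f) := by field_simp
  have e2 : 1 / a * b / c * d / e * f / (1 / a * b / c * d / e) = f := by field_simp
  have e3 : 1 / a * b / c * d / (1 / a * b / c) = d := by field_simp
  have e4 : 1 / a * b / (1 / a) = b := by field_simp
  have e5 : 1 / (1 / a * b / c * d / e * f / g) = a * c * e * g / (b * d * f) := by field_simp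
  rw [e1, e2, e3, e4, e5]
  field_simp
  ring

lemma iter_law {H : (Fin 8 → ℝ) → ℝ≥0∞} (hm : Measurable fun v : Fin 7 → ℝ => (if 1 < f4 v 1 then
      ENNReal.ofReal (Jc v 1) * (ENNReal.ofReal ((Psi8 ((Fin.last 7).insertNth (S4 v 1) v)) ^ 2)⁻¹ * H ((Fin.last 7).insertNth (S4 v 1) v)) else 0)) :
    ∫⁻ v, (if 1 < f4 v 1 then
      ENNReal.ofReal (Jc v 1) * (ENNReal.ofReal ((Psi8 ((Fin.last 7).insertNth (S4 v 1) v)) ^ 2)⁻¹ * H ((Fin.last 7).insertNth (S4 v 1) v)) else 0) ∂pw 7 Pm =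
    ∫⁻ a, ∫⁻ b, ∫⁻ c, ∫⁻ d, ∫⁻ e, ∫⁻ f, ∫⁻ g, dens a b c d e f g * H (Th ![a, b, c, d, e, f, g]) ∂U ∂U ∂U ∂U ∂U ∂U ∂U := by
  have nt : ∀ x : ℝ, ENNReal.ofReal x ≠ ∞ := fun x => ENNReal.ofReal_ne_top
  rw [iter7 Pm hm, sub1 one_pos]
  refine U_congr fun a ha => ?_
  have ha0 := ha.1
  have p1 : 0 < 1 / a := by positivity
  rw [sub2 p1, ← lintegral_const_mul' _ _ (nt _)]
  refine U_congr fun b hb => ?_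
  have hb0 := hb.1
  have p2 : 0 < 1 / a * b := by positivity
  rw [sub1 p2]
  rw [← lintegral_const_mul' _ _ (nt _), ← lintegral_const_mul' _ _ (nt _)]
  refine U_congr fun c hc => ?_
  have hc0 := hc.1
  have p3 : 0 < 1 / a * b / c := by positivity
  rw [sub2 p3]
  rw [← lintegral_const_mul' _ _ (nt _), ← lintegral_const_mul' _ _ (nt _), ← lintegral_const_mul' _ _ (nt _)]
  refine U_congr fun d hd => ?_
  have hd0 := hd.1
  have p4 : 0 < 1 / a * b / c * d := by positivity
  rw [sub1 p4]
  rw [← lintegral_const_mul' _ _ (nt _), ← lintegral_const_mul' _ _ (nt _), ← lintegral_const_mul' _ _ (nt _), ← lintegral_const_mul' _ _ (nt _)]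
  refine U_congr fun e he => ?_
  have he0 := he.1
  have p5 : 0 < 1 / a * b / c * d / e := by positivity
  rw [sub2 p5]
  rw [← lintegral_const_mul' _ _ (nt _), ← lintegral_const_mul' _ _ (nt _), ← lintegral_const_mul' _ _ (nt _), ← lintegral_const_mul' _ _ (nt _), ← lintegral_const_mul' _ _ (nt _)]
  refine U_congr fun f hf => ?_
  have hf0 := hf.1
  have p6 : 0 < 1 / a * b / c * d / e * f := by positivity
  rw [sub1 p6]
  rw [← lintegral_const_mul' _ _ (nt _), ← lintegral_const_mul' _ _ (nt _), ← lintegral_const_mul' _ _ (nt _), ← lintegral_const_mul' _ _ (nt _), ← lintegral_const_mul' _ _ (nt _), ← lintegral_const_mul' _ _ (nt _)]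
  refine U_congr fun g hg => ?_
  have hR : Rg a b c d e f g := ⟨ha, hb, hc, hd, he, hf, hg⟩
  have hT : (![1 * (1 - a) / a, 1 / a * b / (1 - b), 1 / a * b * (1 - c) / c, 1 / a * b / c * d / (1 - d),
    1 / a * b / c * d * (1 - e) / e, 1 / a * b / c * d / e * f / (1 - f), 1 / a * b / c * d / e * f * (1 - g) / g] : Fin 7 → ℝ) = Tv a b c d e f g := rfl
  have hTh : Th ![a, b, c, d, e, f, g] = (Fin.last 7).insertNth (S4 (Tv a b c d e f g) 1) (Tv a b c d e f g) := rfl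
  rw [hT, hTh, dens]
  by_cases h1 : a * c * e * g < b * d * f
  · rw [if_pos h1, if_pos ((Tv_cond hR).2 h1), ← Jac_Tv hR h1]
    have hd1 : 0 < 1 - b := by linarith [hb.2]
    have hd2 : 0 < 1 - d := by linarith [hd.2]
    have hd3 : 0 < 1 - f := by linarith [hf.2]
    have hJ : 0 ≤ Jc (Tv a b c d e f g) 1 := by
      have hv : ∀ i, 0 < Tv a b c d e f g i := by
        have k1 : 0 < 1 - a := by linarith [ha.2]
        have k2 : 0 < 1 - c := by linarith [hc.2]
        have k3 : 0 < 1 - e := by linarith [he.2]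
        have k4 : 0 < 1 - g := by linarith [hg.2]
        have k5 := hg.1
        intro i
        fin_cases i <;> simp [Tv] <;> positivity
      exact mul_nonneg (sq_nonneg _) (dd_lt hv one_pos ((Tv_cond hR).2 h1)).le
    rw [ENNReal.ofReal_mul (by positivity), ENNReal.ofReal_mul (by positivity), ENNReal.ofReal_mul (by positivity), ENNReal.ofReal_mul (by positivity),
      ENNReal.ofReal_mul (by positivity), ENNReal.ofReal_mul (by positivity), ENNReal.ofReal_mul (by positivity), ENNReal.ofReal_mul hJ]
    ring
  · rw [if_neg h1, if_neg (fun h => h1 ((Tv_cond hR).1 h))]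
    simp
end FW

namespace FW
open Filter Topology ENNReal

lemma XC {p g K : ℝ → ℝ≥0∞} (hp : Measurable p) (hg : Measurable g) (hK : Measurable K) :
    ∫⁻ x, p x * ∫⁻ z, g z * K (x * z) ∂U ∂U = ∫⁻ q, K q * conv p g q ∂U := by
  simp only [conv]
  have e1 : ∀ x, K x * ∫⁻ t, kr false x t * (p t * g (x / t)) ∂U =
      ∫⁻ t, K x * (kr false x t * (p t * g (x / t))) ∂U := fun x =>
    (lintegral_const_mul _ ((conv_measP hp hg).comp measurable_prodMk_left)).symm
  simp only [e1]
  rw [lintegral_lintegral_swap (((hK.comp measurable_fst).mul (conv_measP hp hg)).aemeasurable)]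
  refine U_congr fun t ht => ?_
  have e2 : ∀ x, K x * (kr false x t * (p t * g (x / t))) = p t * (kr false x t * (K x * g (x / t))) := fun x => by ring
  simp only [e2]
  have m1 : Measurable fun x => K x * g (x / t) := hK.mul (hg.comp (measurable_id.div_const t))
  have m2 : Measurable fun x => kr false x t * (K x * g (x / t)) := (kr_meas2 false t).mul m1
  rw [lintegral_const_mul _ m2, lint_kr0 ht m1]
  congr 1
  refine lintegral_congr fun s => ?_
  rw [mul_div_cancel_left₀ _ ht.1.ne', mul_comm]

lemma XC4 {p : Fin 4 → ℝ → ℝ≥0∞} (hp : ∀ i, Measurable (p i)) {K : ℝ → ℝ≥0∞} (hK : Measurable K) :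
    ∫⁻ a, p 0 a * ∫⁻ c, p 1 c * ∫⁻ e, p 2 e * ∫⁻ g, p 3 g * K (a * c * e * g) ∂U ∂U ∂U ∂U = ∫⁻ q, K q * conv4 p q ∂U := by
  have m1 := conv_meas (hp 2) (hp 3)
  have m2 := conv_meas (hp 1) m1
  rw [conv4, ← XC (hp 0) m2 hK]
  refine lintegral_congr fun a => ?_
  congr 1
  have s1 := XC (hp 1) m1 (K := fun q => K (a * q)) (hK.comp (measurable_const_mul a))
  have s1' : ∫⁻ z, conv (p 1) (conv (p 2) (p 3)) z * K (a * z) ∂U = ∫⁻ q, K (a * q) * conv (p 1) (conv (p 2) (p 3)) q ∂U :=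
    lintegral_congr fun z => mul_comm _ _
  rw [s1', ← s1]
  refine lintegral_congr fun c => ?_
  congr 1
  have s2 := XC (hp 2) (hp 3) (K := fun q => K (a * (c * q))) (hK.comp ((measurable_const_mul c).const_mul a))
  have s2' : ∫⁻ z, conv (p 2) (p 3) z * K (a * (c * z)) ∂U = ∫⁻ q, K (a * (c * q)) * conv (p 2) (p 3) q ∂U :=
    lintegral_congr fun z => mul_comm _ _
  rw [s2', ← s2]
  simp only [mul_assoc]

lemma Y4 {r : Fin 4 → ℝ → ℝ≥0∞} (hr : ∀ i, Measurable (r i)) {q : ℝ} (hq : q ∈ Set.Ioo (0 : ℝ) 1) :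
    conv4 r q = ∫⁻ b, ∫⁻ d, ∫⁻ f, (if q < b * d * f then ENNReal.ofReal (b * d * f)⁻¹ else 0) *
      (r 0 b * r 1 d * r 2 f * r 3 (q / (b * d * f))) ∂U ∂U ∂U := by
  rw [conv4, conv]
  refine U_congr fun b hb => ?_
  have m1 : Measurable fun t => kr false (q / b) t * (r 1 t * conv (r 2) (r 3) (q / b / t)) :=
    (conv_measP (hr 1) (conv_meas (hr 2) (hr 3))).comp measurable_prodMk_left
  rw [conv, ← mul_assoc, ← lintegral_const_mul _ m1]
  refine U_congr fun d hd => ?_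
  have m2 : Measurable fun t => kr false (q / b / d) t * (r 2 t * r 3 (q / b / d / t)) :=
    (conv_measP (hr 2) (hr 3)).comp measurable_prodMk_left
  rw [conv, ← mul_assoc, ← mul_assoc, ← lintegral_const_mul _ m2]
  refine U_congr fun f hf => ?_
  have hb0 := hb.1
  have hd0 := hd.1
  have hf0 := hf.1
  have c3 : q / b / d < f ↔ q < b * d * f := by
    rw [div_div, div_lt_iff₀ (by positivity)]
    constructor <;> intro h <;> linarith
  have eq : q / b / d / f = q / (b * d * f) := by field_simp
  simp only [kr]
  rw [eq]
  by_cases h : q < b * d * f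
  · have h2 : q < b * d := h.trans (mul_lt_of_lt_one_right (by positivity) hf.2)
    have h1 : q < b := h2.trans (mul_lt_of_lt_one_right hb0 hd.2)
    rw [if_pos h1, if_pos (by rw [div_lt_iff₀ hb0]; linarith), if_pos (c3.2 h), if_pos h,
      show (b * d * f)⁻¹ = b⁻¹ * d⁻¹ * f⁻¹ by field_simp, ENNReal.ofReal_mul (by positivity), ENNReal.ofReal_mul (by positivity)]
    ring
  · rw [if_neg (fun h' => h (c3.1 h')), if_neg h]
    simp

/-- monomials, extended nonnegative form -/
def MoE (p r : Fin 4 → ℝ → ℝ≥0∞) (j : ℕ) (a b c d e f g : ℝ) : ℝ≥0∞ :=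
  We [true] (a * c * e * g) ^ j * (p 0 a * p 1 c * p 2 e * p 3 g) * (r 0 b * r 1 d * r 2 f * r 3 (a * c * e * g / (b * d * f)))

lemma dens_meas : Measurable fun ξ : Fin 7 → ℝ => dens (ξ 0) (ξ 1) (ξ 2) (ξ 3) (ξ 4) (ξ 5) (ξ 6) := by
  unfold dens
  refine Measurable.ite (measurableSet_lt (by fun_prop) (by fun_prop)) (by fun_prop) measurable_const

lemma MoE_meas {p r : Fin 4 → ℝ → ℝ≥0∞} (hp : ∀ i, Measurable (p i)) (hr : ∀ i, Measurable (r i)) (j : ℕ) :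
    Measurable fun ξ : Fin 7 → ℝ => MoE p r j (ξ 0) (ξ 1) (ξ 2) (ξ 3) (ξ 4) (ξ 5) (ξ 6) := by
  unfold MoE
  have := We_meas [true]
  have := hp 0
  have := hp 1
  have := hp 2
  have := hp 3
  have := hr 0
  have := hr 1
  have := hr 2
  have := hr 3
  fun_prop

def prm : Equiv.Perm (Fin 7) := ⟨![0, 4, 1, 5, 2, 6, 3], ![0, 2, 4, 6, 1, 3, 5], by decide, by decide⟩

lemma mono_ZE {p r : Fin 4 → ℝ → ℝ≥0∞} (hp : ∀ i, HE [] (p i)) (hr : ∀ i, HE [] (r i)) (j : ℕ) :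
    ZE (∫⁻ ξ, dens (ξ 0) (ξ 1) (ξ 2) (ξ 3) (ξ 4) (ξ 5) (ξ 6) * MoE p r j (ξ 0) (ξ 1) (ξ 2) (ξ 3) (ξ 4) (ξ 5) (ξ 6) ∂pw 7 U) := by
  have mp := fun i => (hp i).1
  have mr := fun i => (hr i).1
  have h1 := pi_perm U prm (fun ξ : Fin 7 → ℝ => dens (ξ 0) (ξ 1) (ξ 2) (ξ 3) (ξ 4) (ξ 5) (ξ 6) * MoE p r j (ξ 0) (ξ 1) (ξ 2) (ξ 3) (ξ 4) (ξ 5) (ξ 6))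
  have hm : Measurable fun ξ : Fin 7 → ℝ => dens (ξ 0) (ξ 1) (ξ 2) (ξ 3) (ξ 4) (ξ 5) (ξ 6) * MoE p r j (ξ 0) (ξ 1) (ξ 2) (ξ 3) (ξ 4) (ξ 5) (ξ 6) :=
    dens_meas.mul (MoE_meas mp mr j)
  have hm' := hm.comp (measurable_pi_lambda (fun (ξ : Fin 7 → ℝ) => ξ ∘ prm) fun i => measurable_pi_apply (prm i))
  have h5 := iter7 U hm'
  simp only [Function.comp_def] at h1 h5
  rw [← h1, h5]
  have h2 := final_ZE j hp hr
  have mc := conv_meas (mr 0) (conv_meas (mr 1) (conv_meas (mr 2) (mr 3)))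
  have mW := We_meas [true]
  have h3 := XC4 mp (K := fun q => ENNReal.ofReal ((1 + q) / (1 - q) ^ 3) * We [true] q ^ j * conv4 r q)
    (by unfold conv4; fun_prop)
  have h4 : ∫⁻ q, ENNReal.ofReal ((1 + q) / (1 - q) ^ 3) * We [true] q ^ j * (conv4 p q * conv4 r q) ∂U =
    ∫⁻ q, ENNReal.ofReal ((1 + q) / (1 - q) ^ 3) * We [true] q ^ j * conv4 r q * conv4 p q ∂U := lintegral_congr fun q => by ring
  rw [h4, ← h3] at h2
  convert h2 using 1
  have fin : ∀ i, ∀ x ∈ Set.Ioo (0 : ℝ) 1, p i x ≠ ∞ := fun i => (hp i).2.1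
  refine U_congr fun a ha => ?_
  rw [← lintegral_const_mul' _ _ (fin 0 a ha)]
  refine U_congr fun c hc => ?_
  rw [← lintegral_const_mul' _ _ (fin 1 c hc), ← lintegral_const_mul' _ _ (fin 0 a ha)]
  refine U_congr fun e he => ?_
  rw [← lintegral_const_mul' _ _ (fin 2 e he), ← lintegral_const_mul' _ _ (fin 1 c hc), ← lintegral_const_mul' _ _ (fin 0 a ha)]
  refine U_congr fun g hg => ?_
  have ha0 := ha.1
  have hc0 := hc.1
  have he0 := he.1
  have hg0 := hg.1
  have hq : a * c * e * g ∈ Set.Ioo (0 : ℝ) 1 := by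
    refine ⟨by positivity, ?_⟩
    have q1 : a * c < 1 := mul_lt_one_of_nonneg_of_lt_one_left ha0.le ha.2 hc.2.le
    have q2 : a * c * e < 1 := mul_lt_one_of_nonneg_of_lt_one_left (by positivity) q1 he.2.le
    exact mul_lt_one_of_nonneg_of_lt_one_left (by positivity) q2 hg.2.le
  rw [Y4 mr hq]
  have hC : p 0 a * (p 1 c * (p 2 e * (p 3 g * (ENNReal.ofReal ((1 + a * c * e * g) / (1 - a * c * e * g) ^ 3) * We [true] (a * c * e * g) ^ j)))) ≠ ∞ := by
    refine ENNReal.mul_ne_top (fin 0 a ha) (ENNReal.mul_ne_top (fin 1 c hc) (ENNReal.mul_ne_top (fin 2 e he) (ENNReal.mul_ne_top (fin 3 g hg)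
      (ENNReal.mul_ne_top ENNReal.ofReal_ne_top (ENNReal.pow_ne_top (We_ne_top _ hq))))))
  rw [show ∀ X, p 0 a * (p 1 c * (p 2 e * (p 3 g * (ENNReal.ofReal ((1 + a * c * e * g) / (1 - a * c * e * g) ^ 3) * We [true] (a * c * e * g) ^ j * X)))) =
    p 0 a * (p 1 c * (p 2 e * (p 3 g * (ENNReal.ofReal ((1 + a * c * e * g) / (1 - a * c * e * g) ^ 3) * We [true] (a * c * e * g) ^ j)))) * X from fun X => by ring]
  generalize hCd : p 0 a * (p 1 c * (p 2 e * (p 3 g * (ENNReal.ofReal ((1 + a * c * e * g) / (1 - a * c * e * g) ^ 3) * We [true] (a * c * e * g) ^ j)))) = C at hC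
  rw [← lintegral_const_mul' _ _ hC]
  refine U_congr fun b hb => ?_
  rw [← lintegral_const_mul' _ _ hC]
  refine U_congr fun d hd => ?_
  rw [← lintegral_const_mul' _ _ hC]
  refine U_congr fun f hf => ?_
  rw [← hCd]
  have hb0 := hb.1
  have hd0 := hd.1
  have hf0 := hf.1
  show dens a b c d e f g * MoE p r j a b c d e f g = _
  rw [dens, MoE]
  by_cases h : a * c * e * g < b * d * f
  · have hq1 : 0 < 1 - a * c * e * g := by linarith [hq.2]
    rw [if_pos h, if_pos h, div_eq_mul_inv _ (b * d * f), ENNReal.ofReal_mul (by positivity)]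
    ring
  · rw [if_neg h, if_neg h]
    simp
end FW

namespace FW
open Filter Topology ENNReal

def Dn (ξ : Fin 7 → ℝ) : ℝ≥0∞ := dens (ξ 0) (ξ 1) (ξ 2) (ξ 3) (ξ 4) (ξ 5) (ξ 6)
lemma Dn_meas : Measurable Dn := dens_meas
def rho : Measure (Fin 7 → ℝ) := (pw 7 U).withDensity Dn
def qf (ξ : Fin 7 → ℝ) : ℝ := ξ 0 * ξ 2 * ξ 4 * ξ 6
def xs (ξ : Fin 7 → ℝ) : Fin 4 → ℝ := ![ξ 0, ξ 2, ξ 4, ξ 6]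
def ys (ξ : Fin 7 → ℝ) : Fin 4 → ℝ := ![ξ 1, ξ 3, ξ 5, qf ξ / (ξ 1 * ξ 3 * ξ 5)]

def RR (ξ : Fin 7 → ℝ) : Prop := (∀ i, ξ i ∈ Set.Ioo (0 : ℝ) 1) ∧ qf ξ < ξ 1 * ξ 3 * ξ 5

lemma RR.xs {ξ : Fin 7 → ℝ} (h : RR ξ) (i : Fin 4) : xs ξ i ∈ Set.Ioo (0 : ℝ) 1 := by
  fin_cases i
  · exact h.1 0
  · exact h.1 2
  · exact h.1 4
  · exact h.1 6

lemma RR.bdf {ξ : Fin 7 → ℝ} (h : RR ξ) : 0 < ξ 1 * ξ 3 * ξ 5 ∧ ξ 1 * ξ 3 * ξ 5 < 1 := by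
  obtain ⟨h1, h1'⟩ := h.1 1
  obtain ⟨h2, h2'⟩ := h.1 3
  obtain ⟨h3, h3'⟩ := h.1 5
  refine ⟨by positivity, ?_⟩
  have q1 : ξ 1 * ξ 3 < 1 := mul_lt_one_of_nonneg_of_lt_one_left h1.le h1' h2'.le
  exact mul_lt_one_of_nonneg_of_lt_one_left (by positivity) q1 h3'.le

lemma RR.q {ξ : Fin 7 → ℝ} (h : RR ξ) : qf ξ ∈ Set.Ioo (0 : ℝ) 1 := by
  have h1 := (h.1 0).1
  have h2 := (h.1 2).1
  have h3 := (h.1 4).1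
  have h4 := (h.1 6).1
  exact ⟨by unfold qf; positivity, h.2.trans h.bdf.2⟩

lemma RR.ys {ξ : Fin 7 → ℝ} (h : RR ξ) (i : Fin 4) : ys ξ i ∈ Set.Ioo (0 : ℝ) 1 := by
  fin_cases i
  · exact h.1 1
  · exact h.1 3
  · exact h.1 5
  · have := h.bdf.1
    exact ⟨div_pos h.q.1 this, (div_lt_one this).2 h.2⟩

lemma RR.Rg {ξ : Fin 7 → ℝ} (h : RR ξ) : Rg (ξ 0) (ξ 1) (ξ 2) (ξ 3) (ξ 4) (ξ 5) (ξ 6) :=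
  ⟨h.1 0, h.1 1, h.1 2, h.1 3, h.1 4, h.1 5, h.1 6⟩

lemma ae_cube : ∀ᵐ ξ ∂pw 7 U, ∀ i, ξ i ∈ Set.Ioo (0 : ℝ) 1 := ae_pw ae_U 7

lemma ae_rho : ∀ᵐ ξ ∂rho, RR ξ := by
  rw [rho, ae_withDensity_iff Dn_meas]
  filter_upwards [ae_cube] with ξ h h1
  refine ⟨h, ?_⟩
  by_contra h2
  exact h1 (if_neg h2)

/-- real monomials -/
def Mon (m n m' n' : Fin 4 → ℕ) (j : ℕ) (ξ : Fin 7 → ℝ) : ℝ :=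
  (-Real.log (1 - qf ξ)) ^ j * (∏ i, (-Real.log (xs ξ i)) ^ m i * (-Real.log (1 - xs ξ i)) ^ n i) *
    ∏ i, (-Real.log (ys ξ i)) ^ m' i * (-Real.log (1 - ys ξ i)) ^ n' i

lemma xs_meas (i : Fin 4) : Measurable fun ξ => xs ξ i := by
  fin_cases i <;> exact measurable_pi_apply _
lemma ys_meas (i : Fin 4) : Measurable fun ξ => ys ξ i := by
  fin_cases i
  · exact measurable_pi_apply _
  · exact measurable_pi_apply _
  · exact measurable_pi_apply _
  · show Measurable fun ξ => qf ξ / (ξ 1 * ξ 3 * ξ 5)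
    unfold qf
    fun_prop

lemma Mon_meas (m n m' n' : Fin 4 → ℕ) (j : ℕ) : Measurable (Mon m n m' n' j) := by
  unfold Mon
  have h1 := xs_meas
  have h2 := ys_meas
  have h3 : Measurable qf := by unfold qf; fun_prop
  fun_prop

def wl (m n : ℕ) : ℝ → ℝ≥0∞ := fun x => We [false] x ^ m * We [true] x ^ n

lemma nl0 {x : ℝ} (hx : x ∈ Set.Ioo (0 : ℝ) 1) : 0 ≤ -Real.log x := neg_nonneg.2 (Real.log_nonpos hx.1.le hx.2.le)
lemma nl1 {x : ℝ} (hx : x ∈ Set.Ioo (0 : ℝ) 1) : 0 ≤ -Real.log (1 - x) :=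
  neg_nonneg.2 (Real.log_nonpos (by linarith [hx.2]) (by linarith [hx.1]))

lemma wl_eq (m n : ℕ) {x : ℝ} (hx : x ∈ Set.Ioo (0 : ℝ) 1) :
    wl m n x = ENNReal.ofReal ((-Real.log x) ^ m * (-Real.log (1 - x)) ^ n) := by
  rw [wl, We_log0 hx, We_log1 hx, ENNReal.ofReal_mul (pow_nonneg (nl0 hx) _), ENNReal.ofReal_pow (nl0 hx), ENNReal.ofReal_pow (nl1 hx)]

lemma wl_HE (m n : ℕ) : HE [] (wl m n) := by
  refine ⟨((We_meas _).pow_const _).mul ((We_meas _).pow_const _), fun x hx => ?_, ?_⟩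
  · rw [wl_eq m n hx]; exact ENNReal.ofReal_ne_top
  · refine HZ_congr (HZ_mul (HZ_pow HZ_log0 m) (HZ_pow HZ_log1 n)) fun x hx => ?_
    rw [wl_eq m n hx, ENNReal.toReal_ofReal (mul_nonneg (pow_nonneg (nl0 hx) _) (pow_nonneg (nl1 hx) _))]
    rfl

lemma Mon_nonneg (m n m' n' : Fin 4 → ℕ) (j : ℕ) {ξ : Fin 7 → ℝ} (h : RR ξ) : 0 ≤ Mon m n m' n' j ξ :=
  mul_nonneg (mul_nonneg (pow_nonneg (nl1 h.q) _)
    (prod_nonneg fun i _ => mul_nonneg (pow_nonneg (nl0 (h.xs i)) _) (pow_nonneg (nl1 (h.xs i)) _)))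
    (prod_nonneg fun i _ => mul_nonneg (pow_nonneg (nl0 (h.ys i)) _) (pow_nonneg (nl1 (h.ys i)) _))

lemma Mon_E (m n m' n' : Fin 4 → ℕ) (j : ℕ) {ξ : Fin 7 → ℝ} (h : RR ξ) : ENNReal.ofReal (Mon m n m' n' j ξ) =
    MoE (fun i => wl (m i) (n i)) (fun i => wl (m' i) (n' i)) j (ξ 0) (ξ 1) (ξ 2) (ξ 3) (ξ 4) (ξ 5) (ξ 6) := by
  have hx : ∀ i, 0 ≤ (-Real.log (xs ξ i)) ^ m i * (-Real.log (1 - xs ξ i)) ^ n i := fun i =>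
    mul_nonneg (pow_nonneg (nl0 (h.xs i)) _) (pow_nonneg (nl1 (h.xs i)) _)
  have hy : ∀ i, 0 ≤ (-Real.log (ys ξ i)) ^ m' i * (-Real.log (1 - ys ξ i)) ^ n' i := fun i =>
    mul_nonneg (pow_nonneg (nl0 (h.ys i)) _) (pow_nonneg (nl1 (h.ys i)) _)
  rw [Mon, ENNReal.ofReal_mul (mul_nonneg (pow_nonneg (nl1 h.q) _) (prod_nonneg fun i _ => hx i)),
    ENNReal.ofReal_mul (pow_nonneg (nl1 h.q) _), ENNReal.ofReal_prod_of_nonneg (fun i _ => hx i),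
    ENNReal.ofReal_prod_of_nonneg (fun i _ => hy i), ENNReal.ofReal_pow (nl1 h.q), ← We_log1 h.q]
  simp only [← wl_eq _ _ (h.xs _), ← wl_eq _ _ (h.ys _), Fin.prod_univ_four]
  rfl

lemma Mon_ZE (m n m' n' : Fin 4 → ℕ) (j : ℕ) : Integrable (Mon m n m' n' j) rho ∧ ∫ ξ, Mon m n m' n' j ξ ∂rho ∈ Z := by
  have h := mono_ZE (fun i => wl_HE (m i) (n i)) (fun i => wl_HE (m' i) (n' i)) j
  have hm := MoE_meas (fun i => (wl_HE (m i) (n i)).1) (fun i => (wl_HE (m' i) (n' i)).1) j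
  have e : ∫⁻ ξ, ENNReal.ofReal (Mon m n m' n' j ξ) ∂rho =
      ∫⁻ ξ, dens (ξ 0) (ξ 1) (ξ 2) (ξ 3) (ξ 4) (ξ 5) (ξ 6) * MoE (fun i => wl (m i) (n i)) (fun i => wl (m' i) (n' i)) j (ξ 0) (ξ 1) (ξ 2) (ξ 3) (ξ 4) (ξ 5) (ξ 6) ∂pw 7 U := by
    rw [lintegral_congr_ae (ae_rho.mono fun ξ h => Mon_E m n m' n' j h), rho, lintegral_withDensity_eq_lintegral_mul _ Dn_meas hm]
    rfl
  rw [← e] at h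
  have h0 : 0 ≤ᵐ[rho] Mon m n m' n' j := ae_rho.mono fun ξ h => Mon_nonneg _ _ _ _ _ h
  have hms : AEStronglyMeasurable (Mon m n m' n' j) rho := (Mon_meas m n m' n' j).aestronglyMeasurable
  refine ⟨(lintegral_ofReal_ne_top_iff_integrable hms h0).1 h.1, ?_⟩
  rw [integral_eq_lintegral_of_nonneg_ae h0 hms]
  exact h.2

/-- the algebra of good functions -/
def GA : Subalgebra ℚ ((Fin 7 → ℝ) → ℝ) := Algebra.adjoin ℚ {f | ∃ m n m' n' j, f = Mon m n m' n' j}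

lemma GA_int {f : (Fin 7 → ℝ) → ℝ} (hf : f ∈ GA) : Integrable f rho ∧ ∫ ξ, f ξ ∂rho ∈ Z := by
  have hc : ∀ f ∈ Submonoid.closure {f | ∃ m n m' n' j, f = Mon m n m' n' j}, ∃ m n m' n' j, f = Mon m n m' n' j := by
    intro f hf
    induction hf using Submonoid.closure_induction with
    | mem f hf => exact hf
    | one => exact ⟨0, 0, 0, 0, 0, by ext ξ; simp [Mon]⟩
    | mul f g _ _ hf hg =>
      obtain ⟨m, n, m', n', j, rfl⟩ := hf
      obtain ⟨a, b, a', b', k, rfl⟩ := hg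
      refine ⟨m + a, n + b, m' + a', n' + b', j + k, ?_⟩
      ext ξ
      simp only [Mon, Pi.mul_apply, Pi.add_apply, pow_add, Finset.prod_mul_distrib]
      ring
  have hf' : f ∈ Submodule.span ℚ (Submonoid.closure {f | ∃ m n m' n' j, f = Mon m n m' n' j} : Set ((Fin 7 → ℝ) → ℝ)) := by
    rw [← Algebra.adjoin_eq_span]; exact hf
  clear hf
  induction hf' using Submodule.span_induction with
  | mem f hf =>
    obtain ⟨m, n, m', n', j, rfl⟩ := hc f hf
    exact Mon_ZE m n m' n' j
  | zero => exact ⟨integrable_zero _ _ _, by simp⟩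
  | add f g hf hg h1 h2 =>
    refine ⟨h1.1.add h2.1, ?_⟩
    have : ∫ ξ, (f + g) ξ ∂rho = ∫ ξ, f ξ ∂rho + ∫ ξ, g ξ ∂rho := integral_add h1.1 h2.1
    rw [this]
    exact add_mem h1.2 h2.2
  | smul c f hf h1 =>
    have e : c • f = fun ξ => (c : ℝ) * f ξ := by ext ξ; simp [Rat.smul_def]
    rw [e]
    refine ⟨h1.1.const_mul _, ?_⟩
    rw [integral_const_mul]
    exact mul_mem (Z.algebraMap_mem c) h1.2

lemma GA_x0 (i : Fin 4) : (fun ξ => Real.log (xs ξ i)) ∈ GA := by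
  have h : Mon (Pi.single i 1) 0 0 0 0 ∈ GA := Algebra.subset_adjoin ⟨_, _, _, _, _, rfl⟩
  convert neg_mem h using 1
  ext ξ
  simp [Mon, Pi.single_apply, Finset.prod_ite_eq', apply_ite]

lemma GA_x1 (i : Fin 4) : (fun ξ => Real.log (1 - xs ξ i)) ∈ GA := by
  have h : Mon 0 (Pi.single i 1) 0 0 0 ∈ GA := Algebra.subset_adjoin ⟨_, _, _, _, _, rfl⟩
  convert neg_mem h using 1
  ext ξ
  simp [Mon, Pi.single_apply, Finset.prod_ite_eq', apply_ite]

lemma GA_y0 (i : Fin 4) : (fun ξ => Real.log (ys ξ i)) ∈ GA := by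
  have h : Mon 0 0 (Pi.single i 1) 0 0 ∈ GA := Algebra.subset_adjoin ⟨_, _, _, _, _, rfl⟩
  convert neg_mem h using 1
  ext ξ
  simp [Mon, Pi.single_apply, Finset.prod_ite_eq', apply_ite]

lemma GA_y1 (i : Fin 4) : (fun ξ => Real.log (1 - ys ξ i)) ∈ GA := by
  have h : Mon 0 0 0 (Pi.single i 1) 0 ∈ GA := Algebra.subset_adjoin ⟨_, _, _, _, _, rfl⟩
  convert neg_mem h using 1
  ext ξ
  simp [Mon, Pi.single_apply, Finset.prod_ite_eq', apply_ite]

lemma GA_q : (fun ξ => Real.log (1 - qf ξ)) ∈ GA := by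
  have h : Mon 0 0 0 0 1 ∈ GA := Algebra.subset_adjoin ⟨_, _, _, _, _, rfl⟩
  convert neg_mem h using 1
  ext ξ
  simp [Mon]

/-- logarithms of the parametrization -/
def lu (ξ : Fin 7 → ℝ) : Fin 4 → ℝ :=
  ![0, Real.log (ys ξ 0) - Real.log (xs ξ 0), Real.log (ys ξ 0) - Real.log (xs ξ 0) + (Real.log (ys ξ 1) - Real.log (xs ξ 1)),
    Real.log (ys ξ 0) - Real.log (xs ξ 0) + (Real.log (ys ξ 1) - Real.log (xs ξ 1)) + (Real.log (ys ξ 2) - Real.log (xs ξ 2))]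

def Lc (ξ : Fin 7 → ℝ) : Fin 8 → ℝ :=
  ![lu ξ 0 + Real.log (1 - xs ξ 0) - Real.log (xs ξ 0), lu ξ 1 - Real.log (1 - ys ξ 0),
    lu ξ 1 + Real.log (1 - xs ξ 1) - Real.log (xs ξ 1), lu ξ 2 - Real.log (1 - ys ξ 1),
    lu ξ 2 + Real.log (1 - xs ξ 2) - Real.log (xs ξ 2), lu ξ 3 - Real.log (1 - ys ξ 2),
    lu ξ 3 + Real.log (1 - xs ξ 3) - Real.log (xs ξ 3), lu ξ 0 - Real.log (1 - ys ξ 3)]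

def LP (ξ : Fin 7 → ℝ) : ℝ :=
  (3 : ℚ) • Real.log (ys ξ 0) + (2 : ℚ) • Real.log (ys ξ 1) + Real.log (ys ξ 2) - (4 : ℚ) • Real.log (xs ξ 0) - (3 : ℚ) • Real.log (xs ξ 1)
    - (2 : ℚ) • Real.log (xs ξ 2) - Real.log (xs ξ 3) + (2 : ℚ) • Real.log (1 - qf ξ) -
    (Real.log (1 - ys ξ 0) + Real.log (1 - ys ξ 1) + Real.log (1 - ys ξ 2) + Real.log (1 - ys ξ 3))

lemma GA_lu (i : Fin 4) : (fun ξ => lu ξ i) ∈ GA := by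
  have h : ∀ i, (fun ξ => Real.log (ys ξ i) - Real.log (xs ξ i)) ∈ GA := fun i => sub_mem (GA_y0 i) (GA_x0 i)
  fin_cases i
  · exact zero_mem GA
  · exact h 0
  · exact add_mem (h 0) (h 1)
  · exact add_mem (add_mem (h 0) (h 1)) (h 2)

lemma GA_Lc (i : Fin 8) : (fun ξ => Lc ξ i) ∈ GA := by
  have h1 : ∀ i, (fun ξ => lu ξ i + Real.log (1 - xs ξ i) - Real.log (xs ξ i)) ∈ GA := fun i => sub_mem (add_mem (GA_lu i) (GA_x1 i)) (GA_x0 i)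
  have h2 : ∀ i j, (fun ξ => lu ξ i - Real.log (1 - ys ξ j)) ∈ GA := fun i j => sub_mem (GA_lu i) (GA_y1 j)
  fin_cases i
  · exact h1 0
  · exact h2 1 0
  · exact h1 1
  · exact h2 2 1
  · exact h1 2
  · exact h2 3 2
  · exact h1 3
  · exact h2 0 3

lemma GA_LP : LP ∈ GA :=
  sub_mem (add_mem (sub_mem (sub_mem (sub_mem (sub_mem (add_mem (add_mem (GA.smul_mem (GA_y0 0) 3) (GA.smul_mem (GA_y0 1) 2)) (GA_y0 2))
    (GA.smul_mem (GA_x0 0) 4)) (GA.smul_mem (GA_x0 1) 3)) (GA.smul_mem (GA_x0 2) 2)) (GA_x0 3)) (GA.smul_mem GA_q 2))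
    (add_mem (add_mem (add_mem (GA_y1 0) (GA_y1 1)) (GA_y1 2)) (GA_y1 3))

lemma Th_log {ξ : Fin 7 → ℝ} (h : RR ξ) (i : Fin 8) : 0 < Th ξ i ∧ Real.log (Th ξ i) = Lc ξ i := by
  have e7 : Th ξ 7 = 1 / (1 - ys ξ 3) := S4_Tv h.Rg
  have x0 := (h.xs 0).1
  have x1 := (h.xs 1).1
  have x2 := (h.xs 2).1
  have x3 := (h.xs 3).1
  have y0 := (h.ys 0).1
  have y1 := (h.ys 1).1
  have y2 := (h.ys 2).1
  have x0' : 0 < 1 - xs ξ 0 := by linarith [(h.xs 0).2]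
  have x1' : 0 < 1 - xs ξ 1 := by linarith [(h.xs 1).2]
  have x2' : 0 < 1 - xs ξ 2 := by linarith [(h.xs 2).2]
  have x3' : 0 < 1 - xs ξ 3 := by linarith [(h.xs 3).2]
  have y0' : 0 < 1 - ys ξ 0 := by linarith [(h.ys 0).2]
  have y1' : 0 < 1 - ys ξ 1 := by linarith [(h.ys 1).2]
  have y2' : 0 < 1 - ys ξ 2 := by linarith [(h.ys 2).2]
  have y3' : 0 < 1 - ys ξ 3 := by linarith [(h.ys 3).2]
  have key : ∀ t > (0 : ℝ), ∀ r : ℝ, (∃ s, Real.log t = s ∧ s = r) → 0 < t ∧ Real.log t = r := fun t ht r ⟨s, a, b⟩ => ⟨ht, a.trans b⟩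
  have g0 : Th ξ 0 = 1 * (1 - xs ξ 0) / xs ξ 0 := rfl
  have g1 : Th ξ 1 = 1 / xs ξ 0 * ys ξ 0 / (1 - ys ξ 0) := rfl
  have g2 : Th ξ 2 = 1 / xs ξ 0 * ys ξ 0 * (1 - xs ξ 1) / xs ξ 1 := rfl
  have g3 : Th ξ 3 = 1 / xs ξ 0 * ys ξ 0 / xs ξ 1 * ys ξ 1 / (1 - ys ξ 1) := rfl
  have g4 : Th ξ 4 = 1 / xs ξ 0 * ys ξ 0 / xs ξ 1 * ys ξ 1 * (1 - xs ξ 2) / xs ξ 2 := rfl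
  have g5 : Th ξ 5 = 1 / xs ξ 0 * ys ξ 0 / xs ξ 1 * ys ξ 1 / xs ξ 2 * ys ξ 2 / (1 - ys ξ 2) := rfl
  have g6 : Th ξ 6 = 1 / xs ξ 0 * ys ξ 0 / xs ξ 1 * ys ξ 1 / xs ξ 2 * ys ξ 2 * (1 - xs ξ 3) / xs ξ 3 := rfl
  have l1 : ∀ {a b : ℝ}, 0 < a → 0 < b → Real.log (a * b) = Real.log a + Real.log b := fun ha hb => Real.log_mul ha.ne' hb.ne'
  have l2 : ∀ {a b : ℝ}, 0 < a → 0 < b → Real.log (a / b) = Real.log a - Real.log b := fun ha hb => Real.log_div ha.ne' hb.ne'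
  have i0 : 0 < 1 / xs ξ 0 := by positivity
  have i1 : 0 < 1 / xs ξ 0 * ys ξ 0 := by positivity
  have i2 : 0 < 1 / xs ξ 0 * ys ξ 0 / xs ξ 1 := by positivity
  have i3 : 0 < 1 / xs ξ 0 * ys ξ 0 / xs ξ 1 * ys ξ 1 := by positivity
  have i4 : 0 < 1 / xs ξ 0 * ys ξ 0 / xs ξ 1 * ys ξ 1 / xs ξ 2 := by positivity
  have i5 : 0 < 1 / xs ξ 0 * ys ξ 0 / xs ξ 1 * ys ξ 1 / xs ξ 2 * ys ξ 2 := by positivity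
  fin_cases i
  · show 0 < Th ξ 0 ∧ Real.log (Th ξ 0) = lu ξ 0 + Real.log (1 - xs ξ 0) - Real.log (xs ξ 0)
    rw [g0]
    refine ⟨by positivity, ?_⟩
    rw [l2 (by positivity) x0, one_mul]
    simp [lu]
  · show 0 < Th ξ 1 ∧ Real.log (Th ξ 1) = lu ξ 1 - Real.log (1 - ys ξ 0)
    rw [g1]
    refine ⟨by positivity, ?_⟩
    rw [l2 i1 y0', l1 i0 y0, l2 one_pos x0, Real.log_one]
    simp only [lu, Matrix.cons_val]
    ring
  · show 0 < Th ξ 2 ∧ Real.log (Th ξ 2) = lu ξ 1 + Real.log (1 - xs ξ 1) - Real.log (xs ξ 1)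
    rw [g2]
    refine ⟨by positivity, ?_⟩
    rw [l2 (mul_pos i1 x1') x1, l1 i1 x1', l1 i0 y0, l2 one_pos x0, Real.log_one]
    simp only [lu, Matrix.cons_val]
    ring
  · show 0 < Th ξ 3 ∧ Real.log (Th ξ 3) = lu ξ 2 - Real.log (1 - ys ξ 1)
    rw [g3]
    refine ⟨by positivity, ?_⟩
    rw [l2 i3 y1', l1 i2 y1, l2 i1 x1, l1 i0 y0, l2 one_pos x0, Real.log_one]
    simp only [lu, Matrix.cons_val]
    ring
  · show 0 < Th ξ 4 ∧ Real.log (Th ξ 4) = lu ξ 2 + Real.log (1 - xs ξ 2) - Real.log (xs ξ 2)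
    rw [g4]
    refine ⟨by positivity, ?_⟩
    rw [l2 (mul_pos i3 x2') x2, l1 i3 x2', l1 i2 y1, l2 i1 x1, l1 i0 y0, l2 one_pos x0, Real.log_one]
    simp only [lu, Matrix.cons_val]
    ring
  · show 0 < Th ξ 5 ∧ Real.log (Th ξ 5) = lu ξ 3 - Real.log (1 - ys ξ 2)
    rw [g5]
    refine ⟨by positivity, ?_⟩
    rw [l2 i5 y2', l1 i4 y2, l2 i3 x2, l1 i2 y1, l2 i1 x1, l1 i0 y0, l2 one_pos x0, Real.log_one]
    simp only [lu, Matrix.cons_val]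
    ring
  · show 0 < Th ξ 6 ∧ Real.log (Th ξ 6) = lu ξ 3 + Real.log (1 - xs ξ 3) - Real.log (xs ξ 3)
    rw [g6]
    refine ⟨by positivity, ?_⟩
    rw [l2 (mul_pos i5 x3') x3, l1 i5 x3', l1 i4 y2, l2 i3 x2, l1 i2 y1, l2 i1 x1, l1 i0 y0, l2 one_pos x0, Real.log_one]
    simp only [lu, Matrix.cons_val]
    ring
  · show 0 < Th ξ 7 ∧ Real.log (Th ξ 7) = lu ξ 0 - Real.log (1 - ys ξ 3)
    rw [e7]
    refine ⟨by positivity, ?_⟩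
    rw [l2 one_pos y3', Real.log_one]
    simp [lu]

lemma Psi_log {ξ : Fin 7 → ℝ} (h : RR ξ) : 0 < Psi8 (Th ξ) ∧ Real.log (Psi8 (Th ξ)) = LP ξ := by
  have e : Psi8 (Th ξ) = (ys ξ 0 ^ 3 * ys ξ 1 ^ 2 * ys ξ 2 / (xs ξ 0 ^ 4 * xs ξ 1 ^ 3 * xs ξ 2 ^ 2 * xs ξ 3)) * (1 - qf ξ) ^ 2 /
      ((1 - ys ξ 0) * (1 - ys ξ 1) * (1 - ys ξ 2) * (1 - ys ξ 3)) := Psi_Tv h.Rg h.2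
  have x0 := (h.xs 0).1
  have x1 := (h.xs 1).1
  have x2 := (h.xs 2).1
  have x3 := (h.xs 3).1
  have y0 := (h.ys 0).1
  have y1 := (h.ys 1).1
  have y2 := (h.ys 2).1
  have y0' : 0 < 1 - ys ξ 0 := by linarith [(h.ys 0).2]
  have y1' : 0 < 1 - ys ξ 1 := by linarith [(h.ys 1).2]
  have y2' : 0 < 1 - ys ξ 2 := by linarith [(h.ys 2).2]
  have y3' : 0 < 1 - ys ξ 3 := by linarith [(h.ys 3).2]
  have hq : 0 < 1 - qf ξ := by linarith [h.q.2]
  rw [e]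
  refine ⟨by positivity, ?_⟩
  rw [Real.log_div (by positivity) (by positivity), Real.log_mul (by positivity) (by positivity), Real.log_div (by positivity) (by positivity),
    Real.log_mul (by positivity) (by positivity), Real.log_mul (by positivity) (by positivity), Real.log_mul (by positivity) (by positivity),
    Real.log_mul (by positivity) (by positivity), Real.log_mul (by positivity) (by positivity), Real.log_mul (by positivity) (by positivity),
    Real.log_mul (by positivity) (by positivity), Real.log_mul (by positivity) (by positivity)]
  simp only [Real.log_pow, LP, Rat.smul_def]
  push_cast
  ring

/-- the scale invariant logarithms -/
def Lf (j : Fin 8) : Option (Fin 8) → (Fin 8 → ℝ) → ℝ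
  | none, c => Real.log (Psi8 c / c j ^ 4)
  | some i, c => Real.log (c i / c j)

lemma Lf_Th (j : Fin 8) (o : Option (Fin 8)) : ∃ g ∈ GA, ∀ ξ, RR ξ → Lf j o (Th ξ) = g ξ := by
  cases o with
  | none =>
    refine ⟨LP - (4 : ℚ) • fun ξ => Lc ξ j, sub_mem GA_LP (GA.smul_mem (GA_Lc j) 4), fun ξ h => ?_⟩
    have h1 := Th_log h j
    have h2 := Psi_log h
    rw [Lf, Real.log_div h2.1.ne' (pow_pos h1.1 4).ne', Real.log_pow, h1.2, h2.2]
    simp [Rat.smul_def]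
  | some i =>
    refine ⟨(fun ξ => Lc ξ i) - fun ξ => Lc ξ j, sub_mem (GA_Lc i) (GA_Lc j), fun ξ h => ?_⟩
    have h1 := Th_log h j
    have h2 := Th_log h i
    rw [Lf, Real.log_div h2.1.ne' h1.1.ne', h1.2, h2.2]
    rfl

lemma Lf_prod (j : Fin 8) {ι : Type} (s : Finset ι) (o : ι → Option (Fin 8)) :
    Integrable (fun ξ => ∏ i ∈ s, Lf j (o i) (Th ξ)) rho ∧ ∫ ξ, ∏ i ∈ s, Lf j (o i) (Th ξ) ∂rho ∈ Z := by
  choose g hg hh using fun o => Lf_Th j o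
  have h1 := GA_int (prod_mem (t := s) fun i _ => hg (o i))
  have e : (fun ξ => ∏ i ∈ s, Lf j (o i) (Th ξ)) =ᵐ[rho] ∏ i ∈ s, g (o i) := by
    filter_upwards [ae_rho] with ξ h
    rw [Finset.prod_apply]
    exact prod_congr rfl fun i _ => hh _ _ h
  exact ⟨h1.1.congr e.symm, by rw [integral_congr_ae e]; exact h1.2⟩
end FW

namespace FW
open Filter Topology ENNReal

lemma Psi8_smul (t : ℝ) (c : Fin 8 → ℝ) : Psi8 (t • c) = t ^ 4 * Psi8 c := by
  simp only [Psi8, PsiW, Pi.smul_apply, smul_eq_mul]; ring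

lemma Psi8_meas : Measurable Psi8 := by
  unfold Psi8 PsiW; fun_prop

lemma Th_meas : Measurable Th := by
  have hT : Measurable fun ξ : Fin 7 → ℝ => Tv (ξ 0) (ξ 1) (ξ 2) (ξ 3) (ξ 4) (ξ 5) (ξ 6) := by
    refine measurable_pi_lambda _ fun i => ?_
    fin_cases i <;> simp only [Tv] <;> simp <;> fun_prop
  have hS : Measurable fun ξ : Fin 7 → ℝ => S4 (Tv (ξ 0) (ξ 1) (ξ 2) (ξ 3) (ξ 4) (ξ 5) (ξ 6)) 1 :=
    S4_meas.comp (hT.prodMk measurable_const)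
  exact (meas_ins (Fin.last 7)).comp (hS.prodMk hT)

lemma law0 (σ : Equiv.Perm (Fin 8)) {H : (Fin 8 → ℝ) → ℝ≥0∞} (hH : Measurable H)
    (hi : ∀ t : ℝ, 0 < t → ∀ c : Fin 8 → ℝ, (∀ i, 0 < c i) → H (t • c) = H c) :
    ∫⁻ η, ENNReal.ofReal ((Psi8 ((Fin.last 7).insertNth (α := fun _ => ℝ) 1 η ∘ σ)) ^ 2)⁻¹ * H ((Fin.last 7).insertNth (α := fun _ => ℝ) 1 η ∘ σ) ∂pw 7 Pm =
    ∫⁻ ξ, H (Th ξ) ∂rho := by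
  set F : (Fin 8 → ℝ) → ℝ≥0∞ := fun c => ENNReal.ofReal ((Psi8 c) ^ 2)⁻¹ * H c with hFd
  have hPm := Psi8_meas
  have hF : Measurable F := by rw [hFd]; fun_prop
  have hh : Hom8 F := by
    intro t ht c hc
    simp only [hFd]
    rw [hi t ht c hc, Psi8_smul, mul_pow, mul_inv, ← pow_mul, ENNReal.ofReal_mul (by positivity), mul_assoc]
  have hcσ : Measurable fun c : Fin 8 → ℝ => c ∘ σ := measurable_pi_lambda _ fun i => measurable_pi_apply (σ i)
  have h1 := chart (F := fun c => F (c ∘ σ)) (hF.comp hcσ) (fun t ht c hc => hh t ht (c ∘ σ) fun i => hc _)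
  have h2 := pi_perm Pm σ (fun c => gg (c (σ.symm (Fin.last 7))) * F c)
  simp only [Function.comp_apply, Equiv.apply_symm_apply] at h2
  have h3 := gauge hF hh (σ.symm (Fin.last 7))
  rw [h1, h3] at h2
  have h4 := (ENNReal.mul_right_inj L2_ne_zero L2_ne_top).1 h2
  have hv : Measurable fun v : Fin 7 → ℝ => (Fin.last 7).insertNth (α := fun _ => ℝ) (S4 v 1) v :=
    (meas_ins (Fin.last 7)).comp ((S4_meas.comp (measurable_id.prodMk measurable_const)).prodMk measurable_id)
  have hm : Measurable fun v : Fin 7 → ℝ => (if 1 < f4 v 1 then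
      ENNReal.ofReal (Jc v 1) * (ENNReal.ofReal ((Psi8 ((Fin.last 7).insertNth (S4 v 1) v)) ^ 2)⁻¹ * H ((Fin.last 7).insertNth (S4 v 1) v)) else 0) := by
    refine Measurable.ite (measurableSet_lt measurable_const (f4_meas.comp (measurable_id.prodMk measurable_const))) ?_ measurable_const
    exact (Jc_meas.comp (measurable_id.prodMk measurable_const)).ennreal_ofReal.mul (hF.comp hv)
  have h5 := iter_law hm
  have hm2 : Measurable fun ξ => H (Th ξ) := hH.comp Th_meas
  have hm3 : Measurable fun ξ => Dn ξ * H (Th ξ) := Dn_meas.mul hm2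
  rw [rho, lintegral_withDensity_eq_lintegral_mul _ Dn_meas hm2]
  have h6 := iter7 U hm3
  exact h4.trans (h5.trans h6.symm)

/-- the graph data needed for the law -/
structure PD (σ : Equiv.Perm (Fin 8)) (ψ φ : (Fin 6 → ℝ) → ℝ) : Prop where
  mψ : Measurable ψ
  mφ : Measurable φ
  pψ : ∀ y, (∀ i, 0 < y i) → 0 < ψ y
  pφ : ∀ y, (∀ i, 0 < y i) → 0 < φ y
  eq : ∀ a y, Psi8 (Fin.cons (α := fun _ => ℝ) a (Fin.snoc (α := fun _ => ℝ) y 1) ∘ σ) = a * ψ y + φ y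

def mu (ψ φ : (Fin 6 → ℝ) → ℝ) : Measure (Fin 6 → ℝ) := (pw 6 Pm).withDensity fun y => ENNReal.ofReal (ψ y * φ y)⁻¹

instance (ψ φ : (Fin 6 → ℝ) → ℝ) : SFinite (mu ψ φ) := by unfold mu; infer_instance

def cc (σ : Equiv.Perm (Fin 8)) (ψ φ : (Fin 6 → ℝ) → ℝ) (z : (Fin 6 → ℝ) × ℝ) : Fin 8 → ℝ :=
  Fin.cons (α := fun _ => ℝ) (φ z.1 / ψ z.1 * z.2 / (1 - z.2)) (Fin.snoc (α := fun _ => ℝ) z.1 1) ∘ σ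

lemma ins_cons (a : ℝ) (y : Fin 6 → ℝ) : (Fin.last 7).insertNth (α := fun _ => ℝ) 1 ((0 : Fin 7).insertNth (α := fun _ => ℝ) a y) =
    Fin.cons (α := fun _ => ℝ) a (Fin.snoc (α := fun _ => ℝ) y 1) := by
  rw [Fin.insertNth_last', Fin.insertNth_zero']
  exact (Fin.cons_snoc_eq_snoc_cons a y 1).symm

lemma cons_meas : Measurable fun z : ℝ × (Fin 6 → ℝ) => Fin.cons (α := fun _ => ℝ) z.1 (Fin.snoc (α := fun _ => ℝ) z.2 1) := by
  simp only [← ins_cons]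
  exact (meas_ins (Fin.last 7)).comp (measurable_const.prodMk (meas_ins 0))

lemma perm_meas (σ : Equiv.Perm (Fin 8)) : Measurable fun c : Fin 8 → ℝ => c ∘ σ :=
  measurable_pi_lambda _ fun i => measurable_pi_apply (σ i)

lemma PD.cc_meas {σ : Equiv.Perm (Fin 8)} {ψ φ : (Fin 6 → ℝ) → ℝ} (h : PD σ ψ φ) : Measurable (cc σ ψ φ) := by
  have h1 := h.mψ
  have h2 := h.mφ
  have : Measurable fun z : (Fin 6 → ℝ) × ℝ => (φ z.1 / ψ z.1 * z.2 / (1 - z.2), z.1) := by fun_prop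
  exact (perm_meas σ).comp (cons_meas.comp this)

lemma PD.law1 {σ : Equiv.Perm (Fin 8)} {ψ φ : (Fin 6 → ℝ) → ℝ} (h : PD σ ψ φ) {H : (Fin 8 → ℝ) → ℝ≥0∞} (hH : Measurable H)
    (hi : ∀ t : ℝ, 0 < t → ∀ c : Fin 8 → ℝ, (∀ i, 0 < c i) → H (t • c) = H c) :
    ∫⁻ z, H (cc σ ψ φ z) ∂((mu ψ φ).prod U) = ∫⁻ ξ, H (Th ξ) ∂rho := by
  have hPm := Psi8_meas
  have hHc : Measurable fun z => H (cc σ ψ φ z) := hH.comp h.cc_meas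
  have mψ := h.mψ
  have mφ := h.mφ
  rw [← law0 σ hH hi, lintegral_prod _ hHc.aemeasurable, mu,
    lintegral_withDensity_eq_lintegral_mul _ (by fun_prop) hHc.lintegral_prod_right']
  have hm : Measurable fun η : Fin 7 → ℝ => ENNReal.ofReal ((Psi8 ((Fin.last 7).insertNth (α := fun _ => ℝ) 1 η ∘ σ)) ^ 2)⁻¹ *
      H ((Fin.last 7).insertNth (α := fun _ => ℝ) 1 η ∘ σ) := by
    have h1 : Measurable fun η : Fin 7 → ℝ => (Fin.last 7).insertNth (α := fun _ => ℝ) 1 η ∘ σ :=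
      (perm_meas σ).comp ((meas_ins _).comp measurable_prodMk_left)
    fun_prop
  rw [pi_ins' Pm 0 hm]
  refine pw_congr fun y hy => ?_
  have p1 := h.pψ y hy
  have p2 := h.pφ y hy
  rw [sub2 (div_pos p2 p1)]
  show ENNReal.ofReal (ψ y * φ y)⁻¹ * ∫⁻ x, H (cc σ ψ φ (y, x)) ∂U = _
  rw [← lintegral_const_mul' _ _ ENNReal.ofReal_ne_top]
  refine U_congr fun x hx => ?_
  have hx1 : 0 < 1 - x := by linarith [hx.2]
  rw [ins_cons, h.eq, ← mul_assoc, ← ENNReal.ofReal_mul (by positivity)]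
  congr 2
  have : φ y / ψ y * x / (1 - x) * ψ y + φ y = φ y / (1 - x) := by field_simp; ring
  rw [this]
  field_simp

/-- normalization -/
def Nj (j : Fin 8) (c : Fin 8 → ℝ) : Fin 8 → ℝ := fun i => c i / c j

lemma Nj_meas (j : Fin 8) : Measurable (Nj j) := by
  unfold Nj; fun_prop

lemma PD.law2 {σ : Equiv.Perm (Fin 8)} {ψ φ : (Fin 6 → ℝ) → ℝ} (h : PD σ ψ φ) (j : Fin 8) :
    Measure.map (Nj j ∘ cc σ ψ φ) ((mu ψ φ).prod U) = Measure.map (Nj j ∘ Th) rho := by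
  refine Measure.ext fun s hs => ?_
  have m1 := (Nj_meas j).comp h.cc_meas
  have m2 := (Nj_meas j).comp Th_meas
  have hH : Measurable fun c => s.indicator (1 : (Fin 8 → ℝ) → ℝ≥0∞) (Nj j c) := (measurable_one.indicator hs).comp (Nj_meas j)
  have key := h.law1 hH (fun t ht c _ => by
    congr 1
    ext i
    simp only [Nj, Pi.smul_apply, smul_eq_mul]
    exact mul_div_mul_left _ _ ht.ne')
  rw [← lintegral_indicator_one hs, ← lintegral_indicator_one hs, lintegral_map (measurable_one.indicator hs) m1,
    lintegral_map (measurable_one.indicator hs) m2]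
  exact key

lemma Lf_Nj (j : Fin 8) (o : Option (Fin 8)) {c : Fin 8 → ℝ} (hc : 0 < c j) : Lf j o (Nj j c) = Lf j o c := by
  have e : Nj j c = (c j)⁻¹ • c := by ext i; simp [Nj, div_eq_inv_mul]
  cases o with
  | none => rw [Lf, Lf, e, Psi8_smul]; simp only [Pi.smul_apply, smul_eq_mul]; congr 1; field_simp
  | some i => rw [Lf, Lf]; simp only [Nj]; congr 1; field_simp

lemma Lf_meas (j : Fin 8) (o : Option (Fin 8)) : Measurable (Lf j o) := by
  have := Psi8_meas
  cases o with
  | none => show Measurable fun c => Real.log (Psi8 c / c j ^ 4); fun_prop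
  | some i => show Measurable fun c : Fin 8 → ℝ => Real.log (c i / c j); fun_prop

lemma cons_pos {a : ℝ} (ha : 0 < a) {y : Fin 6 → ℝ} (hy : ∀ i, 0 < y i) (i : Fin 8) :
    0 < Fin.cons (α := fun _ => ℝ) a (Fin.snoc (α := fun _ => ℝ) y 1) i := by
  rw [← ins_cons]
  refine sn_pos (fun i => ?_) one_pos i
  refine Fin.cases ?_ (fun i => ?_) i
  · simpa using ha
  · simpa using hy i

lemma mu_ae (ψ φ : (Fin 6 → ℝ) → ℝ) : ∀ᵐ y ∂mu ψ φ, ∀ i, 0 < y i :=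
  (withDensity_absolutelyContinuous _ _).ae_le (ae_pw ae_Pm 6)

lemma prod_ae (ψ φ : (Fin 6 → ℝ) → ℝ) : ∀ᵐ z ∂(mu ψ φ).prod U, (∀ i, 0 < z.1 i) ∧ z.2 ∈ Set.Ioo (0 : ℝ) 1 :=
  (Measure.quasiMeasurePreserving_fst.ae (mu_ae ψ φ)).and (Measure.quasiMeasurePreserving_snd.ae ae_U)

lemma PD.prod {σ : Equiv.Perm (Fin 8)} {ψ φ : (Fin 6 → ℝ) → ℝ} (h : PD σ ψ φ) (j : Fin 8) {ι : Type} (s : Finset ι) (o : ι → Option (Fin 8)) :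
    Integrable (fun z => ∏ i ∈ s, Lf j (o i) (cc σ ψ φ z)) ((mu ψ φ).prod U) ∧
    ∫ z, ∏ i ∈ s, Lf j (o i) (cc σ ψ φ z) ∂(mu ψ φ).prod U ∈ Z := by
  have h0 := Lf_prod j s o
  have m1 := (Nj_meas j).comp h.cc_meas
  have m2 := (Nj_meas j).comp Th_meas
  set g : (Fin 8 → ℝ) → ℝ := fun c => ∏ i ∈ s, Lf j (o i) c with hg
  have gm : Measurable g := Finset.measurable_fun_prod _ fun i _ => Lf_meas j (o i)
  have e1 : g ∘ (Nj j ∘ Th) =ᵐ[rho] fun ξ => g (Th ξ) := by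
    filter_upwards [ae_rho] with ξ hξ
    exact prod_congr rfl fun i _ => Lf_Nj _ _ (Th_log hξ j).1
  have e2 : g ∘ (Nj j ∘ cc σ ψ φ) =ᵐ[(mu ψ φ).prod U] fun z => g (cc σ ψ φ z) := by
    filter_upwards [prod_ae ψ φ] with z hz
    have hz1 : 0 < 1 - z.2 := by linarith [hz.2.2]
    have := h.pψ _ hz.1
    have := h.pφ _ hz.1
    have := hz.2.1
    exact prod_congr rfl fun i _ => Lf_Nj _ _ (cons_pos (by positivity) hz.1 _)
  have i1 : Integrable g (Measure.map (Nj j ∘ Th) rho) :=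
    (integrable_map_measure gm.aestronglyMeasurable m2.aemeasurable).2 (h0.1.congr e1.symm)
  have i2 : ∫ c, g c ∂(Measure.map (Nj j ∘ Th) rho) ∈ Z := by
    rw [integral_map m2.aemeasurable gm.aestronglyMeasurable]
    have := integral_congr_ae e1
    simp only [Function.comp_apply] at this
    simp only [Function.comp_apply]
    rw [this]; exact h0.2
  rw [← h.law2 j] at i1 i2
  refine ⟨((integrable_map_measure gm.aestronglyMeasurable m1.aemeasurable).1 i1).congr e2, ?_⟩
  rw [integral_map m1.aemeasurable gm.aestronglyMeasurable] at i2
  have := integral_congr_ae e2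
  simp only [Function.comp_apply] at this i2
  rw [this] at i2; exact i2
end FW

namespace FW
open Filter Topology ENNReal

instance U_prob : IsProbabilityMeasure U := ⟨by simp [U]⟩

lemma Tw_one (w : List Bool) : Tw w 1 = 1 := by
  induction w with
  | nil => rfl
  | cons b w ih => cases b <;> simp [Tw, dv_apply, Sm_apply, ih]

lemma TS_one {T : ℕ → ℝ} (hT : T ∈ TS Z) : T 1 ∈ Z := by
  induction hT using Submodule.span_induction with
  | mem x h => obtain ⟨w, rfl⟩ := h; rw [Tw_one]; exact one_mem Z
  | zero => exact zero_mem Z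
  | add x y _ _ h1 h2 => exact add_mem h1 h2
  | smul a x _ h => exact mul_mem a.2 h

lemma HZ_int_mem {f : ℝ → ℝ} (hf : f ∈ HZ []) : ∫ x, f x ∂U ∈ Z := by
  obtain ⟨T, hT, h⟩ := HZ_mom (k := 0) rfl hf
  have := (h 0).2
  simp at this
  rw [this]; exact TS_one hT

lemma HZ_prod {ι : Type} (s : Finset ι) (f : ι → ℝ → ℝ) (h : ∀ i, f i ∈ HZ []) : (fun x => ∏ i ∈ s, f i x) ∈ HZ [] := by
  classical
  induction s using Finset.induction_on with
  | empty => simpa using HZ_const (one_mem Z)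
  | insert a s ha ih =>
    simp only [prod_insert ha]
    exact HZ_mul (h a) ih

lemma deconv {Ω ι : Type} [MeasurableSpace Ω] (μ : Measure Ω) [SFinite μ] (L : ι → Ω → ℝ) (Y : ι → ℝ → ℝ)
    (hL : ∀ i, Measurable (L i)) (hY : ∀ i, Y i ∈ HZ [])
    (h : ∀ s : Finset ι, Integrable (fun z : Ω × ℝ => ∏ i ∈ s, (L i z.1 + Y i z.2)) (μ.prod U) ∧
      ∫ z, ∏ i ∈ s, (L i z.1 + Y i z.2) ∂(μ.prod U) ∈ Z) (s : Finset ι) :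
    Integrable (fun y => ∏ i ∈ s, L i y) μ ∧ ∫ y, ∏ i ∈ s, L i y ∂μ ∈ Z := by
  classical
  induction s using Finset.strongInduction with
  | H s ih =>
    obtain ⟨h1, h2⟩ := h s
    have hsub : ∀ t ∈ s.ssubsets, Integrable (fun z : Ω × ℝ => (∏ i ∈ t, L i z.1) * ∏ i ∈ s \ t, Y i z.2) (μ.prod U) := fun t ht =>
      (ih t (mem_ssubsets.1 ht)).1.mul_prod (HZ_int (HZ_prod (s \ t) Y hY))
    have e : ∀ z : Ω × ℝ, ∏ i ∈ s, L i z.1 = ∏ i ∈ s, (L i z.1 + Y i z.2) -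
        ∑ t ∈ s.ssubsets, (∏ i ∈ t, L i z.1) * ∏ i ∈ s \ t, Y i z.2 := by
      intro z
      rw [Finset.prod_add, ← Finset.insert_erase (mem_powerset_self s), sum_insert (by simp)]
      simp [ssubsets]
    have i1 : Integrable (fun z : Ω × ℝ => ∏ i ∈ s, L i z.1) (μ.prod U) := by
      simp_rw [e]
      exact h1.sub (integrable_finsetSum _ hsub)
    have mL : Measurable fun y => ∏ i ∈ s, L i y := Finset.measurable_fun_prod _ fun i _ => hL i
    have mp : MeasurePreserving (Prod.fst : Ω × ℝ → Ω) (μ.prod U) μ := measurePreserving_fst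
    refine ⟨(mp.integrable_comp mL.aestronglyMeasurable).1 i1, ?_⟩
    have e2 : ∫ y, ∏ i ∈ s, L i y ∂μ = ∫ z, ∏ i ∈ s, L i z.1 ∂(μ.prod U) := by
      conv_lhs => rw [← mp.map_eq]
      rw [integral_map mp.measurable.aemeasurable mL.aestronglyMeasurable]
    rw [e2]
    simp_rw [e]
    rw [integral_sub h1 (integrable_finsetSum _ hsub), integral_finsetSum _ hsub]
    refine sub_mem h2 (sum_mem fun t ht => ?_)
    rw [integral_prod_mul (fun y => ∏ i ∈ t, L i y) (fun x => ∏ i ∈ s \ t, Y i x)]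
    exact mul_mem (ih t (mem_ssubsets.1 ht)).2 (HZ_int_mem (HZ_prod _ Y hY))

/-- the logarithms on the propagator side -/
def Lo (ψ φ : (Fin 6 → ℝ) → ℝ) : Option (Fin 7) → (Fin 6 → ℝ) → ℝ
  | none => fun y => Real.log (ψ y ^ 4 / φ y ^ 3)
  | some i => fun y => Real.log ((Fin.snoc (α := fun _ => ℝ) y 1 : Fin 7 → ℝ) i * ψ y / φ y)

def Yo : Option (Fin 7) → ℝ → ℝ
  | none => fun x => 4 * -Real.log x - 3 * -Real.log (1 - x)
  | some _ => fun x => -Real.log x - -Real.log (1 - x)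

lemma Yo_HZ (o : Option (Fin 7)) : Yo o ∈ HZ [] := by
  cases o with
  | none =>
    exact sub_mem (HZ_mul (HZ_const (by exact_mod_cast natc_mem (K := Z) 4)) HZ_log0)
      (HZ_mul (HZ_const (by exact_mod_cast natc_mem (K := Z) 3)) HZ_log1)
  | some i => exact sub_mem HZ_log0 HZ_log1

lemma snoc_meas (i : Fin 7) : Measurable fun y : Fin 6 → ℝ => (Fin.snoc (α := fun _ => ℝ) y 1 : Fin 7 → ℝ) i := by
  refine Fin.lastCases ?_ (fun i => ?_) i
  · simp only [Fin.snoc_last]; exact measurable_const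
  · simp only [Fin.snoc_castSucc]; fun_prop

lemma Lo_meas {ψ φ : (Fin 6 → ℝ) → ℝ} (h1 : Measurable ψ) (h2 : Measurable φ) (o : Option (Fin 7)) : Measurable (Lo ψ φ o) := by
  cases o with
  | none => simp only [Lo]; fun_prop
  | some i => have := snoc_meas i; simp only [Lo]; fun_prop

lemma snoc_pos {y : Fin 6 → ℝ} (hy : ∀ i, 0 < y i) (i : Fin 7) : 0 < (Fin.snoc (α := fun _ => ℝ) y 1 : Fin 7 → ℝ) i := by
  refine Fin.lastCases ?_ (fun i => ?_) i
  · simp only [Fin.snoc_last]; exact one_pos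
  · simpa using hy i

def oo (σ : Equiv.Perm (Fin 8)) : Option (Fin 7) → Option (Fin 8) := Option.map fun i => σ.symm i.succ

lemma Lf_cc {σ : Equiv.Perm (Fin 8)} {ψ φ : (Fin 6 → ℝ) → ℝ} (h : PD σ ψ φ) (o : Option (Fin 7)) {y : Fin 6 → ℝ} (hy : ∀ i, 0 < y i)
    {x : ℝ} (hx : x ∈ Set.Ioo (0 : ℝ) 1) : Lf (σ.symm 0) (oo σ o) (cc σ ψ φ (y, x)) = Lo ψ φ o y + Yo o x := by
  have p1 := h.pψ y hy
  have p2 := h.pφ y hy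
  obtain ⟨x0, x1⟩ := hx
  have x2 : 0 < 1 - x := by linarith
  cases o with
  | none =>
    have e : Psi8 (cc σ ψ φ (y, x)) = φ y / (1 - x) := by
      rw [cc, h.eq]; field_simp; ring
    simp only [oo, Option.map_none, Lf, Lo, Yo, e]
    simp only [cc, Function.comp_apply, Equiv.apply_symm_apply, Fin.cons_zero]
    rw [Real.log_div (by positivity) (by positivity), Real.log_pow, Real.log_div (by positivity) (by positivity),
      Real.log_div (by positivity) (by positivity), Real.log_mul (by positivity) (by positivity),
      Real.log_div (by positivity) (by positivity), Real.log_div (by positivity) (by positivity), Real.log_pow, Real.log_pow]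
    push_cast; ring
  | some i =>
    have p3 := snoc_pos hy i
    simp only [oo, Option.map_some, Lf, Lo, Yo]
    simp only [cc, Function.comp_apply, Equiv.apply_symm_apply, Fin.cons_zero, Fin.cons_succ]
    rw [Real.log_div (by positivity) (by positivity), 
      Real.log_div (by positivity) (by positivity), Real.log_mul (by positivity) (by positivity),
      Real.log_div (by positivity) (by positivity), Real.log_div (by positivity) (by positivity), Real.log_mul (by positivity) (by positivity)]
    ring

lemma PD.fin {σ : Equiv.Perm (Fin 8)} {ψ φ : (Fin 6 → ℝ) → ℝ} (h : PD σ ψ φ) {ι : Type} (s : Finset ι) (o : ι → Option (Fin 7)) :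
    Integrable (fun y => ∏ i ∈ s, Lo ψ φ (o i) y) (mu ψ φ) ∧ ∫ y, ∏ i ∈ s, Lo ψ φ (o i) y ∂mu ψ φ ∈ Z := by
  refine deconv (mu ψ φ) (fun i => Lo ψ φ (o i)) (fun i => Yo (o i)) (fun i => Lo_meas h.mψ h.mφ _) (fun i => Yo_HZ _) (fun s => ?_) s
  have h0 := h.prod (σ.symm 0) s (fun i => oo σ (o i))
  have e : (fun z : (Fin 6 → ℝ) × ℝ => ∏ i ∈ s, Lf (σ.symm 0) (oo σ (o i)) (cc σ ψ φ z)) =ᵐ[(mu ψ φ).prod U]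
      fun z => ∏ i ∈ s, (Lo ψ φ (o i) z.1 + Yo (o i) z.2) := by
    filter_upwards [prod_ae ψ φ] with z hz
    exact prod_congr rfl fun i _ => Lf_cc h (o i) hz.1 hz.2
  exact ⟨h0.1.congr e, by rw [← integral_congr_ae e]; exact h0.2⟩

lemma PD.fin2 {σ : Equiv.Perm (Fin 8)} {ψ φ : (Fin 6 → ℝ) → ℝ} (h : PD σ ψ φ) (k : ℕ) (kk : Fin 7 → ℕ) :
    Integrable (fun y => Lo ψ φ none y ^ k * ∏ i, Lo ψ φ (some i) y ^ kk i) (mu ψ φ) ∧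
    ∫ y, Lo ψ φ none y ^ k * ∏ i, Lo ψ φ (some i) y ^ kk i ∂mu ψ φ ∈ Z := by
  let n : Option (Fin 7) → ℕ := fun o => o.elim k kk
  have h0 := h.fin (Finset.univ : Finset (Σ o : Option (Fin 7), Fin (n o))) Sigma.fst
  have e : ∀ y, ∏ i : (Σ o : Option (Fin 7), Fin (n o)), Lo ψ φ i.1 y = Lo ψ φ none y ^ k * ∏ i, Lo ψ φ (some i) y ^ kk i := by
    intro y
    rw [Fintype.prod_sigma, Fintype.prod_option]
    simp only [prod_const, card_univ, Fintype.card_fin]; rfl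
  simp only [e] at h0
  exact h0

lemma PD.fin3 {σ : Equiv.Perm (Fin 8)} {ψ φ : (Fin 6 → ℝ) → ℝ} (h : PD σ ψ φ) (k : ℕ) (kk : Fin 7 → ℕ) :
    IntegrableOn (fun y => (ψ y * φ y)⁻¹ * (Lo ψ φ none y ^ k * ∏ i, Lo ψ φ (some i) y ^ kk i)) (posOrthant 6) volume ∧
    ∫ y in posOrthant 6, (ψ y * φ y)⁻¹ * (Lo ψ φ none y ^ k * ∏ i, Lo ψ φ (some i) y ^ kk i) ∈ Z := by
  have e : (volume : Measure (Fin 6 → ℝ)).restrict (posOrthant 6) = pw 6 Pm := by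
    rw [posOrthant, volume_pi, Measure.restrict_pi_pi]; rfl
  have h0 := h.fin2 k kk
  rw [IntegrableOn, e]
  have m1 := h.mψ
  have m2 := h.mφ
  have md : Measurable fun y => ENNReal.ofReal (ψ y * φ y)⁻¹ := by fun_prop
  have ec : ∀ᵐ y ∂pw 6 Pm, (ENNReal.ofReal (ψ y * φ y)⁻¹).toReal • (Lo ψ φ none y ^ k * ∏ i, Lo ψ φ (some i) y ^ kk i) =
      (ψ y * φ y)⁻¹ * (Lo ψ φ none y ^ k * ∏ i, Lo ψ φ (some i) y ^ kk i) := by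
    filter_upwards [ae_pw ae_Pm 6] with y hy
    have p1 := h.pψ y hy
    have p2 := h.pφ y hy
    rw [ENNReal.toReal_ofReal (by positivity), smul_eq_mul]
  constructor
  · refine Integrable.congr ?_ ec
    exact (integrable_withDensity_iff_integrable_smul' md (by simp)).1 h0.1
  · rw [← integral_congr_ae ec, ← integral_withDensity_eq_integral_toReal_smul md (by simp)]
    exact h0.2
end FW

namespace FW
open Filter Topology ENNReal

section graph
variable {V : Type}

lemma conn_sup {G : SimpleGraph V} {u v : V} (h : ¬ G.Reachable u v) :
    (G ⊔ edge u v).Connected ↔ Nat.card G.ConnectedComponent = 2 := by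
  have huv : u ≠ v := fun e => h (e ▸ Reachable.refl _)
  have hne : G.connectedComponentMk u ≠ G.connectedComponentMk v := fun e => h (ConnectedComponent.exact e)
  have hadj : (G ⊔ edge u v).Adj u v := by simp [edge_adj, huv]
  constructor
  · intro hc
    rw [Nat.card_eq_two_iff]
    refine ⟨_, _, hne, Set.eq_univ_of_forall fun c => ?_⟩
    induction c using ConnectedComponent.ind with
    | h w =>
      by_contra hw
      let S : Set V := {w | G.Reachable w u ∨ G.Reachable w v}
      have hwS : w ∉ S := by
        rintro (h1 | h1)
        · exact hw (Or.inl (ConnectedComponent.sound h1))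
        · exact hw (Or.inr (ConnectedComponent.sound h1))
      obtain ⟨p⟩ := hc.preconnected u w
      obtain ⟨d, -, d1, d2⟩ := p.exists_boundary_dart S (Or.inl (Reachable.refl _)) hwS
      rcases d.adj with h1 | h1
      · exact d2 (d1.imp h1.symm.reachable.trans h1.symm.reachable.trans)
      · rw [edge_adj] at h1
        rcases h1.1 with h2 | h2
        · exact d2 (Or.inr (by rw [h2.2]))
        · exact d2 (Or.inl (by rw [h2.2]))
  · intro hc
    obtain ⟨x, y, hxy, hu⟩ := Nat.card_eq_two_iff.1 hc
    have key : ∀ w, (G ⊔ edge u v).Reachable w u := by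
      intro w
      have h1 : ∀ c : G.ConnectedComponent, c = x ∨ c = y := fun c => by
        have : c ∈ ({x, y} : Set _) := hu ▸ Set.mem_univ c
        simpa using this
      have h2 : G.connectedComponentMk w = G.connectedComponentMk u ∨ G.connectedComponentMk w = G.connectedComponentMk v := by
        have a1 := h1 (G.connectedComponentMk w)
        have a2 := h1 (G.connectedComponentMk u)
        have a3 := h1 (G.connectedComponentMk v)
        grind
      rcases h2 with h2 | h2
      · exact (ConnectedComponent.exact h2).mono le_sup_left
      · exact ((ConnectedComponent.exact h2).mono le_sup_left).trans hadj.symm.reachable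
    exact { preconnected := fun a b => (key a).trans (key b).symm, nonempty := ⟨u⟩ }

lemma tree_sup {G : SimpleGraph V} {u v : V} (huv : u ≠ v) (h : ¬ G.Adj u v) :
    (G ⊔ edge u v).IsTree ↔ G.IsAcyclic ∧ Nat.card G.ConnectedComponent = 2 ∧ ¬ G.Reachable u v := by
  rw [isTree_iff, isAcyclic_sup_fromEdgeSet_iff]
  by_cases hr : G.Reachable u v
  · simp [hr, huv, h]
  · rw [conn_sup hr]; simp [hr]; tauto

variable [Fintype V] [DecidableEq V]

lemma sum_fin_succ {m : ℕ} (f : Finset (Fin (m + 1)) → ℝ) : ∑ S, f S =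
    ∑ S : Finset (Fin m), f (S.map (Fin.succEmb m)) + ∑ S : Finset (Fin m), f (insert 0 (S.map (Fin.succEmb m))) := by
  have e : (univ : Finset (Finset (Fin (m + 1)))) = (insert 0 ((univ : Finset (Fin m)).map (Fin.succEmb m))).powerset := by
    ext S; simp only [mem_univ, mem_powerset, true_iff]
    intro i _
    refine Fin.cases ?_ (fun i => ?_) i <;> simp
  rw [e, sum_powerset_insert (by simp)]
  have e2 : ((univ : Finset (Fin m)).map (Fin.succEmb m)).powerset = (univ : Finset (Finset (Fin m))).map (mapEmbedding (Fin.succEmb m)).toEmbedding := by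
    ext S
    simp [subset_map_iff, eq_comm]
  rw [e2, sum_map, sum_map]; rfl

lemma psi_cons {m : ℕ} (ed : Fin m → Sym2 V) {u v : V} (huv : u ≠ v) (hed : ∀ i, ed i ≠ s(u, v)) (a : ℝ) (x : Fin m → ℝ) :
    psiI (Fin.cons (α := fun _ => Sym2 V) s(u, v) ed) (Fin.cons (α := fun _ => ℝ) a x) = a * psiI ed x + phiI ed u v x := by
  classical
  unfold psiI phiI
  rw [sum_fin_succ, mul_sum]
  have c1 : ∀ S : Finset (Fin m), (S.map (Fin.succEmb m))ᶜ = insert 0 (Sᶜ.map (Fin.succEmb m)) := by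
    intro S; ext i; refine Fin.cases ?_ (fun i => ?_) i <;> simp
  have c2 : ∀ S : Finset (Fin m), (insert 0 (S.map (Fin.succEmb m)))ᶜ = Sᶜ.map (Fin.succEmb m) := by
    intro S; ext i; refine Fin.cases ?_ (fun i => ?_) i <;> simp
  have c3 : ∀ S : Finset (Fin m), (S.map (Fin.succEmb m)).image (Fin.cons (α := fun _ => Sym2 V) s(u, v) ed) = S.image ed := by
    intro S; rw [map_eq_image, image_image]; congr 1
  congr 1
  · refine sum_congr rfl fun S _ => ?_
    rw [c1, c3, prod_insert (by simp), prod_map, mul_ite, mul_zero]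
    rfl
  · refine sum_congr rfl fun S _ => ?_
    rw [c2, image_insert, c3, prod_map]
    have e1 : fromEdgeSet (↑(insert (Fin.cons (α := fun _ => Sym2 V) s(u, v) ed 0) (S.image ed)) : Set (Sym2 V)) =
        fromEdgeSet (↑(S.image ed) : Set (Sym2 V)) ⊔ edge u v := by
      rw [Fin.cons_zero, coe_insert, Set.insert_eq, Set.union_comm, edge, fromEdgeSet_union]
    have na : ¬ (fromEdgeSet (↑(S.image ed) : Set (Sym2 V))).Adj u v := by
      rw [fromEdgeSet_adj]
      rintro ⟨h1, -⟩
      simp only [coe_image, Set.mem_image] at h1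
      obtain ⟨i, -, hi⟩ := h1
      exact hed i hi
    have e2 := tree_sup huv na
    rw [e1]
    simp only [e2]
    rfl

lemma psi_perm {m : ℕ} (ed : Fin m → Sym2 V) (x : Fin m → ℝ) (σ : Equiv.Perm (Fin m)) : psiI (ed ∘ σ) (x ∘ σ) = psiI ed x := by
  classical
  unfold psiI
  refine Fintype.sum_equiv (Equiv.finsetCongr σ) _ _ fun S => ?_
  have e1 : (Equiv.finsetCongr σ S).image ed = S.image (ed ∘ σ) := by
    rw [Equiv.finsetCongr_apply, map_eq_image, image_image]; rfl
  have e2 : ∏ i ∈ (Equiv.finsetCongr σ S)ᶜ, x i = ∏ i ∈ Sᶜ, (x ∘ σ) i := by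
    have : (Equiv.finsetCongr σ S)ᶜ = Sᶜ.map σ.toEmbedding := by
      ext i; simp [Equiv.finsetCongr_apply, mem_map_equiv]
    rw [this, prod_map]; rfl
  rw [e1, e2]
end graph

def pe : Fin 8 → Fin 5 := ![1, 0, 2, 0, 3, 0, 4, 0]
def qe : Fin 8 → Fin 5 := ![2, 2, 3, 3, 4, 4, 1, 1]
def can (i : Fin 8) : Sym2 (Fin 5) := s(pe i, qe i)

lemma can_inj : Function.Injective can := by decide
lemma can_ne (i : Fin 8) : pe i ≠ qe i := by revert i; decide

lemma conn_can (S : Finset (Fin 8)) : (fromEdgeSet (↑(S.image can) : Set (Sym2 (Fin 5)))).Connected ↔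
    ∀ A : Finset (Fin 5), 0 ∈ A → A ≠ univ → ∃ i ∈ S, ¬ (pe i ∈ A ↔ qe i ∈ A) := by
  classical
  set G := fromEdgeSet (↑(S.image can) : Set (Sym2 (Fin 5))) with hG
  have adj : ∀ a b, G.Adj a b ↔ ∃ i ∈ S, can i = s(a, b) := by
    intro a b
    rw [hG, fromEdgeSet_adj]
    simp only [coe_image, Set.mem_image, mem_coe]
    refine ⟨fun h => h.1, fun ⟨i, hi, h⟩ => ⟨⟨i, hi, h⟩, fun e => ?_⟩⟩
    subst e
    have := can_ne i
    simp only [can, Sym2.eq_iff] at h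
    grind
  constructor
  · intro hc A h0 hA
    obtain ⟨w, hw⟩ : ∃ w, w ∉ A := by
      by_contra! h; exact hA (eq_univ_of_forall h)
    obtain ⟨p⟩ := hc.preconnected 0 w
    obtain ⟨d, -, d1, d2⟩ := p.exists_boundary_dart (↑A) (mem_coe.2 h0) (by simpa using hw)
    obtain ⟨i, hi, h⟩ := (adj _ _).1 d.adj
    refine ⟨i, hi, ?_⟩
    rw [can, Sym2.eq_iff] at h
    simp only [mem_coe] at d1 d2
    grind
  · intro h
    have key : ∀ w, G.Reachable 0 w := by
      by_contra! hw
      obtain ⟨w, hw⟩ := hw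
      obtain ⟨i, hi, hn⟩ := h (univ.filter fun a => G.Reachable 0 a) (by simp) (fun e => hw (by
        have : w ∈ (univ : Finset (Fin 5)) := mem_univ w
        rw [← e] at this; simpa using this))
      have ha : G.Adj (pe i) (qe i) := (adj _ _).2 ⟨i, hi, rfl⟩
      simp only [mem_filter, mem_univ, true_and] at hn
      exact hn ⟨fun h => h.trans ha.reachable, fun h => h.trans ha.symm.reachable⟩
    exact { preconnected := fun a b => (key a).symm.trans (key b), nonempty := ⟨0⟩ }

lemma tree_can (S : Finset (Fin 8)) : (fromEdgeSet (↑(S.image can) : Set (Sym2 (Fin 5)))).IsTree ↔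
    S.card = 4 ∧ ∀ A : Finset (Fin 5), 0 ∈ A → A ≠ univ → ∃ i ∈ S, ¬ (pe i ∈ A ↔ qe i ∈ A) := by
  rw [isTree_iff_connected_and_card, conn_can, and_comm]
  refine and_congr_left fun _ => ?_
  have : (fromEdgeSet (↑(S.image can) : Set (Sym2 (Fin 5)))).edgeSet = ↑(S.image can) := by
    rw [edgeSet_fromEdgeSet, sdiff_eq_left, Set.disjoint_left]
    intro e he
    simp only [coe_image, Set.mem_image] at he
    obtain ⟨i, -, rfl⟩ := he
    simpa [can] using can_ne i
  rw [this, Nat.card_eq_card_toFinset]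
  simp [card_image_of_injective _ can_inj]

def TL : List (List (Fin 8)) := [[0, 1, 3, 5], [0, 1, 3, 6], [0, 1, 3, 7], [0, 1, 4, 5], [0, 1, 4, 6], [0, 1, 4, 7], [0, 1, 5, 6], [0, 1, 5, 7], [0, 2, 3, 5], [0, 2, 3, 6], [0, 2, 3, 7], [0, 2, 4, 5], [0, 2, 4, 6], [0, 2, 4, 7], [0, 2, 5, 6], [0, 2, 5, 7], [0, 3, 4, 5], [0, 3, 4, 6], [0, 3, 4, 7], [0, 3, 5, 6], [0, 3, 5, 7], [1, 2, 3, 5], [1, 2, 3, 6], [1, 2, 3, 7], [1, 2, 4, 5], [1, 2, 4, 6], [1, 2, 4, 7], [1, 2, 5, 6], [1, 2, 5, 7], [1, 3, 4, 5], [1, 3, 4, 6], [1, 3, 4, 7], [1, 3, 5, 6], [1, 3, 6, 7], [1, 4, 5, 7], [1, 4, 6, 7], [1, 5, 6, 7], [2, 3, 5, 7], [2, 3, 6, 7], [2, 4, 5, 7], [2, 4, 6, 7], [2, 5, 6, 7], [3, 4, 5, 7], [3, 4, 6, 7], [3, 5, 6, 7]]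

lemma TL_spec : ∀ S : Finset (Fin 8), (Sᶜ.card = 4 ∧ ∀ A : Finset (Fin 5), 0 ∈ A → A ≠ univ → ∃ i ∈ Sᶜ, ¬ (pe i ∈ A ↔ qe i ∈ A)) ↔
    S ∈ TL.map List.toFinset := by
  decide +kernel

lemma psi_can (x : Fin 8 → ℝ) : psiI can x = Psi8 x := by
  classical
  have h1 : psiI can x = ∑ S : Finset (Fin 8), if S ∈ (TL.map List.toFinset).toFinset then ∏ i ∈ S, x i else 0 := by
    unfold psiI
    refine Fintype.sum_bijective compl compl_bijective _ _ fun S => ?_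
    have h2 := tree_can S
    have h3 := TL_spec Sᶜ
    rw [compl_compl] at h3
    simp only [h2, h3, List.mem_toFinset]
  rw [h1, ← sum_filter, filter_mem_eq_inter, univ_inter, List.sum_toFinset _ (by decide +kernel), List.map_map]
  have h4 : ∀ l ∈ TL, ((fun S => ∏ i ∈ S, x i) ∘ List.toFinset) l = (l.map x).prod := by
    intro l hl
    have hn : ∀ l ∈ TL, l.Nodup := by decide +kernel
    exact List.prod_toFinset _ (hn l hl)
  rw [List.map_congr_left h4]
  simp only [TL, List.map_cons, List.map_nil, List.sum_cons, List.sum_nil, List.prod_cons, List.prod_nil, Psi8, PsiW]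
  ring

lemma pos0 (j : Fin 8) (c : Fin 8 → ℝ) (h : ∀ i, i ≠ j → 0 < c i) (h0 : c j = 0) : 0 < Psi8 c := by
  unfold Psi8 PsiW
  have H : ∀ i : Fin 8, i = j ∨ 0 < c i := fun i => or_iff_not_imp_left.2 (h i)
  have a0 := H 0
  have a1 := H 1
  have a2 := H 2
  have a3 := H 3
  have a4 := H 4
  have a5 := H 5
  have a6 := H 6
  have a7 := H 7
  clear H h
  fin_cases j <;> simp at h0 a0 a1 a2 a3 a4 a5 a6 a7 <;> rw [h0] <;> ring_nf <;> positivity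

lemma pos1 (j : Fin 8) (c c' : Fin 8 → ℝ) (h : ∀ i, i ≠ j → 0 < c i ∧ c' i = c i) (h0 : c j = 0) (h1 : c' j = 1) : 0 < Psi8 c' - Psi8 c := by
  unfold Psi8 PsiW
  have H : ∀ i : Fin 8, i = j ∨ (0 < c i ∧ c' i = c i) := fun i => or_iff_not_imp_left.2 (h i)
  have a0 := H 0
  have a1 := H 1
  have a2 := H 2
  have a3 := H 3
  have a4 := H 4
  have a5 := H 5
  have a6 := H 6
  have a7 := H 7
  clear H h
  fin_cases j <;> simp at h0 h1 a0 a1 a2 a3 a4 a5 a6 a7 <;> simp only [h0, h1, a0, a1, a2, a3, a4, a5, a6, a7] <;> ring_nf <;>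
    cases' a0 with a0 <;> cases' a1 with a1 <;> cases' a2 with a2 <;> cases' a3 with a3 <;> cases' a4 with a4 <;>
    cases' a5 with a5 <;> cases' a6 with a6 <;> cases' a7 with a7 <;> positivity

lemma W4_range : Set.range can = W4.edgeSet := by
  rw [W4, edgeSet_fromEdgeSet]
  ext e
  constructor
  · rintro ⟨i, rfl⟩
    refine ⟨?_, by simpa [can] using can_ne i⟩
    fin_cases i <;> simp [can, pe, qe]
  · rintro ⟨h, -⟩
    have q : ∀ i, can i ∈ Set.range can := fun i => ⟨i, rfl⟩
    simp only [Set.mem_insert_iff, Set.mem_singleton_iff] at h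
    rcases h with rfl | rfl | rfl | rfl | rfl | rfl | rfl | rfl
    · exact q 7
    · exact q 1
    · exact q 3
    · exact q 5
    · exact q 0
    · exact q 2
    · exact q 4
    · exact q 6

lemma exists_PD {u v : Fin 5} (he0 : s(u, v) ∈ W4.edgeSet) {ed : Fin 7 → Sym2 (Fin 5)} (hinj : Function.Injective ed)
    (hrange : Set.range ed = (W4.deleteEdges {s(u, v)}).edgeSet) :
    ∃ σ, PD σ (fun y => psiI ed (Fin.snoc (α := fun _ => ℝ) y 1)) (fun y => phiI ed u v (Fin.snoc (α := fun _ => ℝ) y 1)) := by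
  classical
  have huv : u ≠ v := W4.ne_of_adj he0
  rw [edgeSet_deleteEdges] at hrange
  have hed : ∀ i, ed i ≠ s(u, v) := fun i e => by
    have : ed i ∈ W4.edgeSet \ {s(u, v)} := hrange ▸ Set.mem_range_self i
    exact this.2 e
  set full : Fin 8 → Sym2 (Fin 5) := Fin.cons (α := fun _ => Sym2 (Fin 5)) s(u, v) ed with hfull
  have fi : Function.Injective full := Fin.cons_injective_iff.2 ⟨fun ⟨i, hi⟩ => hed i hi, hinj⟩
  have fr : Set.range full = Set.range can := by
    rw [hfull, Fin.range_cons, hrange, W4_range, Set.insert_sdiff_singleton, Set.insert_eq_of_mem he0]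
  let σ : Equiv.Perm (Fin 8) := (Equiv.ofInjective can can_inj).trans ((Equiv.setCongr fr.symm).trans (Equiv.ofInjective full fi).symm)
  have hσ : full ∘ σ = can := by
    ext1 i
    simp only [σ, Function.comp_apply, Equiv.trans_apply]
    rw [Equiv.apply_ofInjective_symm fi]
    rfl
  have key : ∀ (a : ℝ) (x : Fin 7 → ℝ), Psi8 (Fin.cons (α := fun _ => ℝ) a x ∘ σ) = a * psiI ed x + phiI ed u v x := by
    intro a x
    rw [← psi_can, ← hσ, psi_perm, psi_cons ed huv hed]
  have cj : ∀ (a : ℝ) (x : Fin 7 → ℝ), (Fin.cons (α := fun _ => ℝ) a x ∘ σ) (σ.symm 0) = a := by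
    intro a x; simp
  have ci : ∀ (a : ℝ) (y : Fin 6 → ℝ), (∀ i, 0 < y i) → ∀ i, i ≠ σ.symm 0 →
      0 < (Fin.cons (α := fun _ => ℝ) 0 (Fin.snoc (α := fun _ => ℝ) y 1) ∘ σ) i ∧
      (Fin.cons (α := fun _ => ℝ) a (Fin.snoc (α := fun _ => ℝ) y 1) ∘ σ) i = (Fin.cons (α := fun _ => ℝ) 0 (Fin.snoc (α := fun _ => ℝ) y 1) ∘ σ) i := by
    intro a y hy i hi
    simp only [Function.comp_apply]
    obtain ⟨k, hk⟩ := Fin.exists_succ_eq.2 (fun e : σ i = 0 => hi (by rw [← e]; simp))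
    rw [← hk, Fin.cons_succ, Fin.cons_succ]
    exact ⟨snoc_pos hy k, rfl⟩
  refine ⟨σ, ?_, ?_, ?_, ?_, ?_⟩
  · unfold psiI
    refine Finset.measurable_fun_sum _ fun S _ => ?_
    split_ifs
    · exact Finset.measurable_fun_prod _ fun i _ => snoc_meas i
    · exact measurable_const
  · unfold phiI
    refine Finset.measurable_fun_sum _ fun S _ => ?_
    split_ifs
    · exact Finset.measurable_fun_prod _ fun i _ => snoc_meas i
    · exact measurable_const
  · intro y hy
    have := pos1 (σ.symm 0) _ _ (ci 1 y hy) (cj _ _) (cj _ _)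
    rw [key, key] at this
    linarith
  · intro y hy
    have := pos0 (σ.symm 0) _ (fun i hi => (ci 0 y hy i hi).1) (cj _ _)
    rw [key] at this
    linarith
  · intro a y; exact key a _

lemma main (u v : Fin 5) (he0 : s(u, v) ∈ W4.edgeSet)
    (ed : Fin 7 → Sym2 (Fin 5)) (hinj : Function.Injective ed)
    (hrange : Set.range ed = (W4.deleteEdges {s(u, v)}).edgeSet)
    (k : ℕ) (kk : Fin 7 → ℕ) :
    IntegrableOn (fun y : Fin 6 → ℝ => coeffIntegrand ed u v (-1) (-1) 4 3 k kk y) (posOrthant 6) volume ∧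
      (∫ y in posOrthant 6, coeffIntegrand ed u v (-1) (-1) 4 3 k kk y) ∈ Submodule.span ℚ (insert (1 : ℝ) mzvSet) := by
  obtain ⟨σ, h⟩ := exists_PD he0 hinj hrange
  have h0 := h.fin3 k kk
  have e : ∀ y, coeffIntegrand ed u v (-1) (-1) 4 3 k kk y = (psiI ed (Fin.snoc (α := fun _ => ℝ) y 1) * phiI ed u v (Fin.snoc (α := fun _ => ℝ) y 1))⁻¹ *
      (Lo (fun y => psiI ed (Fin.snoc (α := fun _ => ℝ) y 1)) (fun y => phiI ed u v (Fin.snoc (α := fun _ => ℝ) y 1)) none y ^ k *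
      ∏ i, Lo (fun y => psiI ed (Fin.snoc (α := fun _ => ℝ) y 1)) (fun y => phiI ed u v (Fin.snoc (α := fun _ => ℝ) y 1)) (some i) y ^ kk i) := by
    intro y
    simp only [coeffIntegrand, Lo, zpow_neg_one, mul_inv, mul_assoc]
  simp only [e]
  exact ⟨h0.1, Z_le h0.2⟩
end FW

/-- Theorem 1 of the paper for the three-loop propagators `Q`, `V` (cuts of the wheel
`W₄`): every coefficient integral `∫_{(0,∞)^6} (ψφ)⁻¹ lnᵏ(ψ⁴/φ³) ∏ᵢ ln^{kᵢ}(αᵢψ/φ)` in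
the chart `α₇ = 1` is absolutely convergent and is a rational linear combination of
`1` and multiple zeta values. -/
theorem statement7 (u v : Fin 5) (he0 : s(u, v) ∈ W4.edgeSet)
    (ed : Fin 7 → Sym2 (Fin 5)) (hinj : Function.Injective ed)
    (hrange : Set.range ed = (W4.deleteEdges {s(u, v)}).edgeSet)
    (k : ℕ) (kk : Fin 7 → ℕ) :
    IntegrableOn (fun y : Fin 6 → ℝ => coeffIntegrand ed u v (-1) (-1) 4 3 k kk y) (posOrthant 6) volume ∧
      (∫ y in posOrthant 6, coeffIntegrand ed u v (-1) (-1) 4 3 k kk y) ∈ Submodule.span ℚ (insert (1 : ℝ) mzvSet) := by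
  exact FW.main u v he0 ed hinj hrange k kk
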